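/- Assume G is a good normal subgroup of W~. Let V~ = V~_1 ⊕ V~_2 be a decomposition into W~-stable subspaces, let W~_1 be the pointwise stabilizer of V~_2 in W~ and W~_2 the pointwise stabilizer of V~_1, and set G_1 = G ∩ W~_1 and G_2 = G ∩ W~_2. Then G_1 is a good normal subgroup of the reflection group W~_1, G_2 is a good normal subgroup of W~_2, G_1 × G_2 is a good normal subgroup of W~, and G/(G_1 × G_2) is a good normal subgroup of the reflection group W~/(G_1 × G_2) acting on the tangent space at 0 of V~/(G_1 × G_2). -/

import Mathlib

open MvPolynomial

noncomputable section

namespace ReflQuot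

variable {k : Type} [Field k]

/-- The action of an invertible matrix `g` on polynomial functions on `k^n`:
the linear form `X i` is sent to `∑ j, (g⁻¹) i j • X j`, so that
`(g • f) (v) = f (g⁻¹ ⬝ v)`. -/
def matAct {n : ℕ} (g : Matrix.GeneralLinearGroup (Fin n) k) :
    MvPolynomial (Fin n) k →ₐ[k] MvPolynomial (Fin n) k :=
  aeval fun i => ∑ j, ((↑(g⁻¹) : Matrix (Fin n) (Fin n) k) i j) • X j

/-- The algebra endomorphism of `k[X_1,…,X_m]` sending `X i` to `∑ j, M i j • X j`. -/
def polyAct {m : ℕ} (M : Fin m → Fin m → k) :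
    MvPolynomial (Fin m) k →ₐ[k] MvPolynomial (Fin m) k :=
  aeval fun i => ∑ j, M i j • X j

/-- A reflection: an automorphism of finite order whose fixed-point subspace is a
hyperplane. -/
def IsReflection {n : ℕ} (M : Matrix (Fin n) (Fin n) k) : Prop :=
  IsOfFinOrder M ∧
    Module.finrank k (LinearMap.ker (Matrix.toLin' M - LinearMap.id)) + 1 = n

/-- A double reflection: finite order, fixed points of codimension 2. -/
def IsDoubleReflection {n : ℕ} (M : Matrix (Fin n) (Fin n) k) : Prop :=
  IsOfFinOrder M ∧
    Module.finrank k (LinearMap.ker (Matrix.toLin' M - LinearMap.id)) + 2 = n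

/-- A reflection group: a group generated by its reflections. -/
def IsReflectionGroup {n : ℕ} (W : Subgroup (Matrix.GeneralLinearGroup (Fin n) k)) : Prop :=
  Subgroup.closure {g | g ∈ W ∧ IsReflection ((g : Matrix (Fin n) (Fin n) k))} = W

/-- The algebra of `G`-invariant polynomials. -/
def invariants {n : ℕ} (G : Subgroup (Matrix.GeneralLinearGroup (Fin n) k)) :
    Subalgebra k (MvPolynomial (Fin n) k) where
  carrier := {f | ∀ g ∈ G, matAct g f = f}
  mul_mem' := fun {a b} ha hb g hg => by
    rw [map_mul, ha g hg, hb g hg]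
  one_mem' := fun g _ => map_one (matAct g)
  add_mem' := fun {a b} ha hb g hg => by
    rw [map_add, ha g hg, hb g hg]
  zero_mem' := fun g _ => map_zero (matAct g)
  algebraMap_mem' := fun r g _ => (matAct g).commutes r

/-- The linear span of products of two positive-degree invariants, i.e. `(B^G_+)^2`. -/
def sqSpan {n : ℕ} (G : Subgroup (Matrix.GeneralLinearGroup (Fin n) k)) :
    Submodule k (MvPolynomial (Fin n) k) :=
  Submodule.span k {f | ∃ u ∈ invariants G, ∃ v ∈ invariants G,
    constantCoeff u = 0 ∧ constantCoeff v = 0 ∧ f = u * v}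

/-- The ideal of positive-degree elements of the polynomial ring. -/
def idealPlus (k : Type) [Field k] (m : ℕ) : Ideal (MvPolynomial (Fin m) k) :=
  Ideal.span (Set.range X)

/-- The ideal `I` of relations between the generators `p i` of the invariant algebra:
the kernel of `k[V] = k[X_1,…,X_m] → B^G`, `X i ↦ p i`. -/
def relIdeal {n m : ℕ} (p : Fin m → MvPolynomial (Fin n) k) :
    Ideal (MvPolynomial (Fin m) k) :=
  RingHom.ker (aeval p : MvPolynomial (Fin m) k →ₐ[k] MvPolynomial (Fin n) k)

/-- The context: `Wt` is a finite reflection group on `k^n`, `G` a normal subgroup of `Wt`,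
`p` a minimal system of homogeneous generators (of degrees `d`) of the invariant algebra
`B^G` whose span is `Wt`-stable (i.e. a graded `W`-equivariant section of
`B^G_+ → B^G_+/(B^G_+)^2`), and `c w` the matrix of the action of `w` on the span of the
`p i`, giving the induced action of `W = Wt/G` on `V = k^m`. -/
structure QuotSetup {n m : ℕ} (Wt G : Subgroup (Matrix.GeneralLinearGroup (Fin n) k))
    (p : Fin m → MvPolynomial (Fin n) k) (d : Fin m → ℕ)
    (c : ↥Wt → Fin m → Fin m → k) : Prop where
  finite : (Wt : Set (Matrix.GeneralLinearGroup (Fin n) k)).Finite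
  reflGroup : IsReflectionGroup Wt
  le : G ≤ Wt
  normal : ∀ w ∈ Wt, ∀ g ∈ G, w * g * w⁻¹ ∈ G
  homog : ∀ i, (p i).IsHomogeneous (d i)
  dpos : ∀ i, 0 < d i
  gen : Algebra.adjoin k (Set.range p) = invariants G
  minimal : ∀ a : Fin m → k, (∑ i, a i • p i) ∈ sqSpan G → a = 0
  equivar : ∀ (w : ↥Wt) (i), matAct (w : Matrix.GeneralLinearGroup (Fin n) k) (p i)
      = ∑ j, c w i j • p j

/-- `W = Wt/G` acts trivially on the conormal module `I/(A_+ I)`. -/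
def TrivialConormal {n m : ℕ} (Wt : Subgroup (Matrix.GeneralLinearGroup (Fin n) k))
    (p : Fin m → MvPolynomial (Fin n) k) (c : ↥Wt → Fin m → Fin m → k) : Prop :=
  ∀ w : ↥Wt, ∀ f ∈ relIdeal p, polyAct (c w) f - f ∈ idealPlus k m * relIdeal p

/-- `G` is of complete intersection: `I` is generated by `dim V - dim Vt = m - n` elements. -/
def IsCompleteIntersection {n m : ℕ} (p : Fin m → MvPolynomial (Fin n) k) : Prop :=
  ∃ s : Finset (MvPolynomial (Fin m) k), s.card = m - n ∧ Ideal.span (s : Set _) = relIdeal p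

/-- `G` is a good normal subgroup of `Wt`. -/
def IsGoodQuot {n m : ℕ} (Wt : Subgroup (Matrix.GeneralLinearGroup (Fin n) k))
    (p : Fin m → MvPolynomial (Fin n) k) (c : ↥Wt → Fin m → Fin m → k) : Prop :=
  IsCompleteIntersection p ∧ TrivialConormal Wt p c


/-- The pointwise stabilizer of a subspace `L` in `GL_n(k)`. -/
def pointStab {n : ℕ} (L : Submodule k (Fin n → k)) :
    Subgroup (Matrix.GeneralLinearGroup (Fin n) k) where
  carrier := {g | ∀ x ∈ L, Matrix.mulVec (g : Matrix (Fin n) (Fin n) k) x = x}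
  one_mem' := fun x _ => Matrix.one_mulVec x
  mul_mem' := fun {a b} ha hb x hx => by
    rw [Units.val_mul, ← Matrix.mulVec_mulVec, hb x hx, ha x hx]
  inv_mem' := fun {a} ha x hx => by
    have h1 : Matrix.mulVec (↑(a⁻¹) : Matrix (Fin n) (Fin n) k)
        (Matrix.mulVec (↑a : Matrix (Fin n) (Fin n) k) x) = x := by
      rw [Matrix.mulVec_mulVec, ← Units.val_mul, inv_mul_cancel, Units.val_one,
        Matrix.one_mulVec]
    rw [ha x hx] at h1
    exact h1

/-- The set of reflecting hyperplanes of a subgroup `W` of `GL_n(k)`. -/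
def reflHyps {n : ℕ} (W : Subgroup (Matrix.GeneralLinearGroup (Fin n) k)) :
    Set (Submodule k (Fin n → k)) :=
  {H | ∃ g ∈ W, IsReflection ((g : Matrix (Fin n) (Fin n) k)) ∧
      H = LinearMap.ker (Matrix.toLin' ((g : Matrix (Fin n) (Fin n) k)) - LinearMap.id)}

/-- The set `A'(Wt)` of reflecting hyperplanes `H` of `Wt` such that `Wt_H ≠ G_H`. -/
def reflHyps' {n : ℕ} (Wt G : Subgroup (Matrix.GeneralLinearGroup (Fin n) k)) :
    Set (Submodule k (Fin n → k)) :=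
  {H | H ∈ reflHyps Wt ∧ ¬ (Wt ⊓ pointStab H ≤ G)}

/-- `Wt_H` and `Wt_{H'}` have the same image in `W = Wt/G`. -/
def imageEq {n : ℕ} (Wt G : Subgroup (Matrix.GeneralLinearGroup (Fin n) k))
    (H H' : Submodule k (Fin n → k)) : Prop :=
  {x | ∃ g ∈ G, ∃ u ∈ Wt ⊓ pointStab H, x = g * u}
    = {x | ∃ g ∈ G, ∃ u ∈ Wt ⊓ pointStab H', x = g * u}

/-- `e_H = |G_H|`. -/
def eH {n : ℕ} (G : Subgroup (Matrix.GeneralLinearGroup (Fin n) k))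
    (H : Submodule k (Fin n → k)) : ℕ :=
  Nat.card ↥(G ⊓ pointStab H)

/-- The map `p : Vt → V`, `x ↦ (p 1 (x), …, p m (x))`. -/
def pMap {n m : ℕ} (p : Fin m → MvPolynomial (Fin n) k) (x : Fin n → k) : Fin m → k :=
  fun i => eval x (p i)

/-- The matrix of the action of (the image in `W` of) `w` on `V = k^m`. -/
def qMat {n m : ℕ} {Wt : Subgroup (Matrix.GeneralLinearGroup (Fin n) k)}
    (c : ↥Wt → Fin m → Fin m → k) (w : ↥Wt) : Matrix (Fin m) (Fin m) k :=
  Matrix.of (c w⁻¹)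

/-- The set of reflecting hyperplanes of `W = Wt/G` acting on `V = k^m`. -/
def reflHypsV {n m : ℕ} {Wt : Subgroup (Matrix.GeneralLinearGroup (Fin n) k)}
    (c : ↥Wt → Fin m → Fin m → k) : Set (Submodule k (Fin m → k)) :=
  {K | ∃ w : ↥Wt, IsReflection (qMat c w) ∧
      K = LinearMap.ker (Matrix.toLin' (qMat c w) - LinearMap.id)}

/-- The underlying matrix of an element of a subgroup of `GL_n(k)`. -/
def matOf {n : ℕ} {Wt : Subgroup (Matrix.GeneralLinearGroup (Fin n) k)} (w : ↥Wt) :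
    Matrix (Fin n) (Fin n) k :=
  ((w : Matrix.GeneralLinearGroup (Fin n) k) : Matrix (Fin n) (Fin n) k)

/-- The subalgebra of `A = k[V]` of elements invariant under the action (through `c`)
of the elements of a subgroup `H` of `Wt`: the invariants of `H/G` acting on `k[V]`. -/
def invariantsMid {n m : ℕ} {Wt : Subgroup (Matrix.GeneralLinearGroup (Fin n) k)}
    (c : ↥Wt → Fin m → Fin m → k)
    (H : Subgroup (Matrix.GeneralLinearGroup (Fin n) k)) :
    Subalgebra k (MvPolynomial (Fin m) k) where
  carrier := {f | ∀ w : ↥Wt, (w : Matrix.GeneralLinearGroup (Fin n) k) ∈ H →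
    polyAct (c w) f = f}
  mul_mem' := fun {a b} ha hb w hw => by rw [map_mul, ha w hw, hb w hw]
  one_mem' := fun w _ => map_one (polyAct (c w))
  add_mem' := fun {a b} ha hb w hw => by rw [map_add, ha w hw, hb w hw]
  zero_mem' := fun w _ => map_zero (polyAct (c w))
  algebraMap_mem' := fun r w _ => (polyAct (c w)).commutes r

/-- The span of products of two positive-degree elements of `invariantsMid c H`. -/
def sqSpanMid {n m : ℕ} {Wt : Subgroup (Matrix.GeneralLinearGroup (Fin n) k)}
    (c : ↥Wt → Fin m → Fin m → k)
    (H : Subgroup (Matrix.GeneralLinearGroup (Fin n) k)) :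
    Submodule k (MvPolynomial (Fin m) k) :=
  Submodule.span k {f | ∃ u ∈ invariantsMid c H, ∃ v ∈ invariantsMid c H,
    constantCoeff u = 0 ∧ constantCoeff v = 0 ∧ f = u * v}

/-- A minimal system `r` of generators (of weighted degrees `e`, the grading of
`V` being given by the weights `d`) of the invariants of `H/G` acting on `k[V]`,
together with the matrices `c3` of the `Wt/H`-action on their span: the analogue of
`QuotSetup` for the pair `(W, H/G)` acting on `V`. -/
structure QuotSetup2 {n m m3 : ℕ} {Wt : Subgroup (Matrix.GeneralLinearGroup (Fin n) k)}
    (c : ↥Wt → Fin m → Fin m → k)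
    (H : Subgroup (Matrix.GeneralLinearGroup (Fin n) k)) (d : Fin m → ℕ)
    (r : Fin m3 → MvPolynomial (Fin m) k) (e : Fin m3 → ℕ)
    (c3 : ↥Wt → Fin m3 → Fin m3 → k) : Prop where
  homog : ∀ i, MvPolynomial.IsWeightedHomogeneous d (r i) (e i)
  epos : ∀ i, 0 < e i
  gen : Algebra.adjoin k (Set.range r) = invariantsMid c H
  minimal : ∀ a : Fin m3 → k, (∑ i, a i • r i) ∈ sqSpanMid c H → a = 0
  equivar : ∀ (w : ↥Wt) (i), polyAct (c w) (r i) = ∑ j, c3 w i j • r j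

/-- Trivial action on the conormal module, for the second-level quotient. -/
def TrivialConormal2 {N m3 : ℕ} {ι : Type} (c3 : ι → Fin m3 → Fin m3 → k)
    (r : Fin m3 → MvPolynomial (Fin N) k) : Prop :=
  ∀ w : ι, ∀ f ∈ relIdeal r, polyAct (c3 w) f - f ∈ idealPlus k m3 * relIdeal r

/-- Goodness for the second-level quotient. -/
def IsGoodQuot2 {N m3 : ℕ} {ι : Type} (c3 : ι → Fin m3 → Fin m3 → k)
    (r : Fin m3 → MvPolynomial (Fin N) k) : Prop :=
  IsCompleteIntersection r ∧ TrivialConormal2 c3 r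

section Conormal

variable {K : Type} [Field K] {σ τ : Type}

theorem mem_idealOfVars_iff (f : MvPolynomial σ K) :
    f ∈ idealOfVars σ K ↔ constantCoeff f = 0 := by
  have := mem_pow_idealOfVars_iff' (σ := σ) (R := K) 1 f
  rw [pow_one] at this
  rw [this]
  constructor
  · intro h
    exact h 0 (by simp)
  · intro h x hx
    have : x = 0 := by
      rw [← Finsupp.degree_eq_zero_iff]; omega
    subst this
    exact h

theorem mem_idealOfVars_sq_iff (f : MvPolynomial σ K) :
    f ∈ idealOfVars σ K ^ 2 ↔
      constantCoeff f = 0 ∧ ∀ i, coeff (Finsupp.single i 1) f = 0 := by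
  rw [mem_pow_idealOfVars_iff']
  constructor
  · intro h
    exact ⟨h 0 (by simp), fun i => h _ (by simp)⟩
  · rintro ⟨h0, h1⟩ x hx
    by_cases hx0 : x.degree = 0
    · rw [Finsupp.degree_eq_zero_iff] at hx0
      subst hx0; exact h0
    · have : x.degree = 1 := by omega
      obtain ⟨i, rfl⟩ : ∃ i, Finsupp.single i 1 = x := by
        rw [← Set.mem_range, Finsupp.range_single_one]
        exact this
      exact h1 i

/-- A homomorphism of polynomial rings is augmented if it preserves the vanishing of the
constant term. -/
def Augmented (φ : MvPolynomial σ K →ₐ[K] MvPolynomial τ K) : Prop :=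
  ∀ i, constantCoeff (φ (X i)) = 0

theorem Augmented.constantCoeff_apply {φ : MvPolynomial σ K →ₐ[K] MvPolynomial τ K}
    (hφ : Augmented φ) (f : MvPolynomial σ K) :
    constantCoeff (φ f) = constantCoeff f := by
  induction f using MvPolynomial.induction_on with
  | C a => simp [MvPolynomial.algHom_C]
  | add p q hp hq => simp [hp, hq]
  | mul_X p i hp => simp [hφ i]

theorem Augmented.map_le {φ : MvPolynomial σ K →ₐ[K] MvPolynomial τ K}
    (hφ : Augmented φ) : (idealOfVars σ K).map φ ≤ idealOfVars τ K := by
  rw [Ideal.map_le_iff_le_comap]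
  intro f hf
  rw [Ideal.mem_comap, mem_idealOfVars_iff, hφ.constantCoeff_apply]
  exact (mem_idealOfVars_iff f).1 hf

theorem Augmented.mem {φ : MvPolynomial σ K →ₐ[K] MvPolynomial τ K}
    (hφ : Augmented φ) {f : MvPolynomial σ K} (hf : f ∈ idealOfVars σ K) :
    φ f ∈ idealOfVars τ K := hφ.map_le (Ideal.mem_map_of_mem _ hf)

theorem Augmented.mem_sq {φ : MvPolynomial σ K →ₐ[K] MvPolynomial τ K}
    (hφ : Augmented φ) {f : MvPolynomial σ K} (hf : f ∈ idealOfVars σ K ^ 2) :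
    φ f ∈ idealOfVars τ K ^ 2 := by
  have := Ideal.mem_map_of_mem φ hf
  rw [Ideal.map_pow] at this
  exact Ideal.pow_right_mono hφ.map_le 2 this

theorem Augmented.mem_mul {φ : MvPolynomial σ K →ₐ[K] MvPolynomial τ K}
    (hφ : Augmented φ) {I : Ideal (MvPolynomial σ K)} {J : Ideal (MvPolynomial τ K)}
    (hIJ : ∀ f ∈ I, φ f ∈ J) {f : MvPolynomial σ K} (hf : f ∈ idealOfVars σ K * I) :
    φ f ∈ idealOfVars τ K * J := by
  have := Ideal.mem_map_of_mem φ hf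
  rw [Ideal.map_mul] at this
  exact Ideal.mul_mono hφ.map_le (Ideal.map_le_iff_le_comap.2 hIJ) this

theorem Augmented.comp {υ : Type} {ψ : MvPolynomial τ K →ₐ[K] MvPolynomial υ K}
    {φ : MvPolynomial σ K →ₐ[K] MvPolynomial τ K} (hψ : Augmented ψ) (hφ : Augmented φ) :
    Augmented (ψ.comp φ) := fun i => by
  rw [AlgHom.comp_apply, hψ.constantCoeff_apply, hφ i]

theorem augmented_id : Augmented (AlgHom.id K (MvPolynomial σ K)) := fun i => by simp

theorem sub_mem_of_lift {R : Type} [CommRing R] [Algebra K R]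
    (φ ψ : MvPolynomial σ K →ₐ[K] R) (J : Ideal R)
    (h : ∀ i, φ (X i) - ψ (X i) ∈ J) (f : MvPolynomial σ K) : φ f - ψ f ∈ J := by
  have : (Ideal.Quotient.mkₐ K J).comp φ = (Ideal.Quotient.mkₐ K J).comp ψ := by
    ext i
    simpa [Ideal.Quotient.mk_eq_mk_iff_sub_mem] using h i
  have := DFunLike.congr_fun this f
  simpa [Ideal.Quotient.mk_eq_mk_iff_sub_mem] using this

theorem sub_mem_mul_of_lift {φ ψ : MvPolynomial σ K →ₐ[K] MvPolynomial τ K}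
    (hφ : Augmented φ) (hψ : Augmented ψ) {J : Ideal (MvPolynomial τ K)}
    (h : ∀ i, φ (X i) - ψ (X i) ∈ J) {f : MvPolynomial σ K}
    (hf : f ∈ idealOfVars σ K ^ 2) : φ f - ψ f ∈ idealOfVars τ K * J := by
  rw [sq] at hf
  refine Submodule.mul_induction_on hf ?_ ?_
  · intro a ha b hb
    have : φ (a * b) - ψ (a * b) = φ a * (φ b - ψ b) + ψ b * (φ a - ψ a) := by
      simp only [map_mul]; ring
    rw [this]
    exact Ideal.add_mem _ (Ideal.mul_mem_mul (hφ.mem ha) (sub_mem_of_lift φ ψ J h b))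
      (Ideal.mul_mem_mul (hψ.mem hb) (sub_mem_of_lift φ ψ J h a))
  · intro a b ha hb
    have : φ (a + b) - ψ (a + b) = (φ a - ψ a) + (φ b - ψ b) := by
      simp only [map_add]; ring
    rw [this]
    exact Ideal.add_mem _ ha hb

/-- The conormal space `I / (A_+ I)` of an ideal at the origin. -/
abbrev Conormal (I : Ideal (MvPolynomial σ K)) : Type :=
  ↥(I.restrictScalars K) ⧸
    ((idealOfVars σ K * I).restrictScalars K).comap (I.restrictScalars K).subtype

/-- The class of an element of `I` in the conormal space. -/
def conormalMk (I : Ideal (MvPolynomial σ K)) : ↥(I.restrictScalars K) →ₗ[K] Conormal I :=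
  Submodule.mkQ _

theorem conormalMk_eq_zero {I : Ideal (MvPolynomial σ K)} (f : ↥(I.restrictScalars K)) :
    conormalMk I f = 0 ↔ (f : MvPolynomial σ K) ∈ idealOfVars σ K * I := by
  rw [conormalMk, Submodule.mkQ_apply, Submodule.Quotient.mk_eq_zero]; rfl

theorem conormalMk_surjective (I : Ideal (MvPolynomial σ K)) :
    Function.Surjective (conormalMk I) := Submodule.mkQ_surjective _

theorem span_conormalMk_eq_top {I : Ideal (MvPolynomial σ K)} {ι : Type}
    (s : ι → MvPolynomial σ K) (hs : ∀ i, s i ∈ I)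
    (h : I ≤ Ideal.span (Set.range s) ⊔ idealOfVars σ K * I) :
    Submodule.span K (Set.range fun i => conormalMk I ⟨s i, hs i⟩) = ⊤ := by
  rw [eq_top_iff]
  rintro x -
  obtain ⟨⟨f, hf⟩, rfl⟩ := conormalMk_surjective I x
  obtain ⟨g, hg, z, hz, rfl⟩ := Submodule.mem_sup.1 (h hf)
  have hspan : Ideal.span (Set.range s) ≤ I := Ideal.span_le.2 (by
    rintro _ ⟨i, rfl⟩; exact hs i)
  have key : ∀ g (hg : g ∈ Ideal.span (Set.range s)), conormalMk I ⟨g, hspan hg⟩ ∈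
      Submodule.span K (Set.range fun i => conormalMk I ⟨s i, hs i⟩) := by
    intro g hg
    refine Submodule.span_induction (p := fun g hg => conormalMk I ⟨g, hspan hg⟩ ∈
      Submodule.span K (Set.range fun i => conormalMk I ⟨s i, hs i⟩)) ?_ ?_ ?_ ?_ hg
    · rintro _ ⟨i, rfl⟩
      exact Submodule.subset_span ⟨i, rfl⟩
    · convert Submodule.zero_mem _
      rw [conormalMk_eq_zero]; exact zero_mem _
    · intro x y hx hy h1 h2
      exact Submodule.add_mem _ h1 h2
    · intro a x hx h1
      have : conormalMk I ⟨a • x, hspan (Submodule.smul_mem _ a hx)⟩ =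
          constantCoeff a • conormalMk I ⟨x, hspan hx⟩ := by
        rw [← map_smul, ← sub_eq_zero, ← map_sub, conormalMk_eq_zero]
        have : (a - C (constantCoeff a)) * x ∈ idealOfVars σ K * I :=
          Ideal.mul_mem_mul ((mem_idealOfVars_iff _).2 (by simp)) (hspan hx)
        convert this using 1
        simp [sub_mul, MvPolynomial.smul_eq_C_mul]
      rw [this]
      exact Submodule.smul_mem _ _ h1
  have : conormalMk I ⟨g + z, hf⟩ = conormalMk I ⟨g, hspan hg⟩ := by
    rw [← sub_eq_zero, ← map_sub, conormalMk_eq_zero]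
    simpa using hz
  rw [this]
  exact key g hg

instance [Finite σ] (I : Ideal (MvPolynomial σ K)) : FiniteDimensional K (Conormal I) := by
  obtain ⟨s, hs⟩ := (inferInstance : IsNoetherianRing (MvPolynomial σ K)).noetherian I
  have h := span_conormalMk_eq_top (I := I) (fun i : s => (i : MvPolynomial σ K))
    (fun i => by rw [← hs]; exact Submodule.subset_span i.2)
    (by
      refine le_trans ?_ le_sup_left
      have : Set.range (fun i : s => (i : MvPolynomial σ K)) = s := Subtype.range_coe
      rw [this]; exact hs.ge)
  exact ⟨by rw [← h]; exact Submodule.fg_span (Set.finite_range _)⟩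

theorem finrank_conormal_le {I : Ideal (MvPolynomial σ K)} {ι : Type} [Fintype ι]
    (s : ι → MvPolynomial σ K) (hs : ∀ i, s i ∈ I)
    (h : I ≤ Ideal.span (Set.range s) ⊔ idealOfVars σ K * I) :
    Module.finrank K (Conormal I) ≤ Fintype.card ι := by
  have h1 := finrank_range_le_card (R := K) (fun i => conormalMk I ⟨s i, hs i⟩)
  rwa [Set.finrank, span_conormalMk_eq_top s hs h, finrank_top] at h1

/-- The linear part of a polynomial. -/
def linPart (σ : Type) (K : Type) [Field K] : MvPolynomial σ K →ₗ[K] (σ → K) :=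
  LinearMap.pi fun i => MvPolynomial.lcoeff K (Finsupp.single i 1)

theorem linPart_apply (f : MvPolynomial σ K) (i : σ) :
    linPart σ K f i = coeff (Finsupp.single i 1) f := rfl

theorem mem_sq_iff_linPart (f : MvPolynomial σ K) :
    f ∈ idealOfVars σ K ^ 2 ↔ constantCoeff f = 0 ∧ linPart σ K f = 0 := by
  rw [mem_idealOfVars_sq_iff, funext_iff]; rfl

/-- Two augmented presentations of the same algebra are related by lifts of the identity. -/
structure Lifts {S : Type} [CommRing S] [Algebra K S] (P : MvPolynomial σ K →ₐ[K] S)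
    (P' : MvPolynomial τ K →ₐ[K] S) where
  /-- The lift from the first to the second presentation. -/
  fwd : MvPolynomial σ K →ₐ[K] MvPolynomial τ K
  /-- The lift from the second to the first presentation. -/
  bwd : MvPolynomial τ K →ₐ[K] MvPolynomial σ K
  fwd_aug : Augmented fwd
  bwd_aug : Augmented bwd
  fwd_comp : P'.comp fwd = P
  bwd_comp : P.comp bwd = P'

section Lifts

variable {S : Type} [CommRing S] [Algebra K S] {P : MvPolynomial σ K →ₐ[K] S}
    {P' : MvPolynomial τ K →ₐ[K] S}

theorem Lifts.apply_fwd (L : Lifts P P') (f : MvPolynomial σ K) : P' (L.fwd f) = P f :=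
  DFunLike.congr_fun L.fwd_comp f

theorem Lifts.apply_bwd (L : Lifts P P') (f : MvPolynomial τ K) : P (L.bwd f) = P' f :=
  DFunLike.congr_fun L.bwd_comp f

theorem Lifts.fwd_mem (L : Lifts P P') {f : MvPolynomial σ K} (hf : f ∈ RingHom.ker P) :
    L.fwd f ∈ RingHom.ker P' := by
  rw [RingHom.mem_ker] at *
  rw [L.apply_fwd, hf]

theorem Lifts.bwd_mem (L : Lifts P P') {f : MvPolynomial τ K} (hf : f ∈ RingHom.ker P') :
    L.bwd f ∈ RingHom.ker P := by
  rw [RingHom.mem_ker] at *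
  rw [L.apply_bwd, hf]

theorem Lifts.fwd_bwd_sub_mem (L : Lifts P P') (f : MvPolynomial τ K) :
    L.fwd (L.bwd f) - f ∈ RingHom.ker P' := by
  rw [RingHom.mem_ker, map_sub, L.apply_fwd, L.apply_bwd, sub_self]

theorem Lifts.bwd_fwd_sub_mem (L : Lifts P P') (f : MvPolynomial σ K) :
    L.bwd (L.fwd f) - f ∈ RingHom.ker P := by
  rw [RingHom.mem_ker, map_sub, L.apply_bwd, L.apply_fwd, sub_self]

/-- An endomorphism acts trivially on the part of the conormal space coming from relations
without linear term. -/
def TrivialOnConormal (I : Ideal (MvPolynomial σ K))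
    (φ : MvPolynomial σ K →ₐ[K] MvPolynomial σ K) : Prop :=
  ∀ f ∈ I, f ∈ idealOfVars σ K ^ 2 → φ f - f ∈ idealOfVars σ K * I

theorem Lifts.trivialOnConormal (L : Lifts P P') {θ : S →ₐ[K] S}
    {φ : MvPolynomial σ K →ₐ[K] MvPolynomial σ K} (hφ : Augmented φ)
    (hφθ : ∀ f, P (φ f) = θ (P f))
    {φ' : MvPolynomial τ K →ₐ[K] MvPolynomial τ K} (hφ' : Augmented φ')
    (hφθ' : ∀ i, P' (φ' (X i)) = θ (P' (X i)))
    (h : TrivialOnConormal (RingHom.ker P) φ) :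
    TrivialOnConormal (RingHom.ker P') φ' := by
  intro f hf hf2
  have h1 := h _ (L.bwd_mem hf) (L.bwd_aug.mem_sq hf2)
  have h2 := L.fwd_aug.mem_mul (fun f => L.fwd_mem) h1
  have h3 : L.fwd (L.bwd f) - f ∈ idealOfVars τ K * RingHom.ker P' :=
    sub_mem_mul_of_lift (φ := L.fwd.comp L.bwd) (ψ := AlgHom.id K _)
      (L.fwd_aug.comp L.bwd_aug) augmented_id (fun i => L.fwd_bwd_sub_mem _) hf2
  have h4 : L.fwd (φ (L.bwd f)) - φ' f ∈ idealOfVars τ K * RingHom.ker P' := by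
    refine sub_mem_mul_of_lift (φ := L.fwd.comp (φ.comp L.bwd)) (ψ := φ')
      (L.fwd_aug.comp (hφ.comp L.bwd_aug)) hφ' (fun i => ?_) hf2
    rw [RingHom.mem_ker, map_sub, hφθ', AlgHom.comp_apply, AlgHom.comp_apply,
      L.apply_fwd, hφθ, L.apply_bwd, sub_self]
  have : φ' f - f = (L.fwd (φ (L.bwd f) - L.bwd f)) + (L.fwd (L.bwd f) - f)
      - (L.fwd (φ (L.bwd f)) - φ' f) := by
    simp only [map_sub]; ring
  rw [this]
  exact Ideal.sub_mem _ (Ideal.add_mem _ h2 h3) h4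

/-- The linear map of conormal spaces induced by an augmented homomorphism. -/
def conormalMap {I : Ideal (MvPolynomial σ K)} {J : Ideal (MvPolynomial τ K)}
    (φ : MvPolynomial σ K →ₐ[K] MvPolynomial τ K) (hφ : Augmented φ)
    (h : ∀ f ∈ I, φ f ∈ J) : Conormal I →ₗ[K] Conormal J :=
  Submodule.mapQ _ _ (φ.toLinearMap.restrict (p := I.restrictScalars K)
    (q := J.restrictScalars K) h) (fun _ hf => hφ.mem_mul h hf)

theorem conormalMap_mk {I : Ideal (MvPolynomial σ K)} {J : Ideal (MvPolynomial τ K)}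
    (φ : MvPolynomial σ K →ₐ[K] MvPolynomial τ K) (hφ : Augmented φ)
    (h : ∀ f ∈ I, φ f ∈ J) (f : ↥(I.restrictScalars K)) :
    conormalMap φ hφ h (conormalMk I f) = conormalMk J ⟨φ f, h _ f.2⟩ := rfl

theorem mul_le_sq {I : Ideal (MvPolynomial σ K)} (h : I ≤ idealOfVars σ K) :
    idealOfVars σ K * I ≤ idealOfVars σ K ^ 2 := by
  rw [sq]; exact Ideal.mul_mono_right h

/-- The linear part of a class in the conormal space. -/
def conormalLinPart {I : Ideal (MvPolynomial σ K)} (h : I ≤ idealOfVars σ K) :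
    Conormal I →ₗ[K] (σ → K) :=
  Submodule.liftQ _ (linPart σ K ∘ₗ (I.restrictScalars K).subtype)
    (fun _ hf => ((mem_sq_iff_linPart _).1 (mul_le_sq h hf)).2)

theorem linPart_linearCombination [Fintype σ] (v : σ → K) :
    linPart σ K (Fintype.linearCombination K X v) = v := by
  classical
  ext i
  rw [linPart_apply, Fintype.linearCombination_apply, coeff_sum]
  simp [coeff_X, Finsupp.single_left_inj]

theorem linearCombination_mem [Fintype σ] (v : σ → K) :
    Fintype.linearCombination K X v ∈ idealOfVars σ K := by
  rw [mem_idealOfVars_iff, Fintype.linearCombination_apply]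
  simp

/-- The excess of the number of relations over the number of generators is the same for
all presentations. -/
theorem Lifts.finrank_add_card_le [Fintype σ] [Fintype τ] (L : Lifts P P')
    (hP : RingHom.ker P ≤ idealOfVars σ K) (hP' : RingHom.ker P' ≤ idealOfVars τ K) :
    Module.finrank K (Conormal (RingHom.ker P')) + Fintype.card σ ≤
      Module.finrank K (Conormal (RingHom.ker P)) + Fintype.card τ := by
  let δ : (σ → K) →ₗ[K] Conormal (RingHom.ker P) := conormalMk _ ∘ₗ
    ((L.bwd.toLinearMap ∘ₗ L.fwd.toLinearMap - LinearMap.id).codRestrict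
      ((RingHom.ker P).restrictScalars K) L.bwd_fwd_sub_mem) ∘ₗ Fintype.linearCombination K X
  let Ψ : (Conormal (RingHom.ker P') × (σ → K)) →ₗ[K]
      (Conormal (RingHom.ker P) × (τ → K)) :=
    LinearMap.prod
      (LinearMap.coprod (conormalMap L.bwd L.bwd_aug fun f => L.bwd_mem) δ)
      (LinearMap.coprod (conormalLinPart hP')
        (linPart τ K ∘ₗ L.fwd.toLinearMap ∘ₗ Fintype.linearCombination K X))
  have hinj : Function.Injective Ψ := by
    rw [← LinearMap.ker_eq_bot, LinearMap.ker_eq_bot']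
    rintro ⟨x, v⟩ h
    obtain ⟨⟨f, hf⟩, rfl⟩ := conormalMk_surjective _ x
    obtain ⟨h1, h2⟩ := Prod.ext_iff.1 h
    have h1' : conormalMk (RingHom.ker P) ⟨L.bwd f, L.bwd_mem hf⟩ +
        conormalMk (RingHom.ker P) ⟨_, L.bwd_fwd_sub_mem (Fintype.linearCombination K X v)⟩
          = 0 := h1
    have h2' : linPart τ K (f + L.fwd (Fintype.linearCombination K X v)) = 0 := by
      rw [map_add]; exact h2
    rw [← map_add, conormalMk_eq_zero] at h1'
    have h3 : f + L.fwd (Fintype.linearCombination K X v) ∈ idealOfVars τ K ^ 2 := by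
      rw [mem_sq_iff_linPart]
      refine ⟨?_, h2'⟩
      rw [← mem_idealOfVars_iff]
      exact add_mem (hP' hf) (L.fwd_aug.mem (linearCombination_mem v))
    have h4 := L.bwd_aug.mem_sq h3
    have h5 := mul_le_sq hP h1'
    have h6 := sub_mem h4 h5
    have h7 : Fintype.linearCombination K X v ∈ idealOfVars σ K ^ 2 := by
      convert h6 using 1
      simp only [Submodule.coe_add, map_add]
      ring
    have hv : v = 0 := by
      rw [← linPart_linearCombination v]
      exact ((mem_sq_iff_linPart _).1 h7).2
    subst hv
    have h8 : L.bwd f ∈ idealOfVars σ K * RingHom.ker P := by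
      simpa using h1'
    have h9 : f ∈ idealOfVars τ K ^ 2 := by simpa using h3
    have h10 := L.fwd_aug.mem_mul (fun f => L.fwd_mem) h8
    have h11 : L.fwd (L.bwd f) - f ∈ idealOfVars τ K * RingHom.ker P' :=
      sub_mem_mul_of_lift (φ := L.fwd.comp L.bwd) (ψ := AlgHom.id K _)
        (L.fwd_aug.comp L.bwd_aug) augmented_id (fun i => L.fwd_bwd_sub_mem _) h9
    have h12 := sub_mem h10 h11
    rw [sub_sub_cancel] at h12
    rw [Prod.mk_eq_zero]
    exact ⟨(conormalMk_eq_zero _).2 h12, rfl⟩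
  have := LinearMap.finrank_le_finrank_of_injective hinj
  rw [Module.finrank_prod, Module.finrank_prod] at this
  simpa using this

/-- Two families generating the same algebra and killed by an augmentation give presentations
related by lifts. -/
theorem nonempty_lifts {u : σ → S} {u' : τ → S} (ε : S →ₐ[K] K)
    (hu : ∀ i, ε (u i) = 0) (hu' : ∀ i, ε (u' i) = 0)
    (h : Algebra.adjoin K (Set.range u) = Algebra.adjoin K (Set.range u')) :
    Nonempty (Lifts (K := K) (aeval u) (aeval u')) := by
  have key : ∀ {σ τ : Type} {u : σ → S} {u' : τ → S}, (∀ i, ε (u i) = 0) →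
      (∀ i, ε (u' i) = 0) →
      Algebra.adjoin K (Set.range u) = Algebra.adjoin K (Set.range u') →
      ∃ φ : MvPolynomial σ K →ₐ[K] MvPolynomial τ K, Augmented φ ∧
        (aeval u').comp φ = aeval u := by
    intro σ τ u u' hu hu' h
    have h1 : ∀ i, ∃ f : MvPolynomial τ K, aeval (R := K) u' f = u i := by
      intro i
      have : u i ∈ Algebra.adjoin K (Set.range u') := h ▸ Algebra.subset_adjoin ⟨i, rfl⟩
      rwa [Algebra.adjoin_range_eq_range_aeval, AlgHom.mem_range] at this
    choose f hf using h1
    have hε : ∀ g : MvPolynomial τ K, ε (aeval u' g) = constantCoeff g := by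
      intro g
      have : ε.comp (aeval u') = aeval (fun _ => 0) := by
        ext i; simp [hu']
      have := DFunLike.congr_fun this g
      simpa [MvPolynomial.aeval_zero'] using this
    refine ⟨aeval f, fun i => ?_, ?_⟩
    · rw [aeval_X, ← hε, hf, hu]
    · ext i; simp [hf]
  obtain ⟨φ, h1, h2⟩ := key hu hu' h
  obtain ⟨ψ, h3, h4⟩ := key hu' hu h.symm
  exact ⟨⟨φ, ψ, h1, h3, h2, h4⟩⟩

theorem ker_aeval_le {u : σ → S} (ε : S →ₐ[K] K) (hu : ∀ i, ε (u i) = 0) :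
    RingHom.ker (aeval u : MvPolynomial σ K →ₐ[K] S) ≤ idealOfVars σ K := by
  intro f hf
  rw [mem_idealOfVars_iff]
  have : ε.comp (aeval u) = aeval (fun _ => 0) := by
    ext i; simp [hu]
  have := DFunLike.congr_fun this f
  rw [AlgHom.comp_apply, (RingHom.mem_ker).1 hf, map_zero] at this
  simpa [MvPolynomial.aeval_zero'] using this.symm

end Lifts

end Conormal

section Jacobian

variable {K : Type} [Field K]

theorem card_le_of_algebraicIndependent {σ ι : Type} [Fintype σ] [Fintype ι]
    {x : ι → MvPolynomial σ K} (hx : AlgebraicIndependent K x) :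
    Fintype.card ι ≤ Fintype.card σ := by
  have := hx.cardinalMk_le_trdeg
  rw [MvPolynomial.trdeg_of_isDomain] at this
  simpa using this

theorem card_le_of_algebraicIndependent_comp {σ ι F : Type} [Fintype σ] [Fintype ι]
    [CommRing F] [Algebra K F] (φ : MvPolynomial σ K →ₐ[K] F)
    {x : ι → F} (hx : AlgebraicIndependent K x) (h : ∀ i, x i ∈ φ.range) :
    Fintype.card ι ≤ Fintype.card σ := by
  choose y hy using h
  obtain rfl : x = φ ∘ y := funext fun i => (hy i).symm
  exact card_le_of_algebraicIndependent (AlgebraicIndependent.of_comp φ hx)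

variable {F : Type} [Field F] [Algebra K F] {τ : Type}

theorem pderiv_mem_supported {s : Set τ} {g : MvPolynomial τ K} (hg : g ∈ supported K s) (i : τ) :
    pderiv i g ∈ supported K s := by
  rw [mem_supported] at *
  intro j hj
  classical
  rw [Finset.mem_coe, mem_vars_iff_mem_support] at hj
  obtain ⟨m, hm, hj⟩ := hj
  rw [mem_support_iff, coeff_pderiv] at hm
  refine hg ?_
  rw [Finset.mem_coe, mem_vars_iff_mem_support]
  refine ⟨m + Finsupp.single i 1, mem_support_iff.2 (left_ne_zero_of_mul hm), ?_⟩
  rw [Finsupp.mem_support_iff] at *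
  simp only [Finsupp.coe_add, Pi.add_apply]; omega

theorem totalDegree_pderiv_lt {g : MvPolynomial τ K} {i : τ} (h : pderiv i g ≠ 0) :
    (pderiv i g).totalDegree < g.totalDegree := by
  obtain ⟨m, hm⟩ := ne_zero_iff.1 h
  have h1 : ∀ m ∈ (pderiv i g).support, (m.sum fun _ e => e) + 1 ≤ g.totalDegree := by
    intro m hm
    rw [mem_support_iff, coeff_pderiv] at hm
    have := le_totalDegree (mem_support_iff.2 (left_ne_zero_of_mul hm))
    rwa [Finsupp.sum_add_index' (fun _ => rfl) (fun _ _ _ => rfl),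
      Finsupp.sum_single_index rfl] at this
  have h2 := h1 m (mem_support_iff.2 hm)
  rw [totalDegree]
  exact (Finset.sup_lt_iff (by rw [Nat.bot_eq_zero]; omega)).2 fun m hm => h1 m hm

theorem mem_supported_of_pderiv_eq_zero [CharZero K] [DecidableEq τ] {g : MvPolynomial τ K} {i : τ}
    {s : Set τ} (hg : g ∈ supported K (insert i s)) (h : pderiv i g = 0) :
    g ∈ supported K s := by
  rw [mem_supported] at *
  intro j hj
  rcases hg hj with rfl | hs
  · exfalso
    rw [Finset.mem_coe, mem_vars_iff_mem_support] at hj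
    obtain ⟨m, hm, hj⟩ := hj
    rw [mem_support_iff] at hm
    rw [Finsupp.mem_support_iff] at hj
    have h1 := coeff_pderiv (i := j) g (m - Finsupp.single j 1)
    have h2 : m - Finsupp.single j 1 + Finsupp.single j 1 = m := by
      rw [tsub_add_cancel_of_le]
      rw [Finsupp.single_le_iff]; omega
    rw [h, coeff_zero, h2] at h1
    exact mul_ne_zero hm (Nat.cast_add_one_ne_zero _) h1.symm
  · exact hs

/-- The values at a point of the gradients of the relations satisfied by that point. -/
def gradientSpan (p : τ → F) : Submodule F (τ → F) :=
  Submodule.span F {v | ∃ g : MvPolynomial τ K, aeval p g = 0 ∧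
    v = fun j => aeval p (pderiv j g)}

/-- The Jacobian criterion in characteristic zero: the gradients of the relations of a point
have rank at least the number of coordinates minus the transcendence degree. -/
theorem card_le_finrank_gradientSpan [CharZero K] [Fintype τ] (p : τ → F) (N : ℕ)
    (hN : ∀ S : Finset τ, AlgebraicIndependent K (fun i : S => p i) → S.card ≤ N) :
    Fintype.card τ ≤ Module.finrank F (gradientSpan (K := K) p) + N := by
  classical
  have hne : (Finset.univ.filter fun S : Finset τ =>
      AlgebraicIndependent K (fun i : S => p i)).Nonempty :=
    ⟨∅, by
      rw [Finset.mem_filter]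
      exact ⟨Finset.mem_univ _, algebraicIndependent_empty_type_iff.2 (algebraMap K F).injective⟩⟩
  obtain ⟨S, hS, hmax⟩ := Finset.exists_max_image _ Finset.card hne
  rw [Finset.mem_filter] at hS
  have hSind : ∀ g ∈ supported K (S : Set τ), aeval p g = 0 → g = 0 :=
    algebraicIndependent_comp_subtype.1 hS.2
  have key : ∀ i ∉ S, ∃ v ∈ gradientSpan (K := K) p, v i ≠ 0 ∧ ∀ j ∉ insert i S, v j = 0 := by
    intro i hi
    have hnot : ¬ AlgebraicIndependent K (fun j : (insert i S : Finset τ) => p j) := by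
      intro h
      have := hmax (insert i S) (by simpa using h)
      rw [Finset.card_insert_of_notMem hi] at this
      omega
    have hnot' : ∃ N, ∃ g ∈ supported K ((insert i S : Finset τ) : Set τ),
        aeval p g = 0 ∧ g ≠ 0 ∧ g.totalDegree = N := by
      by_contra hcon
      push Not at hcon
      refine hnot (algebraicIndependent_comp_subtype.2 fun g hg hg0 => ?_)
      by_contra hne
      exact hcon _ g hg hg0 hne rfl
    obtain ⟨g, hg, hg0, hgne, hgdeg⟩ := Nat.find_spec hnot'
    have hmin := fun N (hN : N < Nat.find hnot') => Nat.find_min hnot' hN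
    rw [← hgdeg] at hmin
    refine ⟨_, Submodule.subset_span ⟨g, hg0, rfl⟩, ?_, ?_⟩
    · intro hz
      by_cases hd : pderiv i g = 0
      · refine hgne (hSind g ?_ hg0)
        rw [Finset.coe_insert] at hg
        exact mem_supported_of_pderiv_eq_zero hg hd
      · exact hmin _ (totalDegree_pderiv_lt hd)
          ⟨_, pderiv_mem_supported hg i, hz, hd, rfl⟩
    · intro j hj
      have : pderiv j g = 0 := pderiv_eq_zero_of_notMem_vars
        (fun h => hj (Finset.mem_coe.1 (mem_supported.1 hg h)))
      simp [this]
  let U : Submodule F (τ → F) :=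
    Submodule.span F (Set.range fun i : S => (Pi.single (i : τ) 1 : τ → F))
  have htop : gradientSpan (K := K) p ⊔ U = ⊤ := by
    have hS' : ∀ i ∈ S, (Pi.single i 1 : τ → F) ∈ U := fun i hi =>
      Submodule.subset_span ⟨⟨i, hi⟩, rfl⟩
    rw [eq_top_iff, ← Pi.basisFun F τ |>.span_eq, Submodule.span_le]
    rintro _ ⟨i, rfl⟩
    rw [Pi.basisFun_apply]
    by_cases hi : i ∈ S
    · exact Submodule.mem_sup_right (hS' i hi)
    · obtain ⟨v, hv, hvi, hvj⟩ := key i hi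
      have hv' : v = v i • (Pi.single i 1 : τ → F) + ∑ j ∈ S, v j • (Pi.single j 1 : τ → F) := by
        ext l
        simp only [Pi.add_apply, Pi.smul_apply, Finset.sum_apply, smul_eq_mul]
        by_cases hl : l = i
        · subst hl
          rw [Finset.sum_eq_zero]
          · simp
          · intro j hj
            rw [Pi.single_eq_of_ne (by rintro rfl; exact hi hj), mul_zero]
        · rw [Pi.single_eq_of_ne hl, mul_zero, zero_add]
          by_cases hlS : l ∈ S
          · rw [Finset.sum_eq_single_of_mem l hlS]
            · simp
            · intro j _ hj
              rw [Pi.single_eq_of_ne hj.symm, mul_zero]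
          · rw [hvj l (by simp [hl, hlS]), Finset.sum_eq_zero]
            intro j hj
            rw [Pi.single_eq_of_ne (by rintro rfl; exact hlS hj), mul_zero]
      have : (Pi.single i 1 : τ → F) = (v i)⁻¹ • (v - ∑ j ∈ S, v j • (Pi.single j 1 : τ → F)) := by
        rw [eq_inv_smul_iff₀ hvi, eq_sub_iff_add_eq]
        exact hv'.symm
      rw [SetLike.mem_coe, this]
      refine Submodule.smul_mem _ _ (Submodule.sub_mem _ (Submodule.mem_sup_left hv)
        (Submodule.mem_sup_right ?_))
      exact Submodule.sum_mem _ fun j hj => Submodule.smul_mem _ _ (hS' j hj)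
  have h1 := Submodule.finrank_add_le_finrank_add_finrank (gradientSpan (K := K) p) U
  rw [htop, finrank_top, Module.finrank_pi] at h1
  have h2 : Module.finrank F U ≤ S.card := by
    have := finrank_range_le_card (R := F) (fun i : S => (Pi.single (i : τ) 1 : τ → F))
    rwa [Fintype.card_coe] at this
  have h3 := hN S hS.2
  omega

end Jacobian

section Graded

variable {K : Type} [Field K] {σ τ : Type}

/-- An ideal stable under taking weighted homogeneous components. -/
def WHomog (d : σ → ℕ) (J : Ideal (MvPolynomial σ K)) : Prop :=
  ∀ f ∈ J, ∀ e, weightedHomogeneousComponent d e f ∈ J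

attribute [local instance] MvPolynomial.weightedGradedAlgebra in
theorem whomog_iff (d : σ → ℕ) (J : Ideal (MvPolynomial σ K)) :
    WHomog d J ↔ J.IsHomogeneous (weightedHomogeneousSubmodule K d) := by
  constructor
  · intro h e f hf
    have := h f hf e
    rwa [← weightedDecomposition.decompose'_apply] at this
  · intro h f hf e
    exact weightedHomogeneousComponent_mem_of_mem K d h hf e

attribute [local instance] MvPolynomial.weightedGradedAlgebra in
theorem WHomog.idealOfVars_mul {d : σ → ℕ} {J : Ideal (MvPolynomial σ K)} (hJ : WHomog d J) :
    WHomog d (idealOfVars σ K * J) := by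
  rw [whomog_iff] at *
  refine Ideal.IsHomogeneous.mul ?_ hJ
  refine Ideal.homogeneous_span _ _ ?_
  rintro _ ⟨i, rfl⟩
  exact ⟨d i, isWeightedHomogeneous_X K d i⟩

attribute [local instance] MvPolynomial.weightedGradedAlgebra in
theorem whomog_span {d : σ → ℕ} {ι : Type} (f : ι → MvPolynomial σ K) (e : ι → ℕ)
    (hf : ∀ i, IsWeightedHomogeneous d (f i) (e i)) :
    WHomog d (Ideal.span (Set.range f)) := by
  rw [whomog_iff]
  refine Ideal.homogeneous_span _ _ ?_
  rintro _ ⟨i, rfl⟩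
  exact ⟨e i, hf i⟩

theorem weightedHomogeneousComponent_eq_zero_of_mem_pow {d : σ → ℕ} (hd : ∀ i, 0 < d i)
    {N : ℕ} {a : MvPolynomial σ K} (ha : a ∈ idealOfVars σ K ^ N) {e : ℕ} (he : e < N) :
    weightedHomogeneousComponent d e a = 0 := by
  classical
  ext x
  rw [coeff_weightedHomogeneousComponent, coeff_zero]
  split_ifs with h
  · refine (mem_pow_idealOfVars_iff' N a).1 ha x ?_
    have : x.degree ≤ Finsupp.weight d x := by
      rw [Finsupp.degree_apply, Finsupp.weight_apply, Finsupp.sum]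
      exact Finset.sum_le_sum fun i _ => by
        rw [smul_eq_mul]; exact Nat.le_mul_of_pos_right _ (hd i)
    omega
  · rfl

theorem WHomog.mem_of_forall_mem_sup_pow {d : σ → ℕ} (hd : ∀ i, 0 < d i)
    {J : Ideal (MvPolynomial σ K)} (hJ : WHomog d J) {x : MvPolynomial σ K}
    (hx : ∀ N, x ∈ J ⊔ idealOfVars σ K ^ N) : x ∈ J := by
  have h : ∀ e, weightedHomogeneousComponent d e x ∈ J := by
    intro e
    obtain ⟨j, hj, a, ha, rfl⟩ := Submodule.mem_sup.1 (hx (e + 1))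
    rw [map_add, weightedHomogeneousComponent_eq_zero_of_mem_pow hd ha (Nat.lt_succ_self e),
      add_zero]
    exact hJ j hj e
  rw [← finsum_weightedHomogeneousComponent d x]
  exact finsum_induction (· ∈ J) (zero_mem _) (fun _ _ => add_mem) h

/-- The graded Nakayama lemma. -/
theorem WHomog.le_of_le_sup_mul {d : σ → ℕ} (hd : ∀ i, 0 < d i)
    {I J : Ideal (MvPolynomial σ K)} (hJ : WHomog d J)
    (h : I ≤ J ⊔ idealOfVars σ K * I) : I ≤ J := by
  have key : ∀ N, I ≤ J ⊔ idealOfVars σ K ^ N * I := by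
    intro N
    induction N with
    | zero => simp
    | succ N ih =>
      refine h.trans (sup_le le_sup_left ?_)
      refine (Ideal.mul_mono_right ih).trans ?_
      rw [Ideal.mul_sup, ← mul_assoc, ← pow_succ']
      exact sup_le_sup_right Ideal.mul_le_right _
  exact fun x hx => hJ.mem_of_forall_mem_sup_pow hd fun N =>
    sup_le_sup_left (Ideal.mul_le_left (I := idealOfVars σ K ^ N)) J (key N hx)

theorem isWeightedHomogeneous_aeval {d : σ → ℕ} {δ : τ → ℕ} {p : σ → MvPolynomial τ K}
    (hp : ∀ i, IsWeightedHomogeneous δ (p i) (d i)) {f : MvPolynomial σ K} {e : ℕ}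
    (hf : IsWeightedHomogeneous d f e) : IsWeightedHomogeneous δ (aeval p f) e := by
  rw [f.as_sum, map_sum]
  refine IsWeightedHomogeneous.sum _ _ _ fun s hs => ?_
  have hs' : Finsupp.weight d s = e := hf (mem_support_iff.1 hs)
  rw [aeval_monomial]
  have h1 : IsWeightedHomogeneous δ (s.prod fun i k => p i ^ k) e := by
    rw [← hs', Finsupp.weight_apply]
    exact IsWeightedHomogeneous.prod _ _ _ fun i _ => (hp i).pow _
  exact h1.C_mul _

theorem weightedHomogeneousComponent_aeval {d : σ → ℕ} {δ : τ → ℕ} {p : σ → MvPolynomial τ K}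
    (hp : ∀ i, IsWeightedHomogeneous δ (p i) (d i)) (f : MvPolynomial σ K) (e : ℕ) :
    weightedHomogeneousComponent δ e (aeval p f) =
      aeval p (weightedHomogeneousComponent d e f) := by
  classical
  induction f using MvPolynomial.induction_on' with
  | monomial u a =>
    have h := isWeightedHomogeneous_monomial d u a (m := Finsupp.weight d u) rfl
    rw [weightedHomogeneousComponent_of_mem h,
      weightedHomogeneousComponent_of_mem (isWeightedHomogeneous_aeval hp h)]
    split_ifs
    · rfl
    · rw [map_zero]
  | add f g hf hg => simp only [map_add, hf, hg]

theorem whomog_ker_aeval {d : σ → ℕ} {δ : τ → ℕ} {p : σ → MvPolynomial τ K}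
    (hp : ∀ i, IsWeightedHomogeneous δ (p i) (d i)) :
    WHomog d (RingHom.ker (aeval p : MvPolynomial σ K →ₐ[K] MvPolynomial τ K)) := by
  intro f hf e
  rw [RingHom.mem_ker] at *
  rw [← weightedHomogeneousComponent_aeval hp, hf, map_zero]

/-- A homogeneous ideal is generated by homogeneous elements whose classes form a basis of
the conormal space. -/
theorem exists_homogeneous_generators [Finite σ] {d : σ → ℕ}
    {I : Ideal (MvPolynomial σ K)} (hI : WHomog d I) :
    ∃ (f : Fin (Module.finrank K (Conormal I)) → MvPolynomial σ K) (hf : ∀ i, f i ∈ I),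
      (∀ i, ∃ e, IsWeightedHomogeneous d (f i) e) ∧
      LinearIndependent K (fun i => conormalMk I ⟨f i, hf i⟩) ∧
      Submodule.span K (Set.range fun i => conormalMk I ⟨f i, hf i⟩) = ⊤ := by
  let ι : Type := {f : ↥(I.restrictScalars K) //
    ∃ e, IsWeightedHomogeneous d (f : MvPolynomial σ K) e}
  let v : ι → Conormal I := fun f => conormalMk I f.1
  have hv : Submodule.span K (Set.range v) = ⊤ := by
    rw [eq_top_iff]
    rintro x -
    obtain ⟨⟨f, hf⟩, rfl⟩ := conormalMk_surjective I x
    have hfin : (Function.support fun e => weightedHomogeneousComponent d e f).Finite :=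
      weightedHomogeneousComponent_finsupp f
    have hfin' : (Function.support fun e => (⟨weightedHomogeneousComponent d e f, hI f hf e⟩ :
        ↥(I.restrictScalars K))).Finite := by
      refine hfin.subset fun e he h0 => he (Subtype.ext h0)
    have hsum : (⟨f, hf⟩ : ↥(I.restrictScalars K)) =
        ∑ᶠ e, ⟨weightedHomogeneousComponent d e f, hI f hf e⟩ := by
      apply Subtype.ext
      have := map_finsum (I.restrictScalars K).subtype hfin'
      simp only [Submodule.subtype_apply] at this
      rw [this, finsum_weightedHomogeneousComponent]
    rw [hsum, map_finsum _ hfin']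
    refine finsum_induction (· ∈ Submodule.span K (Set.range v)) (zero_mem _)
      (fun _ _ => add_mem) fun e => Submodule.subset_span
        ⟨(⟨⟨weightedHomogeneousComponent d e f, hI f hf e⟩, e,
          weightedHomogeneousComponent_isWeightedHomogeneous e f⟩ : ι), rfl⟩
  obtain ⟨κ, a, ha, hspan, hli⟩ := exists_linearIndependent' K v
  rw [hv] at hspan
  let b := Module.Basis.mk hli hspan.ge
  have : Fintype κ := FiniteDimensional.fintypeBasisIndex b
  have hcard : Module.finrank K (Conormal I) = Fintype.card κ := Module.finrank_eq_card_basis b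
  let eqv : Fin (Module.finrank K (Conormal I)) ≃ κ :=
    (finCongr hcard).trans (Fintype.equivFin κ).symm
  refine ⟨fun i => (a (eqv i)).1.1, fun i => (a (eqv i)).1.2, fun i => (a (eqv i)).2, ?_, ?_⟩
  · exact hli.comp _ eqv.injective
  · rw [← hspan]
    congr 1
    exact eqv.surjective.range_comp (v ∘ a)

/-- Elements of a homogeneous ideal spanning the conormal space generate the ideal. -/
theorem WHomog.span_eq_of_span_conormal {d : σ → ℕ} (hd : ∀ i, 0 < d i)
    {I : Ideal (MvPolynomial σ K)} {ι : Type} {f : ι → MvPolynomial σ K}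
    (hf : ∀ i, f i ∈ I) (hw : ∀ i, ∃ e, IsWeightedHomogeneous d (f i) e)
    (h : Submodule.span K (Set.range fun i => conormalMk I ⟨f i, hf i⟩) = ⊤) :
    Ideal.span (Set.range f) = I := by
  have hle : Ideal.span (Set.range f) ≤ I := Ideal.span_le.2 (by
    rintro _ ⟨i, rfl⟩; exact hf i)
  refine le_antisymm hle ?_
  choose e he using hw
  refine (whomog_span f e he).le_of_le_sup_mul hd fun g hg => ?_
  have hmem : conormalMk I ⟨g, hg⟩ ∈
      (Submodule.span K (Set.range fun i => (⟨f i, hf i⟩ : ↥(I.restrictScalars K)))).map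
        (conormalMk I) := by
    rw [Submodule.map_span, ← Set.range_comp]
    exact h.ge trivial
  obtain ⟨⟨g', hg'⟩, hg's, hgg⟩ := hmem
  have h1 : g' ∈ Ideal.span (Set.range f) := by
    have : (Submodule.span K (Set.range fun i => (⟨f i, hf i⟩ : ↥(I.restrictScalars K)))).map
        (I.restrictScalars K).subtype ≤ (Ideal.span (Set.range f)).restrictScalars K := by
      rw [Submodule.map_span, ← Set.range_comp, Submodule.span_le]
      rintro _ ⟨i, rfl⟩
      exact Ideal.subset_span ⟨i, rfl⟩
    exact this ⟨_, hg's, rfl⟩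
  rw [eq_comm, ← sub_eq_zero, ← map_sub, conormalMk_eq_zero] at hgg
  have : g = g' + (g - g') := by ring
  rw [this]
  exact add_mem (Submodule.mem_sup_left h1) (Submodule.mem_sup_right hgg)

theorem finrank_conormal_le_of_span {I : Ideal (MvPolynomial σ K)}
    {s : Finset (MvPolynomial σ K)} (hs : Ideal.span (s : Set _) = I) :
    Module.finrank K (Conormal I) ≤ s.card := by
  have := finrank_conormal_le (I := I) (fun i : s => (i : MvPolynomial σ K))
    (fun i => by rw [← hs]; exact Ideal.subset_span i.2) (by
      have : Set.range (fun i : s => (i : MvPolynomial σ K)) = s := Subtype.range_coe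
      rw [this, hs]; exact le_sup_left)
  rwa [Fintype.card_coe] at this

theorem IsCompleteIntersection.finrank_le {n m : ℕ} {p : Fin m → MvPolynomial (Fin n) K}
    (h : IsCompleteIntersection p) (hnm : n ≤ m) :
    Module.finrank K (Conormal (relIdeal p)) + n ≤ m := by
  obtain ⟨s, hs, hs'⟩ := h
  have := finrank_conormal_le_of_span hs'
  omega

theorem isCompleteIntersection_of_finrank_le {n m : ℕ} {p : Fin m → MvPolynomial (Fin n) K}
    {d : Fin m → ℕ} (hd : ∀ i, 0 < d i) {δ : Fin n → ℕ}
    (hp : ∀ i, IsWeightedHomogeneous δ (p i) (d i))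
    (h : Module.finrank K (Conormal (relIdeal p)) + n ≤ m) : IsCompleteIntersection p := by
  classical
  obtain ⟨f, hf, hw, -, hspan⟩ := exists_homogeneous_generators (whomog_ker_aeval hp)
  have hgen := WHomog.span_eq_of_span_conormal hd hf hw hspan
  change Ideal.span (Set.range f) = relIdeal p at hgen
  by_cases hbot : relIdeal p = ⊥
  · refine ⟨∅, ?_, by simp [hbot]⟩
    have hind : AlgebraicIndependent K p := by
      rw [AlgebraicIndependent, injective_iff_map_eq_zero]
      intro a ha
      have : a ∈ relIdeal p := ha
      rwa [hbot] at this
    have := card_le_of_algebraicIndependent hind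
    simp at this
    simp; omega
  · have hinf : (relIdeal p : Set (MvPolynomial (Fin m) K)).Infinite := by
      obtain ⟨x, hx, hx0⟩ := Submodule.exists_mem_ne_zero_of_ne_bot hbot
      have : m ≠ 0 := by
        rintro rfl
        obtain ⟨a, rfl⟩ := C_surjective (R := K) (Fin 0) x
        have h1 : aeval p (C a : MvPolynomial (Fin 0) K) = 0 := hx
        rw [algHom_C, algebraMap_eq, C_eq_zero] at h1
        exact hx0 (by rw [h1, C_0])
      refine Set.infinite_of_injective_forall_mem (f := fun N : ℕ => X ⟨0, by omega⟩ ^ N * x) ?_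
        (fun N => Ideal.mul_mem_left _ _ hx)
      intro a b hab
      have h2 := mul_right_cancel₀ hx0 hab
      simp only [X_pow_eq_monomial] at h2
      have h3 := congrArg totalDegree h2
      rw [totalDegree_monomial _ one_ne_zero, totalDegree_monomial _ one_ne_zero] at h3
      simpa using h3
    have hle : (Finset.univ.image f).card ≤ m - n := by
      refine Finset.card_image_le.trans ?_
      rw [Finset.card_univ, Fintype.card_fin]
      have : Module.finrank K (Conormal (RingHom.ker (aeval p :
        MvPolynomial (Fin m) K →ₐ[K] MvPolynomial (Fin n) K))) + n ≤ m := h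
      omega
    obtain ⟨t, hft, ht, htc⟩ := Set.Infinite.exists_superset_ncard_eq hinf
      (s := (Finset.univ.image f : Finset _))
      (by rintro x hx; obtain ⟨i, -, rfl⟩ := Finset.mem_image.1 (Finset.mem_coe.1 hx); exact hf i)
      (Finset.finite_toSet _) (k := m - n) (by rwa [Set.ncard_coe_finset])
    have hpos : m - n ≠ 0 := by
      intro h0
      rw [h0, Nat.le_zero, Finset.card_eq_zero, Finset.image_eq_empty] at hle
      refine hbot ?_
      rw [← hgen, Ideal.span_eq_bot]
      rintro _ ⟨i, rfl⟩
      exact absurd (Finset.mem_univ i) (by rw [hle]; exact Finset.notMem_empty i)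
    have htfin : t.Finite := Set.finite_of_ncard_ne_zero (by rwa [htc])
    lift t to Finset (MvPolynomial (Fin m) K) using htfin
    rw [Set.ncard_coe_finset] at htc
    refine ⟨t, htc, le_antisymm (Ideal.span_le.2 ht) ?_⟩
    rw [← hgen]
    refine Ideal.span_mono ?_
    rintro _ ⟨i, rfl⟩
    exact hft (Finset.mem_coe.2 (Finset.mem_image_of_mem f (Finset.mem_univ i)))

end Graded

section Averaging

variable {K : Type} [Field K] {R : Type} [CommRing R] [Algebra K R]
  {Γ : Type} [Group Γ] [Fintype Γ]

/-- The average of an element over a finite group of automorphisms. -/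
def avg (ρ : Γ →* (R →ₐ[K] R)) : R →ₗ[K] R :=
  (Fintype.card Γ : K)⁻¹ • ∑ g, (ρ g).toLinearMap

theorem avg_apply (ρ : Γ →* (R →ₐ[K] R)) (f : R) :
    avg ρ f = (Fintype.card Γ : K)⁻¹ • ∑ g, ρ g f := by
  simp [avg]

theorem map_avg (ρ : Γ →* (R →ₐ[K] R)) (h : Γ) (f : R) : ρ h (avg ρ f) = avg ρ f := by
  rw [avg_apply, map_smul, map_sum]
  congr 1
  refine Fintype.sum_equiv (Equiv.mulLeft h) _ _ fun g => ?_
  rw [Equiv.coe_mulLeft, map_mul]; rfl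

theorem avg_sub_mem [CharZero K] (ρ : Γ →* (R →ₐ[K] R)) {M : Submodule K R} {f : R}
    (h : ∀ g, ρ g f - f ∈ M) : avg ρ f - f ∈ M := by
  have : avg ρ f - f = (Fintype.card Γ : K)⁻¹ • ∑ g, (ρ g f - f) := by
    rw [avg_apply, Finset.sum_sub_distrib, smul_sub, Finset.sum_const, Finset.card_univ,
      ← Nat.cast_smul_eq_nsmul K, smul_smul, inv_mul_cancel₀, one_smul]
    exact_mod_cast Fintype.card_ne_zero
  rw [this]
  exact M.smul_mem _ (M.sum_mem fun g _ => h g)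

theorem avg_eq_self [CharZero K] (ρ : Γ →* (R →ₐ[K] R)) {f : R} (h : ∀ g, ρ g f = f) :
    avg ρ f = f := by
  have := avg_sub_mem ρ (M := ⊥) (f := f) (fun g => by simp [h])
  rwa [Submodule.mem_bot, sub_eq_zero] at this

theorem avg_mem (ρ : Γ →* (R →ₐ[K] R)) {M : Submodule K R} {f : R}
    (h : ∀ g, ρ g f ∈ M) : avg ρ f ∈ M := by
  rw [avg_apply]
  exact M.smul_mem _ (M.sum_mem fun g _ => h g)

theorem map_avg_of_comm {R' : Type} [CommRing R'] [Algebra K R'] (ρ : Γ →* (R →ₐ[K] R))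
    (ρ' : Γ →* (R' →ₐ[K] R')) (φ : R →ₐ[K] R') (h : ∀ g f, φ (ρ g f) = ρ' g (φ f)) (f : R) :
    φ (avg ρ f) = avg ρ' (φ f) := by
  rw [avg_apply, avg_apply, map_smul, map_sum]
  simp only [h]

end Averaging

section Action

variable {k : Type} [Field k] {n m : ℕ}

theorem polyAct_X (M : Fin m → Fin m → k) (i : Fin m) : polyAct M (X i) = ∑ j, M i j • X j := by
  rw [polyAct, aeval_X]

/-- The linear substitution given by a matrix. -/
def linSub (M : Matrix (Fin m) (Fin m) k) :
    MvPolynomial (Fin m) k →ₐ[k] MvPolynomial (Fin m) k := polyAct fun i j => M i j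

theorem polyAct_eq_linSub (M : Fin m → Fin m → k) : polyAct M = linSub (Matrix.of M) := rfl

theorem linSub_X (M : Matrix (Fin m) (Fin m) k) (i : Fin m) :
    linSub M (X i) = ∑ j, M i j • X j := polyAct_X _ i

theorem linSub_comp (M N : Matrix (Fin m) (Fin m) k) :
    (linSub M).comp (linSub N) = linSub (N * M) := by
  ext1 i
  rw [AlgHom.comp_apply, linSub_X, linSub_X, map_sum]
  simp only [map_smul, linSub_X, Finset.smul_sum, smul_smul, Matrix.mul_apply, Finset.sum_smul]
  rw [Finset.sum_comm]

theorem linSub_linSub (M N : Matrix (Fin m) (Fin m) k) (f : MvPolynomial (Fin m) k) :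
    linSub M (linSub N f) = linSub (N * M) f := DFunLike.congr_fun (linSub_comp M N) f

theorem linSub_one : linSub (1 : Matrix (Fin m) (Fin m) k) = AlgHom.id k _ := by
  ext1 i
  rw [linSub_X, AlgHom.id_apply]
  simp [Matrix.one_apply]

theorem augmented_polyAct (M : Fin m → Fin m → k) : Augmented (polyAct M) := fun i => by
  rw [polyAct_X, map_sum]
  exact Finset.sum_eq_zero fun j _ => by rw [constantCoeff_smul, constantCoeff_X, smul_zero]

theorem matAct_eq (g : Matrix.GeneralLinearGroup (Fin n) k) :
    matAct g = linSub (↑(g⁻¹) : Matrix (Fin n) (Fin n) k) := rfl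

theorem matAct_mul (g h : Matrix.GeneralLinearGroup (Fin n) k) :
    matAct (g * h) = (matAct g).comp (matAct h) := by
  rw [matAct_eq, matAct_eq, matAct_eq, linSub_comp, ← Units.val_mul, mul_inv_rev]

theorem matAct_one : matAct (1 : Matrix.GeneralLinearGroup (Fin n) k) = AlgHom.id k _ := by
  rw [matAct_eq, inv_one, Units.val_one, linSub_one]

/-- The action of the general linear group on polynomials as a homomorphism. -/
def matActHom (n : ℕ) (k : Type) [Field k] : Matrix.GeneralLinearGroup (Fin n) k →*
    (MvPolynomial (Fin n) k →ₐ[k] MvPolynomial (Fin n) k) where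
  toFun := matAct
  map_one' := matAct_one
  map_mul' := matAct_mul

theorem matAct_inv_apply (g : Matrix.GeneralLinearGroup (Fin n) k) (f : MvPolynomial (Fin n) k) :
    matAct g (matAct g⁻¹ f) = f := by
  rw [← AlgHom.comp_apply, ← matAct_mul, mul_inv_cancel, matAct_one, AlgHom.id_apply]

theorem matAct_injective (g : Matrix.GeneralLinearGroup (Fin n) k) :
    Function.Injective (matAct g) := fun a b h => by
  have := congrArg (matAct g⁻¹) h
  rwa [← AlgHom.comp_apply, ← AlgHom.comp_apply, ← matAct_mul, inv_mul_cancel, matAct_one] at this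

/-- Homogeneous relations of positive degree: polynomials of order at least two are sent to
the square of the augmentation ideal. -/
theorem aeval_mem_span_of_mem_sq {C : Subalgebra k (MvPolynomial (Fin n) k)}
    {p : Fin m → MvPolynomial (Fin n) k} (hp : ∀ i, p i ∈ C)
    (hp0 : ∀ i, constantCoeff (p i) = 0) {f : MvPolynomial (Fin m) k}
    (hf : f ∈ idealOfVars (Fin m) k ^ 2) :
    aeval p f ∈ Submodule.span k {f | ∃ u ∈ C, ∃ v ∈ C,
      constantCoeff u = 0 ∧ constantCoeff v = 0 ∧ f = u * v} := by
  have hC : ∀ g : MvPolynomial (Fin m) k, aeval p g ∈ C := by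
    intro g
    have : Algebra.adjoin k (Set.range p) ≤ C := Algebra.adjoin_le (by
      rintro _ ⟨i, rfl⟩; exact hp i)
    refine this ?_
    rw [Algebra.adjoin_range_eq_range_aeval]
    exact ⟨g, rfl⟩
  have h0 : ∀ g ∈ idealOfVars (Fin m) k, constantCoeff (aeval p g) = 0 := by
    intro g hg
    have : Augmented (aeval p : MvPolynomial (Fin m) k →ₐ[k] MvPolynomial (Fin n) k) :=
      fun i => by rw [aeval_X, hp0]
    rw [this.constantCoeff_apply]
    exact (mem_idealOfVars_iff g).1 hg
  rw [sq] at hf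
  refine Submodule.mul_induction_on hf ?_ ?_
  · intro a ha b hb
    exact Submodule.subset_span ⟨_, hC a, _, hC b, h0 a ha, h0 b hb, map_mul _ _ _⟩
  · intro a b ha hb
    rw [map_add]
    exact add_mem ha hb

theorem relIdeal_le_sq {C : Subalgebra k (MvPolynomial (Fin n) k)}
    {p : Fin m → MvPolynomial (Fin n) k} (hp : ∀ i, p i ∈ C)
    (hp0 : ∀ i, constantCoeff (p i) = 0)
    (hmin : ∀ a : Fin m → k, (∑ i, a i • p i) ∈ Submodule.span k {f | ∃ u ∈ C, ∃ v ∈ C,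
      constantCoeff u = 0 ∧ constantCoeff v = 0 ∧ f = u * v} → a = 0) :
    relIdeal p ≤ idealOfVars (Fin m) k ^ 2 := by
  intro f hf
  have haug : Augmented (aeval p : MvPolynomial (Fin m) k →ₐ[k] MvPolynomial (Fin n) k) :=
    fun i => by rw [aeval_X, hp0]
  have hf0 : aeval p f = 0 := hf
  have hc : constantCoeff f = 0 := by
    rw [← haug.constantCoeff_apply, hf0, map_zero]
  rw [mem_sq_iff_linPart]
  refine ⟨hc, hmin _ ?_⟩
  have h2 : f - Fintype.linearCombination k X (linPart (Fin m) k f) ∈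
      idealOfVars (Fin m) k ^ 2 := by
    rw [mem_sq_iff_linPart, map_sub, map_sub, linPart_linearCombination, sub_self, hc,
      (mem_idealOfVars_iff _).1 (linearCombination_mem _), sub_self]
    exact ⟨rfl, rfl⟩
  have h3 := aeval_mem_span_of_mem_sq hp hp0 h2
  rw [map_sub, hf0, zero_sub] at h3
  have h4 := neg_mem h3
  rw [neg_neg, Fintype.linearCombination_apply, map_sum] at h4
  simpa using h4

/-- A graded equivariant presentation of an invariant algebra for which the number of relations
is minimal and the group acts trivially on the conormal space. -/
structure GoodSetup (Wt G : Subgroup (Matrix.GeneralLinearGroup (Fin n) k))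
    (p : Fin m → MvPolynomial (Fin n) k) (d : Fin m → ℕ)
    (c : ↥Wt → Fin m → Fin m → k) : Prop where
  finite : (Wt : Set (Matrix.GeneralLinearGroup (Fin n) k)).Finite
  le : G ≤ Wt
  homog : ∀ i, (p i).IsHomogeneous (d i)
  dpos : ∀ i, 0 < d i
  gen : Algebra.adjoin k (Set.range p) = invariants G
  minimal : relIdeal p ≤ idealOfVars (Fin m) k ^ 2
  equivar : ∀ (w : ↥Wt) (i), matAct (w : Matrix.GeneralLinearGroup (Fin n) k) (p i)
      = ∑ j, c w i j • p j
  finrank_le : Module.finrank k (Conormal (relIdeal p)) + n ≤ m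
  trivial : TrivialConormal Wt p c

theorem constantCoeff_eq_zero_of_isHomogeneous {σ : Type} {δ : σ → ℕ} {f : MvPolynomial σ k}
    {e : ℕ} (hf : IsWeightedHomogeneous δ f e) (he : 0 < e) : constantCoeff f = 0 := by
  by_contra h
  have := hf (d := 0) h
  rw [map_zero] at this
  omega

variable {Wt G : Subgroup (Matrix.GeneralLinearGroup (Fin n) k)}
    {p : Fin m → MvPolynomial (Fin n) k} {d : Fin m → ℕ} {c : ↥Wt → Fin m → Fin m → k}

theorem QuotSetup.constantCoeff_eq (h : QuotSetup Wt G p d c) (i : Fin m) :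
    constantCoeff (p i) = 0 :=
  constantCoeff_eq_zero_of_isHomogeneous (h.homog i) (h.dpos i)

theorem QuotSetup.mem_invariants (h : QuotSetup Wt G p d c) (i : Fin m) :
    p i ∈ invariants G := by
  rw [← h.gen]
  exact Algebra.subset_adjoin ⟨i, rfl⟩

theorem QuotSetup.relIdeal_le_sq (h : QuotSetup Wt G p d c) :
    relIdeal p ≤ idealOfVars (Fin m) k ^ 2 :=
  ReflQuot.relIdeal_le_sq h.mem_invariants h.constantCoeff_eq h.minimal

/-- Polynomial rings are integral over the invariants of a finite group. -/
theorem isIntegral_invariants (hG : (G : Set (Matrix.GeneralLinearGroup (Fin n) k)).Finite) :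
    Algebra.IsIntegral (invariants G) (MvPolynomial (Fin n) k) := by
  have : Finite ↥G := hG
  have : Fintype ↥G := Fintype.ofFinite _
  let ρ : ↥G → MvPolynomial (Fin n) k →ₐ[k] MvPolynomial (Fin n) k := fun g => matAct g
  refine ⟨fun x => ?_⟩
  let P : Polynomial (MvPolynomial (Fin n) k) := ∏ g : ↥G, (Polynomial.X - Polynomial.C (ρ g x))
  have hP : P.Monic := Polynomial.monic_prod_of_monic _ _ fun g _ => Polynomial.monic_X_sub_C _
  have hinv : ∀ h : ↥G, P.map (ρ h : MvPolynomial (Fin n) k →+* _) = P := by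
    intro h
    rw [Polynomial.map_prod]
    refine Fintype.prod_equiv (Equiv.mulLeft h) _ _ fun g => ?_
    simp only [Polynomial.map_sub, Polynomial.map_X, Polynomial.map_C, Equiv.coe_mulLeft]
    congr 2
    change matAct (h : Matrix.GeneralLinearGroup (Fin n) k) (matAct g x) = matAct (h * g : ↥G) x
    rw [Subgroup.coe_mul, matAct_mul]; rfl
  have hlift : P ∈ Polynomial.lifts (algebraMap (invariants G) (MvPolynomial (Fin n) k)) := by
    rw [Polynomial.lifts_iff_coeff_lifts]
    intro i
    refine ⟨⟨P.coeff i, fun g hg => ?_⟩, rfl⟩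
    have := congrArg (fun Q => Polynomial.coeff Q i) (hinv ⟨g, hg⟩)
    simpa [Polynomial.coeff_map] using this
  obtain ⟨Q, hQ, -, hQm⟩ := Polynomial.lifts_and_degree_eq_and_monic hlift hP
  refine ⟨Q, hQm, ?_⟩
  rw [← Polynomial.eval_map, hQ, Polynomial.eval_prod]
  refine Finset.prod_eq_zero (Finset.mem_univ 1) ?_
  have : ρ 1 x = x := by
    change matAct ((1 : ↥G) : Matrix.GeneralLinearGroup (Fin n) k) x = x
    rw [Subgroup.coe_one, matAct_one, AlgHom.id_apply]
  simp [this]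

theorem le_card_of_adjoin_eq_invariants {τ : Type} [Fintype τ]
    (hG : (G : Set (Matrix.GeneralLinearGroup (Fin n) k)).Finite)
    {p : τ → MvPolynomial (Fin n) k}
    (hp : Algebra.adjoin k (Set.range p) = invariants G) : n ≤ Fintype.card τ := by
  have h1 : Algebra.IsAlgebraic (Algebra.adjoin k (Set.range p)) (MvPolynomial (Fin n) k) := by
    rw [hp]
    have := isIntegral_invariants hG
    infer_instance
  have h2 := Algebra.IsAlgebraic.trdeg_le_cardinalMk (A := MvPolynomial (Fin n) k) k (Set.range p)
  rw [MvPolynomial.trdeg_of_isDomain] at h2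
  have h3 : Cardinal.mk (Set.range p) ≤ Cardinal.mk τ := Cardinal.mk_range_le
  have := h2.trans h3
  simpa using this

theorem QuotSetup.goodSetup (h : QuotSetup Wt G p d c) (hg : IsGoodQuot Wt p c) :
    GoodSetup Wt G p d c where
  finite := h.finite
  le := h.le
  homog := h.homog
  dpos := h.dpos
  gen := h.gen
  minimal := h.relIdeal_le_sq
  equivar := h.equivar
  finrank_le := hg.1.finrank_le (by
    have := le_card_of_adjoin_eq_invariants (h.finite.subset h.le) h.gen
    rwa [Fintype.card_fin] at this)
  trivial := hg.2

end Action

section Equivariance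

variable {k : Type} [Field k] {n m : ℕ}
variable {Wt G : Subgroup (Matrix.GeneralLinearGroup (Fin n) k)}
    {p : Fin m → MvPolynomial (Fin n) k} {d : Fin m → ℕ} {c : ↥Wt → Fin m → Fin m → k}

theorem linearIndependent_of_relIdeal_le_sq {τ : Type} [Fintype τ]
    {p : τ → MvPolynomial (Fin n) k}
    (hp : RingHom.ker (aeval p : MvPolynomial τ k →ₐ[k] _) ≤ idealOfVars τ k ^ 2) :
    LinearIndependent k p := by
  rw [Fintype.linearIndependent_iff]
  intro a ha
  have : Fintype.linearCombination k X a ∈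
      RingHom.ker (aeval p : MvPolynomial τ k →ₐ[k] MvPolynomial (Fin n) k) := by
    rw [RingHom.mem_ker, Fintype.linearCombination_apply, map_sum]
    simpa using ha
  have h2 := ((mem_sq_iff_linPart _).1 (hp this)).2
  rw [linPart_linearCombination] at h2
  exact fun i => congrFun h2 i

theorem GoodSetup.linearIndependent (h : GoodSetup Wt G p d c) : LinearIndependent k p :=
  linearIndependent_of_relIdeal_le_sq h.minimal

/-- A matrix acting on the span of a linearly independent family is determined by its action. -/
theorem eq_of_sum_smul_eq {τ E : Type} [Fintype τ] [AddCommGroup E] [Module k E] {p : τ → E}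
    (hp : LinearIndependent k p) {a b : τ → k} (h : ∑ j, a j • p j = ∑ j, b j • p j) : a = b := by
  have := Fintype.linearIndependent_iff.1 hp (fun j => a j - b j) (by
    simp only [sub_smul, Finset.sum_sub_distrib, h, sub_self])
  exact funext fun j => sub_eq_zero.1 (this j)

/-- The action on the ambient polynomial ring of a presentation as a group homomorphism. -/
def actionHom {E : Type} [CommRing E] [Algebra k E] (ρ : ↥Wt →* (E →ₐ[k] E))
    (p : Fin m → E) (hp : LinearIndependent k p) (c : ↥Wt → Fin m → Fin m → k)
    (hc : ∀ w i, ρ w (p i) = ∑ j, c w i j • p j) :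
    ↥Wt →* (MvPolynomial (Fin m) k →ₐ[k] MvPolynomial (Fin m) k) where
  toFun w := polyAct (c w)
  map_one' := by
    have : Matrix.of (c 1) = 1 := by
      ext i j
      refine congrFun (eq_of_sum_smul_eq (k := k) (a := c 1 i)
        (b := fun j => (1 : Matrix (Fin m) (Fin m) k) i j) hp ?_) j
      rw [← hc, map_one]
      simp [Matrix.one_apply]
    rw [polyAct_eq_linSub, this, linSub_one]; rfl
  map_mul' w w' := by
    have : Matrix.of (c (w * w')) = Matrix.of (c w') * Matrix.of (c w) := by
      ext i j
      refine congrFun (eq_of_sum_smul_eq (k := k) (a := c (w * w') i)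
        (b := fun j => (Matrix.of (c w') * Matrix.of (c w)) i j) hp ?_) j
      rw [← hc, map_mul, AlgHom.mul_apply, hc, map_sum]
      simp only [map_smul, hc, Finset.smul_sum, smul_smul, Matrix.mul_apply, Finset.sum_smul,
        Matrix.of_apply]
      rw [Finset.sum_comm]
    rw [polyAct_eq_linSub, this, ← linSub_comp]; rfl

theorem aeval_polyAct {E : Type} [CommRing E] [Algebra k E] {φ : E →ₐ[k] E}
    {p : Fin m → E} {c : Fin m → Fin m → k} (hc : ∀ i, φ (p i) = ∑ j, c i j • p j)
    (f : MvPolynomial (Fin m) k) : aeval p (polyAct c f) = φ (aeval p f) := by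
  have : (aeval p).comp (polyAct c) = φ.comp (aeval p) := by
    ext1 i
    rw [AlgHom.comp_apply, AlgHom.comp_apply, polyAct_X, aeval_X, hc, map_sum]
    simp
  exact DFunLike.congr_fun this f

/-- The restriction of the action of the general linear group to a subgroup. -/
def groupAct (Wt : Subgroup (Matrix.GeneralLinearGroup (Fin n) k)) :
    ↥Wt →* (MvPolynomial (Fin n) k →ₐ[k] MvPolynomial (Fin n) k) :=
  (matActHom n k).comp Wt.subtype

theorem weight_eq_of_ne_zero {N : ℕ} {δ : Fin N → ℕ} {p : Fin m → MvPolynomial (Fin N) k}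
    (hp : LinearIndependent k p) (hom : ∀ i, IsWeightedHomogeneous δ (p i) (d i))
    {φ : MvPolynomial (Fin N) k → MvPolynomial (Fin N) k}
    (hφ : ∀ f e, IsWeightedHomogeneous δ f e → IsWeightedHomogeneous δ (φ f) e)
    {M : Fin m → Fin m → k} (hM : ∀ i, φ (p i) = ∑ j, M i j • p j) {i j : Fin m}
    (h : M i j ≠ 0) : d j = d i := by
  classical
  have h1 := weightedHomogeneousComponent_of_mem (m := d i) (hφ _ _ (hom i))
  rw [if_pos rfl] at h1
  rw [hM i, map_sum] at h1
  have h2 : ∑ j, (if d i = d j then M i j else 0) • p j = ∑ j, M i j • p j := by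
    rw [← h1]
    refine Finset.sum_congr rfl fun l _ => ?_
    rw [map_smul, weightedHomogeneousComponent_of_mem (hom l)]
    split_ifs <;> simp
  have h3 := congrFun (eq_of_sum_smul_eq hp h2) j
  by_contra hne
  rw [if_neg (fun h => hne h.symm)] at h3
  exact h h3.symm

theorem isWeightedHomogeneous_polyAct {M : Fin m → Fin m → k}
    (hM : ∀ i j, M i j ≠ 0 → d j = d i) {f : MvPolynomial (Fin m) k} {e : ℕ}
    (hf : IsWeightedHomogeneous d f e) : IsWeightedHomogeneous d (polyAct M f) e := by
  refine isWeightedHomogeneous_aeval (fun i => ?_) hf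
  refine IsWeightedHomogeneous.sum _ _ _ fun j _ => ?_
  by_cases h : M i j = 0
  · rw [h, zero_smul]; exact isWeightedHomogeneous_zero k d _
  · rw [← hM i j h, smul_eq_C_mul]
    exact (isWeightedHomogeneous_X k d j).C_mul _

theorem isHomogeneous_matAct (g : Matrix.GeneralLinearGroup (Fin n) k)
    {f : MvPolynomial (Fin n) k} {e : ℕ} (hf : IsWeightedHomogeneous 1 f e) :
    IsWeightedHomogeneous 1 (matAct g f) e :=
  isWeightedHomogeneous_polyAct (fun _ _ _ => rfl) hf

theorem GoodSetup.weight_eq (h : GoodSetup Wt G p d c) (w : ↥Wt) {i j : Fin m}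
    (hne : c w i j ≠ 0) : d j = d i :=
  weight_eq_of_ne_zero h.linearIndependent h.homog (fun _ _ => isHomogeneous_matAct _)
    (h.equivar w) hne

/-- A homogeneous ideal on whose conormal space a finite group acts trivially is generated by
invariant homogeneous elements whose classes form a basis of the conormal space. -/
theorem WHomog.exists_invariant_generators [CharZero k] {σ : Type} [Finite σ] {d : σ → ℕ}
    (hd : ∀ i, 0 < d i) {I : Ideal (MvPolynomial σ k)} (hI : WHomog d I)
    {Γ : Type} [Group Γ] [Fintype Γ] (ρ : Γ →* (MvPolynomial σ k →ₐ[k] MvPolynomial σ k))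
    (hρ : ∀ g f e, IsWeightedHomogeneous d f e → IsWeightedHomogeneous d (ρ g f) e)
    (hI' : ∀ g, ∀ f ∈ I, ρ g f - f ∈ idealOfVars σ k * I) :
    ∃ (f : Fin (Module.finrank k (Conormal I)) → MvPolynomial σ k) (hf : ∀ i, f i ∈ I),
      (∀ i, ∃ e, IsWeightedHomogeneous d (f i) e) ∧
      (∀ g i, ρ g (f i) = f i) ∧
      LinearIndependent k (fun i => conormalMk I ⟨f i, hf i⟩) ∧
      Ideal.span (Set.range f) = I := by
  obtain ⟨f, hf, hw, hli, hspan⟩ := exists_homogeneous_generators hI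
  have hav : ∀ i, avg ρ (f i) - f i ∈ (idealOfVars σ k * I).restrictScalars k :=
    fun i => avg_sub_mem ρ fun g => hI' g (f i) (hf i)
  have hmem : ∀ i, avg ρ (f i) ∈ I := fun i => by
    have h0 := (Submodule.restrictScalars_mem k _ _).1 (hav i)
    have h1 : avg ρ (f i) - f i ∈ I :=
      (Ideal.mul_le_right : idealOfVars σ k * I ≤ I) h0
    rw [← sub_add_cancel (avg ρ (f i)) (f i)]
    exact Ideal.add_mem _ h1 (hf i)
  have hcl : (fun i => conormalMk I ⟨avg ρ (f i), hmem i⟩) =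
      fun i => conormalMk I ⟨f i, hf i⟩ := by
    funext i
    rw [← sub_eq_zero, ← map_sub, conormalMk_eq_zero]
    exact hav i
  have hhom : ∀ i, ∃ e, IsWeightedHomogeneous d (avg ρ (f i)) e := by
    intro i
    obtain ⟨e, he⟩ := hw i
    exact ⟨e, avg_mem ρ (M := weightedHomogeneousSubmodule k d e) fun g => hρ g _ _ he⟩
  refine ⟨fun i => avg ρ (f i), hmem, hhom, fun g i => map_avg ρ g (f i), ?_, ?_⟩
  · rw [hcl]; exact hli
  · refine WHomog.span_eq_of_span_conormal hd hmem hhom ?_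
    rw [hcl]; exact hspan

/-- The relation ideal of a good presentation is generated by invariant homogeneous elements
whose classes form a basis of the conormal space. -/
theorem GoodSetup.exists_invariant_generators [CharZero k] (h : GoodSetup Wt G p d c) :
    ∃ (s : ℕ) (f : Fin s → MvPolynomial (Fin m) k) (hf : ∀ i, f i ∈ relIdeal p),
      s + n ≤ m ∧ (∀ i, ∃ e, IsWeightedHomogeneous d (f i) e) ∧
      (∀ w i, polyAct (c w) (f i) = f i) ∧
      LinearIndependent k (fun i => conormalMk (relIdeal p) ⟨f i, hf i⟩) ∧
      Ideal.span (Set.range f) = relIdeal p := by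
  have : Finite ↥Wt := h.finite
  have : Fintype ↥Wt := Fintype.ofFinite _
  have hI : WHomog d (relIdeal p) := whomog_ker_aeval h.homog
  obtain ⟨f, hf, h1, h2, h3, h4⟩ := hI.exists_invariant_generators h.dpos
    (actionHom (groupAct Wt) p h.linearIndependent c h.equivar)
    (fun w _ _ he => isWeightedHomogeneous_polyAct (M := c w) (fun _ _ hne => h.weight_eq w hne) he)
    (fun w f hf => h.trivial w f hf)
  exact ⟨_, f, hf, h.finrank_le, h1, h2, h3, h4⟩

end Equivariance

section Slice

variable {k : Type} [Field k] {n m : ℕ}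

/-- The substitution given by an affine transformation. -/
def affSub (M : Matrix (Fin n) (Fin n) k) (v : Fin n → k) :
    MvPolynomial (Fin n) k →ₐ[k] MvPolynomial (Fin n) k :=
  aeval fun i => ∑ j, M i j • X j + C (v i)

theorem affSub_X (M : Matrix (Fin n) (Fin n) k) (v : Fin n → k) (i : Fin n) :
    affSub M v (X i) = ∑ j, M i j • X j + C (v i) := by rw [affSub, aeval_X]

theorem linSub_eq_affSub (M : Matrix (Fin n) (Fin n) k) : linSub M = affSub M 0 := by
  ext1 i
  rw [linSub_X, affSub_X, Pi.zero_apply, C_0, add_zero]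

theorem affSub_linSub (M N : Matrix (Fin n) (Fin n) k) (v : Fin n → k)
    (f : MvPolynomial (Fin n) k) :
    affSub M v (linSub N f) = affSub (N * M) (N.mulVec v) f := by
  have : (affSub M v).comp (linSub N) = affSub (N * M) (N.mulVec v) := by
    ext1 i
    rw [AlgHom.comp_apply, linSub_X, affSub_X, map_sum]
    simp only [map_smul, affSub_X, smul_add, Finset.sum_add_distrib, Finset.smul_sum, smul_smul,
      Matrix.mul_apply, Finset.sum_smul, Matrix.mulVec, dotProduct, map_sum, C_mul', C_mul]
    rw [Finset.sum_comm]
  exact DFunLike.congr_fun this f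

theorem linSub_affSub (M N : Matrix (Fin n) (Fin n) k) (v : Fin n → k)
    (f : MvPolynomial (Fin n) k) :
    linSub N (affSub M v f) = affSub (M * N) v f := by
  have : (linSub N).comp (affSub M v) = affSub (M * N) v := by
    ext1 i
    rw [AlgHom.comp_apply, affSub_X, affSub_X, map_add, map_sum, algHom_C]
    simp only [map_smul, linSub_X, Finset.smul_sum, smul_smul, Matrix.mul_apply, Finset.sum_smul,
      algebraMap_eq]
    rw [Finset.sum_comm]
  exact DFunLike.congr_fun this f

theorem affSub_zero (v : Fin n → k) (f : MvPolynomial (Fin n) k) :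
    affSub 0 v f = C (eval v f) := by
  have : affSub 0 v = (Algebra.ofId k (MvPolynomial (Fin n) k)).comp (aeval v) := by
    ext1 i
    rw [affSub_X, AlgHom.comp_apply, aeval_X]
    simp [Algebra.ofId_apply]
  rw [this]; rfl

theorem eval_linSub (M : Matrix (Fin n) (Fin n) k) (v : Fin n → k) (f : MvPolynomial (Fin n) k) :
    eval v (linSub M f) = eval (M.mulVec v) f := by
  apply C_injective (Fin n) k
  rw [← affSub_zero, affSub_linSub, mul_zero, affSub_zero]

theorem eval_matAct (g : Matrix.GeneralLinearGroup (Fin n) k) (v : Fin n → k)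
    (f : MvPolynomial (Fin n) k) :
    eval v (matAct g f) =
      eval (Matrix.mulVec (↑(g⁻¹) : Matrix (Fin n) (Fin n) k) v) f := by
  rw [matAct_eq, eval_linSub]

/-- A pair of complementary projections commuting with a finite group `Wt`. -/
structure Splitting (Wt : Subgroup (Matrix.GeneralLinearGroup (Fin n) k))
    (E₁ E₂ : Matrix (Fin n) (Fin n) k) : Prop where
  add : E₁ + E₂ = 1
  mul : E₁ * E₂ = 0
  mul' : E₂ * E₁ = 0
  comm : ∀ w ∈ Wt, (w : Matrix (Fin n) (Fin n) k) * E₁ = E₁ * w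
  comm' : ∀ w ∈ Wt, (w : Matrix (Fin n) (Fin n) k) * E₂ = E₂ * w
  rank : E₁.rank + E₂.rank = n

/-- The pointwise stabilizer of the image of a matrix. -/
abbrev fixSub (E : Matrix (Fin n) (Fin n) k) : Subgroup (Matrix.GeneralLinearGroup (Fin n) k) :=
  pointStab (LinearMap.range (Matrix.toLin' E))

theorem mem_fixSub {E : Matrix (Fin n) (Fin n) k} {g : Matrix.GeneralLinearGroup (Fin n) k} :
    g ∈ fixSub E ↔ (g : Matrix (Fin n) (Fin n) k) * E = E := by
  change (∀ x ∈ LinearMap.range (Matrix.toLin' E), Matrix.mulVec _ x = x) ↔ _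
  rw [← Matrix.toLin'.injective.eq_iff, LinearMap.ext_iff]
  simp [Matrix.toLin'_mul]

namespace Splitting

variable {Wt : Subgroup (Matrix.GeneralLinearGroup (Fin n) k)}
  {E₁ E₂ : Matrix (Fin n) (Fin n) k}

theorem symm (h : Splitting Wt E₁ E₂) : Splitting Wt E₂ E₁ where
  add := by rw [add_comm, h.add]
  mul := h.mul'
  mul' := h.mul
  comm := h.comm'
  comm' := h.comm
  rank := by rw [add_comm, h.rank]

theorem mono (h : Splitting Wt E₁ E₂) {G : Subgroup (Matrix.GeneralLinearGroup (Fin n) k)}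
    (hG : G ≤ Wt) : Splitting G E₁ E₂ :=
  { h with
    comm := fun w hw => h.comm w (hG hw)
    comm' := fun w hw => h.comm' w (hG hw) }

theorem mul_self (h : Splitting Wt E₁ E₂) : E₁ * E₁ = E₁ := by
  have := congrArg (E₁ * ·) h.add
  simpa [mul_add, h.mul] using this

theorem linSub_linSub_self (h : Splitting Wt E₁ E₂) (f : MvPolynomial (Fin n) k) :
    linSub E₁ (linSub E₁ f) = linSub E₁ f := by rw [linSub_linSub, h.mul_self]

theorem matAct_linSub (h : Splitting Wt E₁ E₂) {w : Matrix.GeneralLinearGroup (Fin n) k}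
    (hw : w ∈ Wt) (f : MvPolynomial (Fin n) k) :
    matAct w (linSub E₁ f) = linSub E₁ (matAct w f) := by
  rw [matAct_eq, linSub_linSub, linSub_linSub, h.comm _ (inv_mem hw)]

/-- Elements of the stabilizer act trivially on the corresponding subalgebra. -/
theorem matAct_eq_self (h : Splitting Wt E₁ E₂) {w : Matrix.GeneralLinearGroup (Fin n) k}
    (hw : w ∈ Wt) (hw' : w ∈ fixSub E₁) {f : MvPolynomial (Fin n) k} (hf : linSub E₁ f = f) :
    matAct w f = f := by
  rw [← hf, matAct_eq, linSub_linSub, ← h.comm _ (inv_mem hw), mem_fixSub.1 (inv_mem hw')]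

theorem mulVec_zero (h : Splitting Wt E₁ E₂) {v : Fin n → k} (hv : E₂.mulVec v = v) :
    E₁.mulVec v = 0 := by
  rw [← hv, Matrix.mulVec_mulVec, h.mul, Matrix.zero_mulVec]

theorem affSub_linSub_left (h : Splitting Wt E₁ E₂) {v : Fin n → k} (hv : E₂.mulVec v = v)
    (f : MvPolynomial (Fin n) k) : affSub E₁ v (linSub E₁ f) = linSub E₁ f := by
  rw [affSub_linSub, h.mul_self, h.mulVec_zero hv, linSub_eq_affSub]

theorem linSub_affSub_left (h : Splitting Wt E₁ E₂) (v : Fin n → k)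
    (f : MvPolynomial (Fin n) k) : linSub E₁ (affSub E₁ v f) = affSub E₁ v f := by
  rw [linSub_affSub, h.mul_self]

theorem affSub_linSub_right (h : Splitting Wt E₁ E₂) {v : Fin n → k} (hv : E₂.mulVec v = v)
    (f : MvPolynomial (Fin n) k) : affSub E₁ v (linSub E₂ f) = C (eval v f) := by
  rw [affSub_linSub, h.mul', hv, affSub_zero]

theorem affSub_eq_C (h : Splitting Wt E₁ E₂) {v : Fin n → k} (hv : E₂.mulVec v = v)
    {f : MvPolynomial (Fin n) k} (hf : linSub E₂ f = f) : affSub E₁ v f = C (eval v f) := by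
  rw [← h.affSub_linSub_right hv, hf]

theorem affSub_matAct (h : Splitting Wt E₁ E₂) {w : Matrix.GeneralLinearGroup (Fin n) k}
    (hw : w ∈ Wt) {v : Fin n → k}
    (hv : Matrix.mulVec (w : Matrix (Fin n) (Fin n) k) v = v) (f : MvPolynomial (Fin n) k) :
    affSub E₁ v (matAct w f) = matAct w (affSub E₁ v f) := by
  have hv' : Matrix.mulVec (↑(w⁻¹) : Matrix (Fin n) (Fin n) k) v = v := by
    conv_lhs => rw [← hv]
    rw [Matrix.mulVec_mulVec, ← Units.val_mul, inv_mul_cancel, Units.val_one, Matrix.one_mulVec]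
  rw [matAct_eq, affSub_linSub, linSub_affSub, h.comm _ (inv_mem hw), hv']

/-- The ideal of the affine subspace through `v` parallel to the image of `E₁`. -/
def sliceIdeal (E₂ : Matrix (Fin n) (Fin n) k) (v : Fin n → k) : Ideal (MvPolynomial (Fin n) k) :=
  Ideal.span (Set.range fun i => linSub E₂ (X i) - C (v i))

theorem sub_affSub_mem (h : Splitting Wt E₁ E₂) (v : Fin n → k) (f : MvPolynomial (Fin n) k) :
    f - affSub E₁ v f ∈ sliceIdeal E₂ v := by
  refine sub_mem_of_lift (AlgHom.id k _) (affSub E₁ v) _ (fun i => ?_) f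
  have h1 : (X i : MvPolynomial (Fin n) k) = linSub E₁ (X i) + linSub E₂ (X i) := by
    have := congrArg (fun M => linSub M (X i)) h.add
    simp only [linSub_one, AlgHom.id_apply] at this
    conv_lhs => rw [← this]
    simp only [linSub_X, Matrix.add_apply, add_smul, Finset.sum_add_distrib]
  have h2 : AlgHom.id k (MvPolynomial (Fin n) k) (X i) - affSub E₁ v (X i) =
      linSub E₂ (X i) - C (v i) := by
    rw [AlgHom.id_apply, affSub_X, ← linSub_X]
    nth_rw 1 [h1]
    ring
  rw [h2]
  exact Ideal.subset_span ⟨i, rfl⟩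

theorem mem_sliceIdeal (h : Splitting Wt E₁ E₂) {v : Fin n → k} {f : MvPolynomial (Fin n) k}
    (hf : affSub E₁ v f = 0) : f ∈ sliceIdeal E₂ v := by
  have := h.sub_affSub_mem v f
  rwa [hf, sub_zero] at this

theorem mem_sliceIdeal_of_eval (h : Splitting Wt E₁ E₂) {v : Fin n → k} (hv : E₂.mulVec v = v)
    {f : MvPolynomial (Fin n) k} (hf : linSub E₂ f = f) (hf0 : eval v f = 0) :
    f ∈ sliceIdeal E₂ v :=
  h.mem_sliceIdeal (by rw [h.affSub_eq_C hv hf, hf0, C_0])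

theorem affSub_eq_zero (h : Splitting Wt E₁ E₂) {v : Fin n → k} (hv : E₂.mulVec v = v)
    {f : MvPolynomial (Fin n) k} (hf : f ∈ sliceIdeal E₂ v) : affSub E₁ v f = 0 := by
  have : sliceIdeal E₂ v ≤ RingHom.ker (affSub E₁ v) := Ideal.span_le.2 (by
    rintro _ ⟨i, rfl⟩
    change affSub E₁ v _ = 0
    rw [map_sub, h.affSub_linSub_right hv, eval_X, algHom_C, algebraMap_eq, sub_self])
  exact this hf

end Splitting
end Slice

section Descent

variable {k : Type} [Field k] {n m : ℕ}
variable {G : Subgroup (Matrix.GeneralLinearGroup (Fin n) k)} {E₁ E₂ : Matrix (Fin n) (Fin n) k}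

/-- The trace of a polynomial with respect to a finite group. -/
def groupTrace (G : Subgroup (Matrix.GeneralLinearGroup (Fin n) k)) [Fintype ↥G] :
    MvPolynomial (Fin n) k →ₗ[k] MvPolynomial (Fin n) k :=
  ∑ g : ↥G, (matAct (g : Matrix.GeneralLinearGroup (Fin n) k)).toLinearMap

section
variable [Fintype ↥G]

theorem groupTrace_apply (f : MvPolynomial (Fin n) k) :
    groupTrace G f = ∑ g : ↥G, matAct (g : Matrix.GeneralLinearGroup (Fin n) k) f := by
  simp [groupTrace]

theorem groupTrace_mem (f : MvPolynomial (Fin n) k) : groupTrace G f ∈ invariants G := by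
  intro g hg
  rw [groupTrace_apply, map_sum]
  refine Fintype.sum_equiv (Equiv.mulLeft ⟨g, hg⟩) _ _ fun g' => ?_
  rw [Equiv.coe_mulLeft, Subgroup.coe_mul, matAct_mul]; rfl

theorem groupTrace_mul {x : MvPolynomial (Fin n) k} (hx : x ∈ invariants G)
    (f : MvPolynomial (Fin n) k) : groupTrace G (f * x) = groupTrace G f * x := by
  rw [groupTrace_apply, groupTrace_apply, Finset.sum_mul]
  exact Finset.sum_congr rfl fun g _ => by rw [map_mul, hx _ g.2]

theorem Splitting.groupTrace_linSub (h : Splitting G E₁ E₂) {f : MvPolynomial (Fin n) k}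
    (hf : linSub E₂ f = f) : linSub E₂ (groupTrace G f) = groupTrace G f := by
  rw [groupTrace_apply, map_sum]
  exact Finset.sum_congr rfl fun g _ => by rw [← h.symm.matAct_linSub g.2, hf]

theorem exists_mem_aeval_eq_groupTrace {p : Fin m → MvPolynomial (Fin n) k}
    (hp : Algebra.adjoin k (Set.range p) = invariants G) {𝔞 : Ideal (MvPolynomial (Fin m) k)}
    {z : MvPolynomial (Fin n) k} (hz : z ∈ 𝔞.map (aeval p)) :
    ∃ M ∈ 𝔞, aeval p M = groupTrace G z := by
  rw [Algebra.adjoin_range_eq_range_aeval] at hp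
  suffices ∀ β, ∃ M ∈ 𝔞, aeval p M = groupTrace G (β * z) by simpa using this 1
  refine Submodule.span_induction (p := fun z _ => ∀ β, ∃ M ∈ 𝔞, aeval p M =
    groupTrace G (β * z)) ?_ ?_ ?_ ?_ hz
  · rintro _ ⟨M, hM, rfl⟩ β
    have hβ : groupTrace G β ∈ (aeval p : MvPolynomial (Fin m) k →ₐ[k] _).range := by
      rw [hp]; exact groupTrace_mem β
    obtain ⟨Q, hQ⟩ := hβ
    have hM' : aeval p M ∈ invariants G := by rw [← hp]; exact ⟨M, rfl⟩
    refine ⟨Q * M, Ideal.mul_mem_left _ _ hM, ?_⟩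
    rw [map_mul]
    exact (congrArg (· * aeval p M) hQ).trans (groupTrace_mul hM' β).symm
  · intro β
    exact ⟨0, zero_mem _, by simp⟩
  · intro x y _ _ hx hy β
    obtain ⟨M, hM, hM'⟩ := hx β
    obtain ⟨M', hM1, hM1'⟩ := hy β
    exact ⟨M + M', add_mem hM hM1, by rw [map_add, hM', hM1', mul_add, map_add]⟩
  · intro a x _ hx β
    obtain ⟨M, hM, hM'⟩ := hx (β * a)
    exact ⟨M, hM, by rw [hM', smul_eq_mul, mul_assoc]⟩

end

/-- The point `v` lies in the image of `E₂` and its stabilizer in `G` fixes this image. -/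
structure GenericPoint (G : Subgroup (Matrix.GeneralLinearGroup (Fin n) k))
    (E₂ : Matrix (Fin n) (Fin n) k) (v : Fin n → k) : Prop where
  fix : E₂.mulVec v = v
  mem_fixSub : ∀ g ∈ G, Matrix.mulVec (g : Matrix (Fin n) (Fin n) k) v = v → g ∈ fixSub E₂

variable {v : Fin n → k}

theorem mulVec_eq_of_mem_fixSub {g : Matrix.GeneralLinearGroup (Fin n) k} (hg : g ∈ fixSub E₂)
    (hv : E₂.mulVec v = v) : Matrix.mulVec (g : Matrix (Fin n) (Fin n) k) v = v :=
  hg v ⟨v, by rw [Matrix.toLin'_apply, hv]⟩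

/-- A polynomial on the image of `E₂` separating `v` from the other points of its orbit. -/
theorem Splitting.exists_separating (h : Splitting G E₁ E₂) [Finite ↥G]
    (hv : GenericPoint G E₂ v) :
    ∃ τ, linSub E₂ τ = τ ∧ eval v τ = 1 ∧
      ∀ g ∈ G, g ∉ fixSub E₂ → eval v (matAct g τ) = 0 := by
  classical
  have key : ∀ g : ↥G, ∃ y, linSub E₂ y = y ∧ eval v y = 1 ∧
      ((g : Matrix.GeneralLinearGroup (Fin n) k) ∉ fixSub E₂ →
        eval v (matAct (g : Matrix.GeneralLinearGroup (Fin n) k) y) = 0) := by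
    intro g
    by_cases hg : (g : Matrix.GeneralLinearGroup (Fin n) k) ∈ fixSub E₂
    · exact ⟨1, map_one _, map_one _, fun h => absurd hg h⟩
    have hgi : (g : Matrix.GeneralLinearGroup (Fin n) k)⁻¹ ∈ G := inv_mem g.2
    set u := Matrix.mulVec (((g : Matrix.GeneralLinearGroup (Fin n) k)⁻¹ :
      Matrix.GeneralLinearGroup (Fin n) k) : Matrix (Fin n) (Fin n) k) v with hu
    have hne : u ≠ v := fun h0 => hg (inv_mem_iff.1 (hv.mem_fixSub _ hgi h0))
    have hu2 : E₂.mulVec u = u := by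
      rw [hu, Matrix.mulVec_mulVec, ← h.comm' _ hgi, ← Matrix.mulVec_mulVec, hv.fix]
    obtain ⟨i, hi⟩ := Function.ne_iff.1 hne
    have hi' : v i - u i ≠ 0 := sub_ne_zero.2 (Ne.symm hi)
    refine ⟨(v i - u i)⁻¹ • (linSub E₂ (X i) - C (u i)), ?_, ?_, fun _ => ?_⟩
    · rw [map_smul, map_sub, h.symm.linSub_linSub_self, algHom_C, algebraMap_eq]
    · rw [smul_eval, map_sub, eval_linSub, hv.fix, eval_X, eval_C, inv_mul_cancel₀ hi']
    · rw [eval_matAct]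
      change eval u _ = 0
      rw [smul_eval, map_sub, eval_linSub, hu2, eval_X, eval_C, sub_self, mul_zero]
  choose y hy1 hy2 hy3 using key
  have := Fintype.ofFinite ↥G
  refine ⟨∏ g, y g, ?_, ?_, ?_⟩
  · rw [map_prod]; exact Finset.prod_congr rfl fun g _ => hy1 g
  · rw [map_prod]; exact Finset.prod_eq_one fun g _ => hy2 g
  · intro g hg hg'
    have h0 : eval v (matAct g (y ⟨g, hg⟩)) = 0 := hy3 ⟨g, hg⟩ hg'
    obtain ⟨z, hz⟩ := Finset.dvd_prod_of_mem y (Finset.mem_univ (⟨g, hg⟩ : ↥G))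
    rw [hz, map_mul, map_mul, h0, zero_mul]

open Classical in
theorem Splitting.affSub_groupTrace [Fintype ↥G] (h : Splitting G E₁ E₂)
    (hv : E₂.mulVec v = v) {τ : MvPolynomial (Fin n) k} (h1 : linSub E₂ τ = τ)
    (h2 : eval v τ = 1) (h3 : ∀ g ∈ G, g ∉ fixSub E₂ → eval v (matAct g τ) = 0)
    (z : MvPolynomial (Fin n) k) :
    affSub E₁ v (groupTrace G (τ * z)) =
      ∑ g : ↥G, if (g : Matrix.GeneralLinearGroup (Fin n) k) ∈ fixSub E₂ then
        matAct (g : Matrix.GeneralLinearGroup (Fin n) k) (affSub E₁ v z) else 0 := by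
  rw [groupTrace_apply, map_sum]
  refine Finset.sum_congr rfl fun g _ => ?_
  have h4 : linSub E₂ (matAct (g : Matrix.GeneralLinearGroup (Fin n) k) τ) =
      matAct (g : Matrix.GeneralLinearGroup (Fin n) k) τ := by
    rw [← h.symm.matAct_linSub g.2, h1]
  rw [map_mul, map_mul, h.affSub_eq_C hv h4]
  split_ifs with hg
  · rw [h.symm.matAct_eq_self g.2 hg h1, h2, C_1, one_mul,
      h.affSub_matAct g.2 (mulVec_eq_of_mem_fixSub hg hv)]
  · rw [h3 _ g.2 hg, C_0, zero_mul]

/-- The ideal generated by the invariants of the image of `E₂` vanishing at `v`. -/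
def orbitIdeal (E₂ : Matrix (Fin n) (Fin n) k) (v : Fin n → k)
    (p : Fin m → MvPolynomial (Fin n) k) : Ideal (MvPolynomial (Fin n) k) :=
  Ideal.span (Set.range fun i => linSub E₂ (p i) - C (eval v (p i)))

theorem Splitting.sub_mem_orbitIdeal (h : Splitting G E₁ E₂)
    {p : Fin m → MvPolynomial (Fin n) k}
    (hp : Algebra.adjoin k (Set.range p) = invariants G) (hv : E₂.mulVec v = v)
    {c : MvPolynomial (Fin n) k} (hc : c ∈ invariants G) (hc' : linSub E₂ c = c) :
    c - C (eval v c) ∈ orbitIdeal E₂ v p := by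
  rw [← hp, Algebra.adjoin_range_eq_range_aeval] at hc
  obtain ⟨Q, rfl⟩ := hc
  change aeval p Q - _ ∈ _
  change linSub E₂ (aeval p Q) = aeval p Q at hc'
  have h1 := sub_mem_of_lift ((linSub E₂).comp (aeval p))
    ((affSub E₁ v).comp ((linSub E₂).comp (aeval p))) (orbitIdeal E₂ v p) (fun i => by
      rw [AlgHom.comp_apply, AlgHom.comp_apply, AlgHom.comp_apply, aeval_X,
        h.affSub_linSub_right hv]
      exact Ideal.subset_span ⟨i, rfl⟩) Q
  rw [AlgHom.comp_apply, AlgHom.comp_apply, AlgHom.comp_apply, h.affSub_linSub_right hv,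
    hc'] at h1
  exact h1

variable [CharZero k]

open Classical in
theorem Splitting.sliceIdeal_le (h : Splitting G E₁ E₂) [Finite ↥G]
    {p : Fin m → MvPolynomial (Fin n) k}
    (hp : Algebra.adjoin k (Set.range p) = invariants G) (hv : GenericPoint G E₂ v) :
    sliceIdeal E₂ v ≤ orbitIdeal E₂ v p ⊔ sliceIdeal E₂ v * sliceIdeal E₂ v := by
  have := Fintype.ofFinite ↥G
  obtain ⟨τ, h1, h2, h3⟩ := h.exists_separating hv
  refine Ideal.span_le.2 ?_
  rintro _ ⟨i, rfl⟩
  set y := linSub E₂ (X i) - C (v i) with hy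
  have hy1 : linSub E₂ y = y := by
    rw [hy, map_sub, h.symm.linSub_linSub_self, algHom_C, algebraMap_eq]
  have hym : y ∈ sliceIdeal E₂ v := Ideal.subset_span ⟨i, rfl⟩
  set c := groupTrace G (τ * (τ * y)) with hc
  have hc1 : linSub E₂ c = c := h.groupTrace_linSub (by rw [map_mul, map_mul, h1, hy1])
  have hc0 : affSub E₁ v c = 0 := by
    rw [hc, h.affSub_groupTrace hv.fix h1 h2 h3]
    refine Finset.sum_eq_zero fun g _ => ?_
    rw [map_mul, h.affSub_eq_zero hv.fix hym, mul_zero, map_zero, ite_self]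
  have hcn : c ∈ orbitIdeal E₂ v p := by
    have h4 := h.sub_mem_orbitIdeal hp hv.fix (groupTrace_mem (τ * (τ * y))) hc1
    rw [← hc, ← h.affSub_eq_C hv.fix hc1, hc0, sub_zero] at h4
    exact h4
  set S := Finset.univ.filter fun g : ↥G =>
    (g : Matrix.GeneralLinearGroup (Fin n) k) ∈ fixSub E₂
  have hS : (S.card : k) ≠ 0 := by
    have : S.Nonempty := ⟨1, by
      rw [Finset.mem_filter]; exact ⟨Finset.mem_univ _, one_mem _⟩⟩
    exact_mod_cast this.card_pos.ne'
  have hd : c - (S.card : k) • y ∈ sliceIdeal E₂ v * sliceIdeal E₂ v := by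
    have h5 : (S.card : k) • y = ∑ g : ↥G, if
        (g : Matrix.GeneralLinearGroup (Fin n) k) ∈ fixSub E₂ then y else 0 := by
      rw [← Finset.sum_filter, Finset.sum_const, Nat.cast_smul_eq_nsmul]
    rw [h5, hc, groupTrace_apply, ← Finset.sum_sub_distrib]
    refine Ideal.sum_mem _ fun g _ => ?_
    split_ifs with hg
    · rw [h.symm.matAct_eq_self g.2 hg (by rw [map_mul, map_mul, h1, hy1])]
      have h6 : τ - 1 ∈ sliceIdeal E₂ v := h.mem_sliceIdeal_of_eval hv.fix
        (by rw [map_sub, h1, map_one]) (by rw [map_sub, h2, map_one, sub_self])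
      have h7 : τ * (τ * y) - y = (τ - 1) * ((τ + 1) * y) := by ring
      rw [h7]
      exact Ideal.mul_mem_mul h6 (Ideal.mul_mem_left _ _ hym)
    · have h6 : matAct (g : Matrix.GeneralLinearGroup (Fin n) k) τ ∈ sliceIdeal E₂ v :=
        h.mem_sliceIdeal_of_eval hv.fix (by rw [← h.symm.matAct_linSub g.2, h1]) (h3 _ g.2 hg)
      rw [sub_zero, map_mul, map_mul]
      exact Ideal.mul_mem_mul h6 (Ideal.mul_mem_right _ _ h6)
  have hfin : y = C (S.card : k)⁻¹ * (c - (c - (S.card : k) • y)) := by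
    rw [sub_sub_cancel, ← smul_eq_C_mul, smul_smul, inv_mul_cancel₀ hS, one_smul]
  change y ∈ _
  rw [hfin]
  exact Ideal.mul_mem_left _ _ (Ideal.sub_mem _ (Ideal.mem_sup_left hcn) (Ideal.mem_sup_right hd))

theorem Splitting.exists_mul_mem_orbitIdeal (h : Splitting G E₁ E₂) [Finite ↥G]
    {p : Fin m → MvPolynomial (Fin n) k}
    (hp : Algebra.adjoin k (Set.range p) = invariants G) (hv : GenericPoint G E₂ v) :
    ∃ b, linSub E₂ b = b ∧ affSub E₁ v b = 1 ∧
      ∀ x ∈ sliceIdeal E₂ v, b * x ∈ orbitIdeal E₂ v p := by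
  obtain ⟨b, hb, hb'⟩ := Submodule.exists_sub_one_mem_and_smul_le_of_fg_of_le_sup
    (R := MvPolynomial (Fin n) k) (I := sliceIdeal E₂ v) (N := orbitIdeal E₂ v p)
    (N' := sliceIdeal E₂ v) (P := sliceIdeal E₂ v)
    ((inferInstance : IsNoetherianRing (MvPolynomial (Fin n) k)).noetherian _)
    le_rfl (h.sliceIdeal_le hp hv)
  have hmap : ∀ f ∈ orbitIdeal E₂ v p, linSub E₂ f ∈ orbitIdeal E₂ v p := by
    have : orbitIdeal E₂ v p ≤ (orbitIdeal E₂ v p).comap (linSub E₂) := Ideal.span_le.2 (by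
      rintro _ ⟨i, rfl⟩
      change linSub E₂ _ ∈ orbitIdeal E₂ v p
      rw [map_sub, h.symm.linSub_linSub_self, algHom_C]
      exact Ideal.subset_span ⟨i, rfl⟩)
    exact this
  refine ⟨linSub E₂ b, h.symm.linSub_linSub_self b, ?_, ?_⟩
  · have h0 := h.affSub_eq_zero hv.fix hb
    rw [map_sub, map_one, sub_eq_zero] at h0
    have h1 := h.affSub_linSub_right hv.fix b
    have h2 : C (eval v b) = linSub E₂ (affSub E₁ v b) := by
      rw [linSub_affSub, h.mul, affSub_zero]
    rw [h1, h2, h0, map_one]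
  · intro x hx
    refine Submodule.span_induction
      (p := fun x _ => linSub E₂ b * x ∈ orbitIdeal E₂ v p) ?_ ?_ ?_ ?_ hx
    · rintro _ ⟨i, rfl⟩
      have h5 : linSub E₂ (X i) - C (v i) ∈ sliceIdeal E₂ v := Ideal.subset_span ⟨i, rfl⟩
      have h3 : b * (linSub E₂ (X i) - C (v i)) ∈ orbitIdeal E₂ v p :=
        SetLike.le_def.1 hb' (Submodule.smul_mem_pointwise_smul (linSub E₂ (X i) - C (v i)) b
          (sliceIdeal E₂ v) h5)
      have h4 := hmap _ h3
      rw [map_mul, map_sub, h.symm.linSub_linSub_self, algHom_C] at h4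
      exact h4
    · rw [mul_zero]; exact zero_mem _
    · intro x y _ _ hx hy
      rw [mul_add]; exact add_mem hx hy
    · intro a x _ hx
      rw [smul_eq_mul, mul_left_comm]; exact Ideal.mul_mem_left _ _ hx

end Descent

section Presentations

variable {K : Type} [Field K] {σ τ : Type} {S : Type} [CommRing S] [Algebra K S]

/-- An endomorphism `θ` of an algebra lifts to an endomorphism of the presentation `u`
which acts trivially on the conormal space. -/
def TriviallyActs (u : σ → S) (θ : S →ₐ[K] S) : Prop :=
  ∃ φ : MvPolynomial σ K →ₐ[K] MvPolynomial σ K, Augmented φ ∧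
    (∀ f, aeval u (φ f) = θ (aeval u f)) ∧
    TrivialOnConormal (RingHom.ker (aeval u : MvPolynomial σ K →ₐ[K] S)) φ

theorem Lifts.triviallyActs {u : σ → S} {u' : τ → S} (L : Lifts (K := K) (aeval u) (aeval u'))
    {θ : S →ₐ[K] S} (h : TriviallyActs u θ) : TriviallyActs u' θ := by
  obtain ⟨φ, h1, h2, h3⟩ := h
  have h4 : ∀ f, aeval u' (L.fwd.comp (φ.comp L.bwd) f) = θ (aeval u' f) := fun f => by
    rw [AlgHom.comp_apply, AlgHom.comp_apply, L.apply_fwd, h2, L.apply_bwd]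
  have h5 := L.fwd_aug.comp (h1.comp L.bwd_aug)
  exact ⟨_, h5, h4, L.trivialOnConormal h1 h2 h5 (fun i => h4 _) h3⟩

/-- The reflexive relation between presentations. -/
def Lifts.refl (P : MvPolynomial σ K →ₐ[K] S) : Lifts P P :=
  ⟨AlgHom.id K _, AlgHom.id K _, augmented_id, augmented_id, rfl, rfl⟩

theorem TriviallyActs.trivialOnConormal {u : σ → S} {θ : S →ₐ[K] S} (h : TriviallyActs u θ)
    {φ : MvPolynomial σ K →ₐ[K] MvPolynomial σ K} (hφ : Augmented φ)
    (hφ' : ∀ f, aeval u (φ f) = θ (aeval u f)) :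
    TrivialOnConormal (RingHom.ker (aeval u : MvPolynomial σ K →ₐ[K] S)) φ := by
  obtain ⟨ψ, h1, h2, h3⟩ := h
  exact (Lifts.refl _).trivialOnConormal h1 h2 hφ (fun i => hφ' _) h3

theorem TriviallyActs.comp {u : σ → S} {θ θ' : S →ₐ[K] S} (h : TriviallyActs u θ)
    (h' : TriviallyActs u θ') : TriviallyActs u (θ.comp θ') := by
  obtain ⟨φ, h1, h2, h3⟩ := h
  obtain ⟨ψ, h1', h2', h3'⟩ := h'
  refine ⟨φ.comp ψ, h1.comp h1', fun f => by
    rw [AlgHom.comp_apply, AlgHom.comp_apply, h2, h2'], fun f hf hf2 => ?_⟩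
  have h4 := h1.mem_mul (J := RingHom.ker (aeval u : MvPolynomial σ K →ₐ[K] S))
    (fun g hg => by rw [RingHom.mem_ker] at *; rw [h2, hg, map_zero]) (h3' f hf hf2)
  have h5 : (φ.comp ψ) f - f = φ (ψ f - f) + (φ f - f) := by
    rw [AlgHom.comp_apply, map_sub]; ring
  rw [h5]
  exact Ideal.add_mem _ h4 (h3 f hf hf2)

theorem triviallyActs_id (u : σ → S) : TriviallyActs u (AlgHom.id K S) :=
  ⟨AlgHom.id K _, augmented_id, fun _ => rfl, fun f _ _ => by
    rw [AlgHom.id_apply, sub_self]; exact zero_mem _⟩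

theorem Augmented.sub_mem {φ : MvPolynomial σ K →ₐ[K] MvPolynomial σ K} (hφ : Augmented φ)
    (f : MvPolynomial σ K) : φ f - f ∈ idealOfVars σ K := by
  rw [mem_idealOfVars_iff, map_sub, hφ.constantCoeff_apply, sub_self]

/-- An endomorphism fixing generators of an ideal acts trivially on its conormal space. -/
theorem Augmented.sub_mem_mul {φ : MvPolynomial σ K →ₐ[K] MvPolynomial σ K} (hφ : Augmented φ)
    {s : Set (MvPolynomial σ K)} (hs : ∀ f ∈ s, φ f = f) {f : MvPolynomial σ K}
    (hf : f ∈ Ideal.span s) : φ f - f ∈ idealOfVars σ K * Ideal.span s := by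
  refine Submodule.span_induction
    (p := fun f _ => φ f - f ∈ idealOfVars σ K * Ideal.span s) ?_ ?_ ?_ ?_ hf
  · intro x hx
    rw [hs x hx, sub_self]; exact zero_mem _
  · rw [map_zero, sub_self]; exact zero_mem _
  · intro x y _ _ hx hy
    rw [map_add, add_sub_add_comm]; exact add_mem hx hy
  · intro a x hx' hx
    have : φ (a • x) - a • x = (φ a - a) * x + φ a * (φ x - x) := by
      rw [smul_eq_mul, map_mul]; ring
    rw [this]
    exact add_mem (Ideal.mul_mem_mul (hφ.sub_mem a) hx') (Ideal.mul_mem_left _ _ hx)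

end Presentations

section Translation

variable {K : Type} [Field K] {σ : Type}

/-- The translation automorphism of a polynomial ring. -/
def translate (a : σ → K) : MvPolynomial σ K →ₐ[K] MvPolynomial σ K :=
  aeval fun i => X i + C (a i)

theorem translate_X (a : σ → K) (i : σ) : translate a (X i) = X i + C (a i) := by
  rw [translate, aeval_X]

theorem translate_translate_neg (a : σ → K) (f : MvPolynomial σ K) :
    translate a (translate (-a) f) = f := by
  have : (translate a).comp (translate (-a)) = AlgHom.id K _ := by
    ext1 i
    rw [AlgHom.comp_apply, translate_X, map_add, translate_X, algHom_C, algebraMap_eq,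
      Pi.neg_apply, map_neg, add_neg_cancel_right, AlgHom.id_apply]
  exact DFunLike.congr_fun this f

end Translation

section Slices

variable {k : Type} [Field k] {n m : ℕ}
variable {G : Subgroup (Matrix.GeneralLinearGroup (Fin n) k)} {E₁ E₂ : Matrix (Fin n) (Fin n) k}


theorem exists_genericPoint [CharZero k] [Finite ↥G] (h : Splitting G E₁ E₂) :
    ∃ v, GenericPoint G E₂ v := by
  let S : {g : ↥G // (g : Matrix.GeneralLinearGroup (Fin n) k) ∉ fixSub E₂} →
      Subspace k (Fin n → k) := fun g => LinearMap.ker (Matrix.toLin'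
        (((g : ↥G) : Matrix.GeneralLinearGroup (Fin n) k) * E₂ - E₂ :
          Matrix (Fin n) (Fin n) k))
  have h1 : (⋃ i, (S i : Set (Fin n → k))) ≠ Set.univ := by
    intro h2
    obtain ⟨g, hg⟩ := Subspace.exists_eq_top_of_iUnion_eq_univ h2
    apply g.2
    rw [mem_fixSub, ← sub_eq_zero]
    rw [LinearMap.ker_eq_top] at hg
    exact Matrix.toLin'.injective (by rw [hg, map_zero])
  obtain ⟨x, hx⟩ := (Set.ne_univ_iff_exists_notMem _).1 h1
  refine ⟨E₂.mulVec x, by rw [Matrix.mulVec_mulVec, h.symm.mul_self], fun g hg hgx => ?_⟩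
  by_contra hg'
  refine hx (Set.mem_iUnion.2 ⟨⟨⟨g, hg⟩, hg'⟩, ?_⟩)
  change _ ∈ LinearMap.ker _
  rw [LinearMap.mem_ker, Matrix.toLin'_apply, Matrix.sub_mulVec, ← Matrix.mulVec_mulVec]
  exact sub_eq_zero.2 hgx

/-- The ideal of relations defining the orbit of `v`. -/
def liftIdeal (P : Fin m → MvPolynomial (Fin m) k) (a : Fin m → k) :
    Ideal (MvPolynomial (Fin m) k) :=
  Ideal.span (Set.range fun i => P i - C (a i))

end Slices

section Slices

variable {k : Type} [Field k] {n m : ℕ}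
variable {G : Subgroup (Matrix.GeneralLinearGroup (Fin n) k)} {E₁ E₂ : Matrix (Fin n) (Fin n) k}
  {v : Fin n → k} {p : Fin m → MvPolynomial (Fin n) k} {P : Fin m → MvPolynomial (Fin m) k}

theorem map_liftIdeal (hP : ∀ i, aeval p (P i) = linSub E₂ (p i)) :
    (liftIdeal P fun i => eval v (p i)).map (aeval p : MvPolynomial (Fin m) k →ₐ[k] _) =
      orbitIdeal E₂ v p := by
  rw [liftIdeal, Ideal.map_span, orbitIdeal, ← Set.range_comp]
  congr 2
  funext i
  rw [Function.comp_apply, map_sub, hP, algHom_C, algebraMap_eq]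

theorem pow_mul_mem_pow {R : Type} [CommRing R] {I J : Ideal R} {b : R}
    (h : ∀ x ∈ I, b * x ∈ J) (N : ℕ) : ∀ x ∈ I ^ N, b ^ N * x ∈ J ^ N := by
  intro x hx
  induction N generalizing x with
  | zero => simp
  | succ N ih =>
    rw [pow_succ] at hx
    refine Submodule.mul_induction_on hx (fun a ha c hc => ?_) fun a c ha hc => ?_
    · have : b ^ (N + 1) * (a * c) = (b ^ N * a) * (b * c) := by ring
      rw [this, pow_succ]
      exact Ideal.mul_mem_mul (ih a ha) (h c hc)
    · rw [mul_add]; exact add_mem ha hc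

theorem aeval_aeval_lift (hP : ∀ i, aeval p (P i) = linSub E₂ (p i))
    (Q : MvPolynomial (Fin m) k) : aeval p (aeval P Q) = linSub E₂ (aeval p Q) := by
  have : (aeval p).comp (aeval P) = (linSub E₂).comp (aeval p) := by
    ext1 i
    rw [AlgHom.comp_apply, AlgHom.comp_apply, aeval_X, aeval_X, hP]
  exact DFunLike.congr_fun this Q

theorem aeval_lift_sub_mem (Q : MvPolynomial (Fin m) k) :
    aeval P Q - C (eval v (aeval p Q)) ∈ liftIdeal P fun i => eval v (p i) := by
  have h := sub_mem_of_lift (aeval P) (aeval fun i => C (eval v (p i)))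
    (liftIdeal P fun i => eval v (p i)) (fun i => by
      rw [aeval_X, aeval_X]; exact Ideal.subset_span ⟨i, rfl⟩) Q
  have h1 : (aeval fun i => (C (eval v (p i)) : MvPolynomial (Fin m) k)) =
      (Algebra.ofId k (MvPolynomial (Fin m) k)).comp ((aeval v).comp (aeval p)) := by
    ext1 i
    rw [aeval_X, AlgHom.comp_apply, AlgHom.comp_apply, aeval_X]; rfl
  rw [h1] at h
  exact h

theorem sum_ite_const_ne_zero [CharZero k] [Fintype ↥G]
    (E : Matrix (Fin n) (Fin n) k) :
    ∃ N : k, N ≠ 0 ∧ ∀ f : MvPolynomial (Fin n) k, (∑ g : ↥G,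
      open Classical in if (g : Matrix.GeneralLinearGroup (Fin n) k) ∈ fixSub E then f else 0) =
        C N * f := by
  classical
  refine ⟨((Finset.univ.filter fun g : ↥G =>
    (g : Matrix.GeneralLinearGroup (Fin n) k) ∈ fixSub E).card : k), ?_, fun f => ?_⟩
  · have : (Finset.univ.filter fun g : ↥G =>
      (g : Matrix.GeneralLinearGroup (Fin n) k) ∈ fixSub E).Nonempty := ⟨1, by
        rw [Finset.mem_filter]; exact ⟨Finset.mem_univ _, one_mem _⟩⟩
    exact_mod_cast this.card_pos.ne'
  · rw [← Finset.sum_filter, Finset.sum_const, ← Nat.cast_smul_eq_nsmul k, smul_eq_C_mul]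

theorem Splitting.mem_sup_of_mem_pow [CharZero k] [Finite ↥G] (h : Splitting G E₁ E₂)
    (hp : Algebra.adjoin k (Set.range p) = invariants G) (hv : GenericPoint G E₂ v)
    (hP : ∀ i, aeval p (P i) = linSub E₂ (p i)) (N : ℕ) {Q : MvPolynomial (Fin m) k}
    (hQ : Q ∈ (liftIdeal P fun i => eval v (p i)) ^ N)
    (hQ' : aeval p Q ∈ sliceIdeal E₂ v ^ (N + 1)) :
    Q ∈ relIdeal p ⊔ (liftIdeal P fun i => eval v (p i)) ^ (N + 1) := by
  classical
  have := Fintype.ofFinite ↥G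
  obtain ⟨τ, h1, h2, h3⟩ := h.exists_separating hv
  obtain ⟨b, hb, hb1, hb2⟩ := h.exists_mul_mem_orbitIdeal hp hv
  have hx : aeval p Q ∈ invariants G := by
    rw [← hp, Algebra.adjoin_range_eq_range_aeval]; exact ⟨Q, rfl⟩
  have h4 : τ * (b ^ (N + 1) * aeval p Q) ∈
      ((liftIdeal P fun i => eval v (p i)) ^ (N + 1)).map
        (aeval p : MvPolynomial (Fin m) k →ₐ[k] _) := by
    rw [Ideal.map_pow, map_liftIdeal hP]
    exact Ideal.mul_mem_left _ _ (pow_mul_mem_pow hb2 _ _ hQ')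
  obtain ⟨M, hM, hM'⟩ := exists_mem_aeval_eq_groupTrace hp h4
  rw [← mul_assoc, groupTrace_mul hx] at hM'
  set c := groupTrace G (τ * b ^ (N + 1)) with hc
  have hc1 : c ∈ invariants G := groupTrace_mem _
  have hc2 : linSub E₂ c = c := h.groupTrace_linSub (by rw [map_mul, map_pow, h1, hb])
  obtain ⟨N₀, hN, hN'⟩ := sum_ite_const_ne_zero (G := G) E₂
  have hc3 : eval v c = N₀ := by
    apply C_injective (Fin n) k
    rw [← h.affSub_eq_C hv.fix hc2, hc, h.affSub_groupTrace hv.fix h1 h2 h3, map_pow, hb1,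
      one_pow]
    simp only [map_one]
    rw [hN' 1, mul_one]
  rw [← hp, Algebra.adjoin_range_eq_range_aeval] at hc1
  obtain ⟨Q₀, hQ₀⟩ := hc1
  change aeval p Q₀ = c at hQ₀
  have h5 := aeval_lift_sub_mem (v := v) (p := p) (P := P) Q₀
  rw [hQ₀, hc3] at h5
  have h6 : aeval P Q₀ * Q - M ∈ relIdeal p := by
    change aeval p _ = 0
    rw [map_sub, map_mul, aeval_aeval_lift hP, hQ₀, hc2, hM', sub_self]
  have h7 : Q = C N₀⁻¹ * ((aeval P Q₀ * Q - M) + (M - (aeval P Q₀ - C N₀) * Q)) := by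
    have h8 : (aeval P Q₀ * Q - M) + (M - (aeval P Q₀ - C N₀) * Q) = C N₀ * Q := by ring
    rw [h8, ← mul_assoc, ← C_mul, inv_mul_cancel₀ hN, C_1, one_mul]
  rw [h7]
  refine Ideal.mul_mem_left _ _ (Ideal.add_mem _ (Ideal.mem_sup_left h6)
    (Ideal.mem_sup_right (Ideal.sub_mem _ hM ?_)))
  rw [pow_succ']
  exact Ideal.mul_mem_mul h5 hQ

/-- The restrictions of the generators `p` to the affine subspace through `v` parallel to the
image of `E₁`. -/
def slice (E₁ : Matrix (Fin n) (Fin n) k) (v : Fin n → k) (p : Fin m → MvPolynomial (Fin n) k)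
    (i : Fin m) : MvPolynomial (Fin n) k := affSub E₁ v (p i) - C (eval v (p i))

theorem constantCoeff_affSub (M : Matrix (Fin n) (Fin n) k) (f : MvPolynomial (Fin n) k) :
    constantCoeff (affSub M v f) = eval v f := by
  have : (aeval (0 : Fin n → k)).comp (affSub M v) = aeval v := by
    ext1 i
    rw [AlgHom.comp_apply, affSub_X]
    simp
  have := DFunLike.congr_fun this f
  rwa [AlgHom.comp_apply, MvPolynomial.aeval_zero] at this

theorem constantCoeff_slice (i : Fin m) : constantCoeff (slice E₁ v p i) = 0 := by
  rw [slice, map_sub, constantCoeff_affSub, constantCoeff_C, sub_self]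

theorem aeval_slice_translate (Q : MvPolynomial (Fin m) k) :
    aeval (slice E₁ v p) (translate (fun i => eval v (p i)) Q) = affSub E₁ v (aeval p Q) := by
  have : (aeval (slice E₁ v p)).comp (translate fun i => eval v (p i)) =
      (affSub E₁ v).comp (aeval p) := by
    ext1 i
    rw [AlgHom.comp_apply, AlgHom.comp_apply, translate_X, map_add, aeval_X, aeval_X, slice,
      algHom_C, algebraMap_eq, sub_add_cancel]
  exact DFunLike.congr_fun this Q

theorem aeval_slice (R : MvPolynomial (Fin m) k) :
    aeval (slice E₁ v p) R =
      affSub E₁ v (aeval p (translate (-fun i => eval v (p i)) R)) := by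
  rw [← aeval_slice_translate, translate_translate_neg]

/-- The invariants which are polynomials on the image of `E`. -/
def imageInvariants (H : Subgroup (Matrix.GeneralLinearGroup (Fin n) k))
    (E : Matrix (Fin n) (Fin n) k) : Subalgebra k (MvPolynomial (Fin n) k) :=
  invariants H ⊓ (linSub E).range

theorem Splitting.mem_imageInvariants {H : Subgroup (Matrix.GeneralLinearGroup (Fin n) k)}
    {W : Subgroup (Matrix.GeneralLinearGroup (Fin n) k)}
    (h : Splitting W E₁ E₂) {f : MvPolynomial (Fin n) k} :
    f ∈ imageInvariants H E₁ ↔ f ∈ invariants H ∧ linSub E₁ f = f := by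
  rw [imageInvariants, Algebra.mem_inf]
  refine and_congr_right fun _ => ⟨?_, fun hf => ⟨f, hf⟩⟩
  rintro ⟨g, rfl⟩
  exact h.linSub_linSub_self g

theorem Splitting.adjoin_slice [CharZero k] [Finite ↥G] (h : Splitting G E₁ E₂)
    (hp : Algebra.adjoin k (Set.range p) = invariants G) (hv : GenericPoint G E₂ v) :
    Algebra.adjoin k (Set.range (slice E₁ v p)) = imageInvariants (G ⊓ fixSub E₂) E₁ := by
  classical
  have := Fintype.ofFinite ↥G
  apply le_antisymm
  · rw [Algebra.adjoin_range_eq_range_aeval]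
    rintro _ ⟨R, rfl⟩
    change aeval (slice E₁ v p) R ∈ _
    rw [aeval_slice, h.mem_imageInvariants]
    refine ⟨fun g hg => ?_, h.linSub_affSub_left v _⟩
    rw [← h.affSub_matAct hg.1 (mulVec_eq_of_mem_fixSub hg.2 hv.fix)]
    congr 1
    have : aeval p (translate (-fun i => eval v (p i)) R) ∈ invariants G := by
      rw [← hp, Algebra.adjoin_range_eq_range_aeval]; exact ⟨_, rfl⟩
    exact this g hg.1
  · intro f hf
    rw [h.mem_imageInvariants] at hf
    obtain ⟨hf1, hf2⟩ := hf
    obtain ⟨τ, h1, h2, h3⟩ := h.exists_separating hv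
    obtain ⟨N₀, hN, hN'⟩ := sum_ite_const_ne_zero (G := G) E₂
    have h4 : affSub E₁ v (groupTrace G (τ * f)) = C N₀ * f := by
      rw [h.affSub_groupTrace hv.fix h1 h2 h3, ← hN']
      refine Finset.sum_congr rfl fun g _ => ?_
      split_ifs with hg
      · rw [← hf2, h.affSub_linSub_left hv.fix, hf2, hf1 g ⟨g.2, hg⟩]
      · rfl
    have h5 : groupTrace G (τ * f) ∈ invariants G := groupTrace_mem _
    rw [← hp, Algebra.adjoin_range_eq_range_aeval] at h5
    obtain ⟨Q, hQ⟩ := h5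
    change aeval p Q = _ at hQ
    rw [Algebra.adjoin_range_eq_range_aeval]
    refine ⟨C N₀⁻¹ * translate (fun i => eval v (p i)) Q, ?_⟩
    change aeval (slice E₁ v p) _ = _
    rw [map_mul, aeval_slice_translate, hQ, h4, algHom_C, algebraMap_eq, ← mul_assoc, ← C_mul,
      inv_mul_cancel₀ hN, C_1, one_mul]

end Slices

section Slices

variable {k : Type} [Field k] {n m : ℕ}
variable {G : Subgroup (Matrix.GeneralLinearGroup (Fin n) k)} {E₁ E₂ : Matrix (Fin n) (Fin n) k}
  {v : Fin n → k} {p : Fin m → MvPolynomial (Fin n) k} {P : Fin m → MvPolynomial (Fin m) k}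

theorem liftIdeal_le {a : Fin m → k} {J : Ideal (MvPolynomial (Fin m) k)}
    (h : ∀ i, translate a (P i) - C (a i) ∈ J) :
    (liftIdeal P a).map (translate a) ≤ J := by
  rw [liftIdeal, Ideal.map_span, Ideal.span_le]
  rintro _ ⟨_, ⟨i, rfl⟩, rfl⟩
  rw [map_sub, algHom_C]
  exact h i

theorem Splitting.ker_slice [CharZero k] [Finite ↥G] (h : Splitting G E₁ E₂)
    (hp : Algebra.adjoin k (Set.range p) = invariants G) (hv : GenericPoint G E₂ v)
    (hP : ∀ i, aeval p (P i) = linSub E₂ (p i)) {s : ℕ} {f : Fin s → MvPolynomial (Fin m) k}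
    (hf : Ideal.span (Set.range f) = relIdeal p) :
    RingHom.ker (aeval (slice E₁ v p) : MvPolynomial (Fin m) k →ₐ[k] _) =
      Ideal.span (Set.range (Sum.elim (fun i => translate (fun i => eval v (p i)) (f i))
        (fun i => translate (fun i => eval v (p i)) (P i) - C (eval v (p i))))) := by
  apply le_antisymm
  · intro R hR
    set a : Fin m → k := fun i => eval v (p i) with ha
    rw [RingHom.mem_ker, aeval_slice] at hR
    have h1 := h.mem_sliceIdeal hR
    have h2 := h.mem_sup_of_mem_pow hp hv hP 0 (Q := translate (-a) R)
      (by rw [pow_zero, Ideal.one_eq_top]; trivial) (by rw [zero_add, pow_one]; exact h1)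
    have h3 := Ideal.mem_map_of_mem (translate a) h2
    rw [translate_translate_neg, zero_add, pow_one, Ideal.map_sup, ← hf, Ideal.map_span] at h3
    refine (sup_le ?_ ?_ : _ ⊔ _ ≤ Ideal.span _) h3
    · rw [Ideal.span_le]
      rintro _ ⟨_, ⟨i, rfl⟩, rfl⟩
      exact Ideal.subset_span ⟨Sum.inl i, rfl⟩
    · exact liftIdeal_le fun i => Ideal.subset_span ⟨Sum.inr i, rfl⟩
  · rw [Ideal.span_le]
    rintro _ ⟨i | i, rfl⟩
    · change aeval (slice E₁ v p) _ = 0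
      rw [Sum.elim_inl, aeval_slice_translate]
      have : f i ∈ relIdeal p := by rw [← hf]; exact Ideal.subset_span ⟨i, rfl⟩
      rw [show aeval p (f i) = 0 from this, map_zero]
    · change aeval (slice E₁ v p) _ = 0
      rw [Sum.elim_inr, map_sub, aeval_slice_translate, hP, h.affSub_linSub_right hv.fix,
        algHom_C, algebraMap_eq, sub_self]

/-- Taylor expansion along the image of `E₂`. -/
theorem Splitting.linSub_sub_mem (h : Splitting G E₁ E₂) (hv : E₂.mulVec v = v)
    (f : MvPolynomial (Fin n) k) :
    linSub E₂ f - C (eval v f) ∈ Submodule.span k (Set.range fun i => linSub E₂ (X i) - C (v i)) ⊔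
      (sliceIdeal E₂ v ^ 2).restrictScalars k := by
  set N := Submodule.span k (Set.range fun i => linSub E₂ (X i) - C (v i)) ⊔
      (sliceIdeal E₂ v ^ 2).restrictScalars k with hN
  induction f using MvPolynomial.induction_on with
  | C a =>
    rw [algHom_C, algebraMap_eq, eval_C, sub_self]; exact zero_mem _
  | add f g hf hg =>
    rw [map_add, map_add, C_add, add_sub_add_comm]; exact add_mem hf hg
  | mul_X f i hf =>
    have hy : linSub E₂ (X i) - C (v i) ∈ N :=
      Submodule.mem_sup_left (Submodule.subset_span ⟨i, rfl⟩)
    have hy' : linSub E₂ (X i) - C (v i) ∈ sliceIdeal E₂ v := Ideal.subset_span ⟨i, rfl⟩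
    have hf' : linSub E₂ f - C (eval v f) ∈ sliceIdeal E₂ v :=
      h.mem_sliceIdeal_of_eval hv (by rw [map_sub, h.symm.linSub_linSub_self, algHom_C]; rfl)
        (by rw [map_sub, eval_linSub, hv, eval_C, sub_self])
    have h1 : linSub E₂ (f * X i) - C (eval v (f * X i)) =
        (linSub E₂ f - C (eval v f)) * (linSub E₂ (X i) - C (v i)) +
        (v i • (linSub E₂ f - C (eval v f)) + eval v f • (linSub E₂ (X i) - C (v i))) := by
      rw [map_mul, map_mul, eval_X, C_mul, smul_eq_C_mul, smul_eq_C_mul]; ring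
    rw [h1]
    refine add_mem (Submodule.mem_sup_right ?_)
      (add_mem (N.smul_mem _ hf) (N.smul_mem _ hy))
    rw [sq]
    exact Ideal.mul_mem_mul hf' hy'

theorem finrank_span_le (hv : E₂.mulVec v = v) :
    Module.finrank k (Submodule.span k (Set.range fun i => linSub E₂ (X i) - C (v i))) ≤
      E₂.rank := by
  set T : (Fin n → k) →ₗ[k] MvPolynomial (Fin n) k :=
    Fintype.linearCombination k fun j => X j - C (v j) with hT
  have h1 : Submodule.span k (Set.range fun i => linSub E₂ (X i) - C (v i)) ≤
      (LinearMap.range E₂.transpose.mulVecLin).map T := by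
    rw [Submodule.span_le]
    rintro _ ⟨i, rfl⟩
    refine ⟨E₂.transpose.mulVecLin (Pi.single i 1), ⟨_, rfl⟩, ?_⟩
    rw [Matrix.mulVecLin_apply, Matrix.mulVec_single_one, hT, Fintype.linearCombination_apply]
    have h2 : v i = ∑ j, E₂ i j * v j := (congrFun hv i).symm
    change _ = linSub E₂ (X i) - C (v i)
    conv_rhs => rw [h2]
    simp only [Matrix.col_apply, Matrix.transpose_apply, smul_sub, Finset.sum_sub_distrib,
      linSub_X, map_sum, C_mul, smul_eq_C_mul]
  calc _ ≤ Module.finrank k ((LinearMap.range E₂.transpose.mulVecLin).map T) :=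
        Submodule.finrank_mono h1
    _ ≤ Module.finrank k (LinearMap.range E₂.transpose.mulVecLin) :=
        Submodule.finrank_map_le _ _
    _ = E₂.rank := by rw [← Matrix.rank_transpose E₂]; rfl

theorem Splitting.finrank_conormal_slice_le [CharZero k] [Finite ↥G] (h : Splitting G E₁ E₂)
    (hp : Algebra.adjoin k (Set.range p) = invariants G) (hv : GenericPoint G E₂ v)
    (hP : ∀ i, aeval p (P i) = linSub E₂ (p i)) {s : ℕ} {f : Fin s → MvPolynomial (Fin m) k}
    (hf : Ideal.span (Set.range f) = relIdeal p) :
    Module.finrank k (Conormal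
      (RingHom.ker (aeval (slice E₁ v p) : MvPolynomial (Fin m) k →ₐ[k] _))) ≤ s + E₂.rank := by
  have hker := h.ker_slice hp hv hP hf
  set I := RingHom.ker (aeval (slice E₁ v p) : MvPolynomial (Fin m) k →ₐ[k] _) with hI
  set a : Fin m → k := fun i => eval v (p i) with ha
  set l : Fin m → MvPolynomial (Fin m) k := fun i => translate a (P i) - C (a i) with hl
  set F : Fin s → MvPolynomial (Fin m) k := fun i => translate a (f i) with hF
  have hFI : ∀ i, F i ∈ I := fun i => by rw [hker]; exact Ideal.subset_span ⟨Sum.inl i, rfl⟩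
  have hlI : ∀ i, l i ∈ I := fun i => by rw [hker]; exact Ideal.subset_span ⟨Sum.inr i, rfl⟩
  have hI0 : I ≤ idealOfVars (Fin m) k :=
    ker_aeval_le (aeval (0 : Fin n → k)) fun i => by
      rw [MvPolynomial.aeval_zero, constantCoeff_slice, map_zero]
  let q := Submodule.mkQ ((sliceIdeal E₂ v ^ 2).restrictScalars k)
  let y : Fin m → MvPolynomial (Fin n) k := fun i => linSub E₂ (p i) - C (a i)
  have hr : Module.finrank k (Submodule.span k (Set.range (q ∘ y))) ≤ E₂.rank := by
    have h1 : Submodule.span k (Set.range (q ∘ y)) ≤ (Submodule.span k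
        (Set.range fun i => linSub E₂ (X i) - C (v i))).map q := by
      rw [Submodule.span_le]
      rintro _ ⟨i, rfl⟩
      obtain ⟨y₁, hy₁, y₂, hy₂, h12⟩ := Submodule.mem_sup.1 (h.linSub_sub_mem hv.fix (p i))
      refine ⟨y₁, hy₁, ?_⟩
      have : q y₂ = 0 := (Submodule.Quotient.mk_eq_zero _).2 hy₂
      change q y₁ = q (linSub E₂ (p i) - C (eval v (p i)))
      rw [← h12, map_add, this, add_zero]
    have : FiniteDimensional k (Submodule.span k
        (Set.range fun i => linSub E₂ (X i) - C (v i))) :=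
      FiniteDimensional.span_of_finite k (Set.finite_range _)
    exact (Submodule.finrank_mono h1).trans
      ((Submodule.finrank_map_le _ _).trans (finrank_span_le hv.fix))
  have := FiniteDimensional.span_of_finite k (Set.finite_range (q ∘ y))
  obtain ⟨g, hg, hg', -⟩ := Submodule.exists_fun_fin_finrank_span_eq k (Set.range (q ∘ y))
  choose t ht using hg
  have hgen : I ≤ Ideal.span (Set.range (Sum.elim F (l ∘ t))) ⊔ idealOfVars (Fin m) k * I := by
    conv_lhs => rw [hker]
    rw [Ideal.span_le]
    rintro _ ⟨i | i, rfl⟩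
    · exact Ideal.mem_sup_left (Ideal.subset_span ⟨Sum.inl i, rfl⟩)
    · rw [Sum.elim_inr]
      have h1 : q (y i) ∈ Submodule.span k (Set.range g) := by
        rw [hg']; exact Submodule.subset_span ⟨i, rfl⟩
      obtain ⟨b, hb⟩ := (Submodule.mem_span_range_iff_exists_fun k).1 h1
      set Q := (P i - C (a i)) - ∑ j, b j • (P (t j) - C (a (t j))) with hQ
      have hQ1 : Q ∈ liftIdeal P a := by
        refine Ideal.sub_mem _ (Ideal.subset_span ⟨i, rfl⟩) (Ideal.sum_mem _ fun j _ => ?_)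
        rw [smul_eq_C_mul]
        exact Ideal.mul_mem_left _ _ (Ideal.subset_span ⟨t j, rfl⟩)
      have hpy : ∀ j, aeval p (P j - C (a j)) = y j := fun j => by
        rw [map_sub, hP, algHom_C]; rfl
      have hQ2 : aeval p Q ∈ sliceIdeal E₂ v ^ 2 := by
        have : q (aeval p Q) = 0 := by
          rw [hQ, map_sub, map_sum, map_sub, map_sum, sub_eq_zero, hpy, ← hb]
          refine Finset.sum_congr rfl fun j _ => ?_
          rw [map_smul, map_smul, hpy, ← ht]; rfl
        exact (Submodule.Quotient.mk_eq_zero _).1 this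
      have hQ3 := h.mem_sup_of_mem_pow hp hv hP 1 (by rw [pow_one]; exact hQ1) hQ2
      have hQ4 := Ideal.mem_map_of_mem (translate a) hQ3
      have hQ5 : translate a Q = l i - ∑ j, b j • l (t j) := by
        rw [hQ, map_sub, map_sum, map_sub, algHom_C]
        simp only [map_smul, map_sub, algHom_C]; rfl
      rw [Ideal.map_sup, ← hf, Ideal.map_span, Ideal.map_pow, hQ5] at hQ4
      have hQ6 : l i - ∑ j, b j • l (t j) ∈
          Ideal.span (Set.range (Sum.elim F (l ∘ t))) ⊔ idealOfVars (Fin m) k * I := by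
        refine (sup_le ?_ ?_ : _ ⊔ _ ≤
          Ideal.span (Set.range (Sum.elim F (l ∘ t))) ⊔ idealOfVars (Fin m) k * I) hQ4
        · rw [Ideal.span_le]
          rintro _ ⟨_, ⟨j, rfl⟩, rfl⟩
          exact Ideal.mem_sup_left (Ideal.subset_span ⟨Sum.inl j, rfl⟩)
        · refine le_trans ?_ le_sup_right
          rw [sq]
          exact Ideal.mul_mono (liftIdeal_le fun j => hI0 (hlI j)) (liftIdeal_le fun j => hlI j)
      have := Ideal.add_mem _ hQ6 (Ideal.sum_mem (Ideal.span (Set.range (Sum.elim F (l ∘ t))) ⊔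
        idealOfVars (Fin m) k * I) (fun j _ => ?_) : ∑ j, b j • l (t j) ∈ _)
      · rwa [sub_add_cancel] at this
      · rw [smul_eq_C_mul]
        exact Ideal.mul_mem_left _ _ (Ideal.mem_sup_left (Ideal.subset_span ⟨Sum.inr j, rfl⟩))
  have h5 := finrank_conormal_le (Sum.elim F (l ∘ t))
    (by rintro (i | i); exacts [hFI i, hlI _]) hgen
  rw [Fintype.card_sum, Fintype.card_fin, Fintype.card_fin] at h5
  omega

end Slices

section GoodFamilies

variable {k : Type} [Field k] {n m : ℕ}

/-- A finite presentation with at least `N` more generators than relations, up to linear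
eliminations, on whose conormal space the elements of `Γ` act trivially. -/
structure GoodFamily (N : ℕ) (Γ : Set (Matrix.GeneralLinearGroup (Fin n) k)) {σ : Type}
    [Fintype σ] (u : σ → MvPolynomial (Fin n) k) : Prop where
  zero : ∀ i, constantCoeff (u i) = 0
  finrank_le : Module.finrank k (Conormal
    (RingHom.ker (aeval u : MvPolynomial σ k →ₐ[k] _))) + N ≤ Fintype.card σ
  acts : ∀ w ∈ Γ, TriviallyActs u (matAct w)

theorem nonempty_lifts_of_constantCoeff {σ τ : Type} {u : σ → MvPolynomial (Fin n) k}
    {u' : τ → MvPolynomial (Fin n) k} (h : ∀ i, constantCoeff (u i) = 0)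
    (h' : ∀ i, constantCoeff (u' i) = 0)
    (hadj : Algebra.adjoin k (Set.range u) = Algebra.adjoin k (Set.range u')) :
    Nonempty (Lifts (K := k) (aeval u) (aeval u')) :=
  nonempty_lifts (aeval (0 : Fin n → k))
    (fun i => by rw [MvPolynomial.aeval_zero, h, map_zero])
    (fun i => by rw [MvPolynomial.aeval_zero, h', map_zero]) hadj

theorem ker_aeval_le_of_constantCoeff {σ : Type} {u : σ → MvPolynomial (Fin n) k}
    (h : ∀ i, constantCoeff (u i) = 0) :
    RingHom.ker (aeval u : MvPolynomial σ k →ₐ[k] MvPolynomial (Fin n) k) ≤ idealOfVars σ k :=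
  ker_aeval_le (aeval (0 : Fin n → k)) fun i => by rw [MvPolynomial.aeval_zero, h, map_zero]

theorem GoodFamily.of_adjoin_eq {N : ℕ} {Γ : Set (Matrix.GeneralLinearGroup (Fin n) k)}
    {σ τ : Type} [Fintype σ] [Fintype τ] {u : σ → MvPolynomial (Fin n) k}
    {u' : τ → MvPolynomial (Fin n) k} (h : GoodFamily N Γ u)
    (h' : ∀ i, constantCoeff (u' i) = 0)
    (hadj : Algebra.adjoin k (Set.range u) = Algebra.adjoin k (Set.range u')) :
    GoodFamily N Γ u' := by
  obtain ⟨L⟩ := nonempty_lifts_of_constantCoeff h.zero h' hadj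
  refine ⟨h', ?_, fun w hw => L.triviallyActs (h.acts w hw)⟩
  have h1 := L.finrank_add_card_le (ker_aeval_le_of_constantCoeff h.zero)
    (ker_aeval_le_of_constantCoeff h')
  have h2 := h.finrank_le
  omega

theorem GoodFamily.closure {N : ℕ} {Γ : Set (Matrix.GeneralLinearGroup (Fin n) k)}
    {σ : Type} [Fintype σ] {u : σ → MvPolynomial (Fin n) k} (h : GoodFamily N Γ u)
    (hΓ : (Subgroup.closure Γ : Set (Matrix.GeneralLinearGroup (Fin n) k)).Finite) :
    GoodFamily N (Subgroup.closure Γ) u := by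
  refine ⟨h.zero, h.finrank_le, fun w hw => ?_⟩
  have : Finite ↥(Subgroup.closure Γ) := hΓ
  have hmul : ∀ x y, TriviallyActs u (matAct x) → TriviallyActs u (matAct y) →
      TriviallyActs u (matAct (x * y)) := fun x y hx hy => by
    rw [matAct_mul]; exact hx.comp hy
  have hone : TriviallyActs u (matAct (1 : Matrix.GeneralLinearGroup (Fin n) k)) := by
    rw [matAct_one]; exact triviallyActs_id u
  have hpow : ∀ x (j : ℕ), TriviallyActs u (matAct x) → TriviallyActs u (matAct (x ^ j)) := by
    intro x j hx
    induction j with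
    | zero => rw [pow_zero]; exact hone
    | succ j ih => rw [pow_succ]; exact hmul _ _ ih hx
  refine Subgroup.closure_induction (p := fun x _ => TriviallyActs u (matAct x))
    (fun x hx => h.acts x hx) hone (fun x y _ _ hx hy => hmul x y hx hy) (fun x hx ih => ?_) hw
  have h1 : IsOfFinOrder (⟨x, hx⟩ : ↥(Subgroup.closure Γ)) := isOfFinOrder_of_finite _
  have h2 : IsOfFinOrder x := by
    rwa [← Submonoid.isOfFinOrder_coe] at h1
  obtain ⟨j, hj0, hj⟩ := isOfFinOrder_iff_pow_eq_one.1 h2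
  rw [← one_mul x⁻¹, ← hj, ← pow_sub_one_mul hj0.ne', mul_inv_cancel_right]
  exact hpow x _ ih

theorem GoodFamily.mono {N : ℕ} {Γ Γ' : Set (Matrix.GeneralLinearGroup (Fin n) k)}
    {σ : Type} [Fintype σ] {u : σ → MvPolynomial (Fin n) k} (h : GoodFamily N Γ u)
    (hΓ : Γ' ⊆ Γ) : GoodFamily N Γ' u := ⟨h.zero, h.finrank_le, fun w hw => h.acts w (hΓ hw)⟩

variable {Wt G : Subgroup (Matrix.GeneralLinearGroup (Fin n) k)}
    {p : Fin m → MvPolynomial (Fin n) k} {d : Fin m → ℕ} {c : ↥Wt → Fin m → Fin m → k}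
    {E₁ E₂ : Matrix (Fin n) (Fin n) k} {v : Fin n → k}

/-- The invariants on the image of `E₂` have lifts fixed by the stabilizer of this image. -/
theorem GoodSetup.exists_fixed_lifts [CharZero k] (h : GoodSetup Wt G p d c)
    (hE : Splitting Wt E₁ E₂) : ∃ P : Fin m → MvPolynomial (Fin m) k,
      (∀ i, aeval p (P i) = linSub E₂ (p i)) ∧
      ∀ w : ↥Wt, (w : Matrix.GeneralLinearGroup (Fin n) k) ∈ fixSub E₂ →
        ∀ i, polyAct (c w) (P i) = P i := by
  have : Finite ↥Wt := h.finite
  have := Fintype.ofFinite ↥((fixSub E₂).subgroupOf Wt)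
  have h1 : ∀ i, ∃ Q, aeval p Q = linSub E₂ (p i) := fun i => by
    have : linSub E₂ (p i) ∈ invariants G := fun g hg => by
      have : p i ∈ invariants G := by rw [← h.gen]; exact Algebra.subset_adjoin ⟨i, rfl⟩
      rw [hE.symm.matAct_linSub (h.le hg), this g hg]
    rwa [← h.gen, Algebra.adjoin_range_eq_range_aeval] at this
  choose Q hQ using h1
  let ρ := (actionHom (groupAct Wt) p h.linearIndependent c h.equivar).comp
    ((fixSub E₂).subgroupOf Wt).subtype
  let ρ' := (groupAct Wt).comp ((fixSub E₂).subgroupOf Wt).subtype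
  refine ⟨fun i => avg ρ (Q i), fun i => ?_, fun w hw i => map_avg ρ ⟨w, hw⟩ (Q i)⟩
  rw [map_avg_of_comm ρ ρ' (aeval p) (fun g f => aeval_polyAct (h.equivar g) f), hQ]
  exact avg_eq_self ρ' fun g => hE.symm.matAct_eq_self (w := ((g : ↥Wt) : _)) g.1.2 g.2
    (hE.symm.linSub_linSub_self _)

theorem polyAct_translate {M : Fin m → Fin m → k} {a : Fin m → k}
    (h : ∀ i, ∑ j, M i j * a j = a i) (f : MvPolynomial (Fin m) k) :
    polyAct M (translate a f) = translate a (polyAct M f) := by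
  have : (polyAct M).comp (translate a) = (translate a).comp (polyAct M) := by
    ext1 i
    rw [AlgHom.comp_apply, AlgHom.comp_apply, translate_X, polyAct_X, map_add, polyAct_X,
      algHom_C, algebraMap_eq, map_sum, ← h i, map_sum, ← Finset.sum_add_distrib]
    refine Finset.sum_congr rfl fun j _ => ?_
    rw [map_smul, translate_X, smul_add, smul_eq_C_mul (C _), C_mul]
  exact DFunLike.congr_fun this f

/-- Slices of good presentations are good. -/
theorem GoodSetup.goodFamily_slice [CharZero k] (h : GoodSetup Wt G p d c)
    (hE : Splitting Wt E₁ E₂) (hv : GenericPoint G E₂ v) :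
    GoodFamily E₁.rank (Wt ⊓ fixSub E₂ : Subgroup _) (slice E₁ v p) := by
  have : Finite ↥Wt := h.finite
  have : Finite ↥G := h.finite.subset h.le
  obtain ⟨P, hP, hP'⟩ := h.exists_fixed_lifts hE
  obtain ⟨s, f, -, hs, -, hfix, -, hf⟩ := h.exists_invariant_generators
  have hEG := hE.mono h.le
  refine ⟨fun i => constantCoeff_slice .., ?_, fun w hw => ?_⟩
  · have h1 := hEG.finrank_conormal_slice_le h.gen hv hP hf
    have h2 := hE.rank
    rw [Fintype.card_fin]
    omega
  · obtain ⟨w, rfl⟩ : ∃ w' : ↥Wt, (w' : Matrix.GeneralLinearGroup (Fin n) k) = w :=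
      ⟨⟨w, hw.1⟩, rfl⟩
    have hwv := mulVec_eq_of_mem_fixSub hw.2 hv.fix
    have hinv : Matrix.mulVec (↑((w : Matrix.GeneralLinearGroup (Fin n) k)⁻¹) :
        Matrix (Fin n) (Fin n) k) v = v :=
      mulVec_eq_of_mem_fixSub (inv_mem hw.2) hv.fix
    have ha : ∀ i, ∑ j, c w i j * eval v (p j) = eval v (p i) := fun i => by
      have h1 := congrArg (eval v) (h.equivar w i)
      rw [eval_matAct, hinv, map_sum] at h1
      simpa using h1.symm
    have hφ := augmented_polyAct (c w)
    have hlift : ∀ f, aeval (slice E₁ v p) (polyAct (c w) f) =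
        matAct (w : Matrix.GeneralLinearGroup (Fin n) k) (aeval (slice E₁ v p) f) := by
      refine fun f => aeval_polyAct (fun i => ?_) f
      rw [slice, map_sub, ← hE.affSub_matAct hw.1 hwv, h.equivar, map_sum, algHom_C,
        algebraMap_eq, ← ha i, map_sum, ← Finset.sum_sub_distrib]
      refine Finset.sum_congr rfl fun j _ => ?_
      rw [map_smul, slice, smul_sub, smul_eq_C_mul (C _), C_mul]
    refine ⟨polyAct (c w), hφ, hlift, fun g hg _ => ?_⟩
    rw [hEG.ker_slice h.gen hv hP hf] at hg ⊢
    refine hφ.sub_mem_mul ?_ hg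
    rintro _ ⟨i | i, rfl⟩
    · rw [Sum.elim_inl, polyAct_translate ha, hfix]
    · rw [Sum.elim_inr, map_sub, polyAct_translate ha, hP' w hw.2, algHom_C, algebraMap_eq]

/-- The polynomial ring itself as a presentation of the invariants of the trivial group. -/
theorem goodSetup_bot : GoodSetup (n := n) (k := k) ⊥ ⊥ X (fun _ => 1)
    (fun _ i j => if i = j then 1 else 0) := by
  have hker : relIdeal (X : Fin n → MvPolynomial (Fin n) k) = ⊥ := by
    rw [relIdeal, aeval_X_left]
    exact (RingHom.injective_iff_ker_eq_bot _).1 Function.injective_id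
  refine ⟨Set.finite_singleton 1, le_rfl, fun i => isHomogeneous_X k i, fun _ => one_pos, ?_,
    ?_, ?_, ?_, ?_⟩
  · rw [adjoin_range_X, eq_comm, eq_top_iff]
    rintro f - g hg
    rw [Subgroup.mem_bot.1 hg, matAct_one]; rfl
  · rw [hker]; exact bot_le
  · rintro ⟨w, hw⟩ i
    rw [Subgroup.mem_bot] at hw
    subst hw
    rw [matAct_one]
    simp
  · have := finrank_conormal_le (I := relIdeal (X : Fin n → MvPolynomial (Fin n) k))
      (fun i : Fin 0 => i.elim0) (fun i => i.elim0) (by rw [hker]; exact bot_le)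
    rw [Fintype.card_fin] at this
    omega
  · intro w f hf
    rw [hker, Ideal.mem_bot] at hf
    rw [hf, map_zero, sub_zero]; exact zero_mem _

end GoodFamilies

section SumPresentation

open TensorProduct

variable {K : Type} [Field K] {σ τ : Type}

theorem ker_tensorMap_le {A₁ A₂ B₁ B₂ : Type} [CommRing A₁] [CommRing A₂] [CommRing B₁]
    [CommRing B₂] [Algebra K A₁] [Algebra K A₂] [Algebra K B₁] [Algebra K B₂]
    (f : A₁ →ₐ[K] B₁) (g : A₂ →ₐ[K] B₂) :
    RingHom.ker (Algebra.TensorProduct.map f g) ≤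
      Ideal.map (Algebra.TensorProduct.includeLeft : A₁ →ₐ[K] A₁ ⊗[K] A₂) (RingHom.ker f) ⊔
        Ideal.map (Algebra.TensorProduct.includeRight : A₂ →ₐ[K] A₁ ⊗[K] A₂)
          (RingHom.ker g) := by
  intro z hz
  have h1 : Algebra.TensorProduct.map f g = (Algebra.TensorProduct.map f.range.val
      g.range.val).comp (Algebra.TensorProduct.map f.rangeRestrict g.rangeRestrict) := by
    rw [← Algebra.TensorProduct.map_comp]; rfl
  have h2 : Function.Injective (Algebra.TensorProduct.map f.range.val g.range.val) :=
    TensorProduct.map_injective_of_flat_flat f.range.val.toLinearMap g.range.val.toLinearMap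
      Subtype.val_injective Subtype.val_injective
  have h3 : z ∈ RingHom.ker (Algebra.TensorProduct.map f.rangeRestrict g.rangeRestrict) := by
    rw [RingHom.mem_ker, h1, AlgHom.comp_apply] at hz
    exact h2 (by rw [hz, map_zero])
  rw [Algebra.TensorProduct.map_ker _ _ f.rangeRestrict_surjective
    g.rangeRestrict_surjective] at h3
  have hf : RingHom.ker f.rangeRestrict = RingHom.ker f := by
    ext x; simp [RingHom.mem_ker, Subtype.ext_iff]
  have hg : RingHom.ker g.rangeRestrict = RingHom.ker g := by
    ext x; simp [RingHom.mem_ker, Subtype.ext_iff]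
  rwa [hf, hg] at h3

theorem ker_aeval_sumElim_le {S : Type} [CommRing S] [Algebra K S] {u₁ : σ → S} {u₂ : τ → S}
    (Δ : S →ₐ[K] S ⊗[K] S) (h₁ : ∀ i, Δ (u₁ i) = u₁ i ⊗ₜ 1) (h₂ : ∀ i, Δ (u₂ i) = 1 ⊗ₜ u₂ i) :
    RingHom.ker (aeval (Sum.elim u₁ u₂) : MvPolynomial (σ ⊕ τ) K →ₐ[K] S) ≤
      (RingHom.ker (aeval u₁ : MvPolynomial σ K →ₐ[K] S)).map
          (rename Sum.inl : MvPolynomial σ K →ₐ[K] MvPolynomial (σ ⊕ τ) K) ⊔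
        (RingHom.ker (aeval u₂ : MvPolynomial τ K →ₐ[K] S)).map
          (rename Sum.inr : MvPolynomial τ K →ₐ[K] MvPolynomial (σ ⊕ τ) K) := by
  intro F hF
  let T := Algebra.TensorProduct.productMap
    (rename Sum.inl : MvPolynomial σ K →ₐ[K] MvPolynomial (σ ⊕ τ) K)
    (rename Sum.inr : MvPolynomial τ K →ₐ[K] MvPolynomial (σ ⊕ τ) K)
  have hT : Function.Surjective T := by
    rw [← AlgHom.range_eq_top, eq_top_iff, ← adjoin_range_X, Algebra.adjoin_le_iff]
    rintro _ ⟨i | i, rfl⟩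
    · exact ⟨X i ⊗ₜ 1, by
        rw [AlgHom.toRingHom_eq_coe, RingHom.coe_coe,
          Algebra.TensorProduct.productMap_apply_tmul, map_one, mul_one, rename_X]⟩
    · exact ⟨1 ⊗ₜ X i, by
        rw [AlgHom.toRingHom_eq_coe, RingHom.coe_coe,
          Algebra.TensorProduct.productMap_apply_tmul, map_one, one_mul, rename_X]⟩
  obtain ⟨z, rfl⟩ := hT F
  have e1 : ∀ a : MvPolynomial σ K, Δ (aeval u₁ a) = aeval u₁ a ⊗ₜ 1 := fun a => by
    have : Δ.comp (aeval u₁) = Algebra.TensorProduct.includeLeft.comp (aeval u₁) := by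
      ext1 i
      rw [AlgHom.comp_apply, AlgHom.comp_apply, aeval_X, h₁]; rfl
    exact DFunLike.congr_fun this a
  have e2 : ∀ a : MvPolynomial τ K, Δ (aeval u₂ a) = 1 ⊗ₜ aeval u₂ a := fun a => by
    have : Δ.comp (aeval u₂) = Algebra.TensorProduct.includeRight.comp (aeval u₂) := by
      ext1 i
      rw [AlgHom.comp_apply, AlgHom.comp_apply, aeval_X, h₂]; rfl
    exact DFunLike.congr_fun this a
  have hcomp : (Δ.comp (aeval (Sum.elim u₁ u₂))).comp T =
      Algebra.TensorProduct.map (aeval u₁) (aeval u₂) := by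
    refine Algebra.TensorProduct.ext' fun a b => ?_
    rw [AlgHom.comp_apply, AlgHom.comp_apply, Algebra.TensorProduct.productMap_apply_tmul,
      map_mul, map_mul, aeval_rename, aeval_rename, Sum.elim_comp_inl, Sum.elim_comp_inr, e1, e2,
      Algebra.TensorProduct.tmul_mul_tmul, one_mul, mul_one, Algebra.TensorProduct.map_tmul]
  have hz : z ∈ RingHom.ker (Algebra.TensorProduct.map
      (aeval u₁ : MvPolynomial σ K →ₐ[K] S) (aeval u₂ : MvPolynomial τ K →ₐ[K] S)) := by
    rw [RingHom.mem_ker] at hF ⊢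
    rw [← hcomp, AlgHom.comp_apply, AlgHom.comp_apply, hF, map_zero]
  have h3 := Ideal.mem_map_of_mem T (ker_tensorMap_le _ _ hz)
  rw [Ideal.map_sup] at h3
  refine (sup_le_sup ?_ ?_ : _ ⊔ _ ≤
    (RingHom.ker (aeval u₁ : MvPolynomial σ K →ₐ[K] S)).map
          (rename Sum.inl : MvPolynomial σ K →ₐ[K] MvPolynomial (σ ⊕ τ) K) ⊔
        (RingHom.ker (aeval u₂ : MvPolynomial τ K →ₐ[K] S)).map
          (rename Sum.inr : MvPolynomial τ K →ₐ[K] MvPolynomial (σ ⊕ τ) K)) h3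
  · rw [Ideal.map_le_iff_le_comap, Ideal.map_le_iff_le_comap]
    intro a ha
    change T (a ⊗ₜ 1) ∈ Ideal.map _ _
    rw [Algebra.TensorProduct.productMap_apply_tmul, map_one, mul_one]
    exact Ideal.mem_map_of_mem _ ha
  · rw [Ideal.map_le_iff_le_comap, Ideal.map_le_iff_le_comap]
    intro a ha
    change T (1 ⊗ₜ a) ∈ Ideal.map _ _
    rw [Algebra.TensorProduct.productMap_apply_tmul, map_one, one_mul]
    exact Ideal.mem_map_of_mem _ ha

theorem exists_sub_mem_of_mem_map {φ : MvPolynomial σ K →ₐ[K] MvPolynomial τ K}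
    {I : Ideal (MvPolynomial σ K)} {J : Ideal (MvPolynomial τ K)} (hIJ : ∀ f ∈ I, φ f ∈ J)
    {f : MvPolynomial τ K} (hf : f ∈ I.map φ) :
    ∃ g ∈ I, f - φ g ∈ idealOfVars τ K * J := by
  refine Submodule.span_induction
    (p := fun f _ => ∃ g ∈ I, f - φ g ∈ idealOfVars τ K * J) ?_ ?_ ?_ ?_ hf
  · rintro _ ⟨g, hg, rfl⟩
    exact ⟨g, hg, by rw [sub_self]; exact zero_mem _⟩
  · exact ⟨0, zero_mem _, by rw [map_zero, sub_self]; exact zero_mem _⟩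
  · rintro x y - - ⟨g, hg, hx⟩ ⟨g', hg', hy⟩
    exact ⟨g + g', add_mem hg hg', by rw [map_add, add_sub_add_comm]; exact add_mem hx hy⟩
  · rintro a x - ⟨g, hg, hx⟩
    refine ⟨C (constantCoeff a) * g, Ideal.mul_mem_left _ _ hg, ?_⟩
    have : a • x - φ (C (constantCoeff a) * g) =
        a * (x - φ g) + (a - C (constantCoeff a)) * φ g := by
      rw [smul_eq_mul, map_mul, algHom_C, algebraMap_eq]; ring
    rw [this]
    refine add_mem (Ideal.mul_mem_left _ _ hx) (Ideal.mul_mem_mul ?_ (hIJ g hg))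
    rw [mem_idealOfVars_iff, map_sub, constantCoeff_C, sub_self]

/-- A diagonal homomorphism separating the variables of two families. -/
structure Separates {S : Type} [CommRing S] [Algebra K S] (Δ : S →ₐ[K] S ⊗[K] S)
    (u₁ : σ → S) (u₂ : τ → S) : Prop where
  left : ∀ i, Δ (u₁ i) = u₁ i ⊗ₜ 1
  right : ∀ i, Δ (u₂ i) = 1 ⊗ₜ u₂ i

variable {S : Type} [CommRing S] [Algebra K S] {u₁ : σ → S} {u₂ : τ → S}

theorem rename_inl_mem_ker {f : MvPolynomial σ K}
    (hf : f ∈ RingHom.ker (aeval u₁ : MvPolynomial σ K →ₐ[K] S)) :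
    rename Sum.inl f ∈
      RingHom.ker (aeval (Sum.elim u₁ u₂) : MvPolynomial (σ ⊕ τ) K →ₐ[K] S) := by
  rw [RingHom.mem_ker, aeval_rename, Sum.elim_comp_inl]; exact hf

theorem rename_inr_mem_ker {f : MvPolynomial τ K}
    (hf : f ∈ RingHom.ker (aeval u₂ : MvPolynomial τ K →ₐ[K] S)) :
    rename Sum.inr f ∈
      RingHom.ker (aeval (Sum.elim u₁ u₂) : MvPolynomial (σ ⊕ τ) K →ₐ[K] S) := by
  rw [RingHom.mem_ker, aeval_rename, Sum.elim_comp_inr]; exact hf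

theorem Separates.exists_sub_mem {Δ : S →ₐ[K] S ⊗[K] S} (h : Separates Δ u₁ u₂)
    {f : MvPolynomial (σ ⊕ τ) K}
    (hf : f ∈ RingHom.ker (aeval (Sum.elim u₁ u₂) : MvPolynomial (σ ⊕ τ) K →ₐ[K] S)) :
    ∃ f₁ ∈ RingHom.ker (aeval u₁ : MvPolynomial σ K →ₐ[K] S),
      ∃ f₂ ∈ RingHom.ker (aeval u₂ : MvPolynomial τ K →ₐ[K] S),
      f - (rename Sum.inl f₁ + rename Sum.inr f₂) ∈ idealOfVars (σ ⊕ τ) K *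
        RingHom.ker (aeval (Sum.elim u₁ u₂) : MvPolynomial (σ ⊕ τ) K →ₐ[K] S) := by
  obtain ⟨x, hx, y, hy, rfl⟩ := Submodule.mem_sup.1 (ker_aeval_sumElim_le Δ h.left h.right hf)
  obtain ⟨f₁, h1, hx⟩ := exists_sub_mem_of_mem_map (fun _ => rename_inl_mem_ker (u₂ := u₂)) hx
  obtain ⟨f₂, h2, hy⟩ := exists_sub_mem_of_mem_map (fun _ => rename_inr_mem_ker (u₁ := u₁)) hy
  refine ⟨f₁, h1, f₂, h2, ?_⟩
  rw [add_sub_add_comm]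
  exact add_mem hx hy

theorem augmented_rename (f : σ → τ) :
    Augmented (rename f : MvPolynomial σ K →ₐ[K] MvPolynomial τ K) := fun i => by
  rw [rename_X, constantCoeff_X]

theorem Separates.finrank_conormal_le [Finite σ] [Finite τ] {Δ : S →ₐ[K] S ⊗[K] S}
    (h : Separates Δ u₁ u₂) :
    Module.finrank K (Conormal
      (RingHom.ker (aeval (Sum.elim u₁ u₂) : MvPolynomial (σ ⊕ τ) K →ₐ[K] S))) ≤
    Module.finrank K (Conormal (RingHom.ker (aeval u₁ : MvPolynomial σ K →ₐ[K] S))) +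
      Module.finrank K (Conormal (RingHom.ker (aeval u₂ : MvPolynomial τ K →ₐ[K] S))) := by
  rw [← Module.finrank_prod]
  let ι₁ := conormalMap (rename Sum.inl : MvPolynomial σ K →ₐ[K] MvPolynomial (σ ⊕ τ) K)
    (augmented_rename _) (fun _ => rename_inl_mem_ker (u₁ := u₁) (u₂ := u₂))
  let ι₂ := conormalMap (rename Sum.inr : MvPolynomial τ K →ₐ[K] MvPolynomial (σ ⊕ τ) K)
    (augmented_rename _) (fun _ => rename_inr_mem_ker (u₁ := u₁) (u₂ := u₂))
  refine LinearMap.finrank_le_finrank_of_surjective (f := LinearMap.coprod ι₁ ι₂) fun x => ?_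
  obtain ⟨⟨f, hf⟩, rfl⟩ := conormalMk_surjective _ x
  obtain ⟨f₁, h1, f₂, h2, h12⟩ := h.exists_sub_mem hf
  refine ⟨(conormalMk _ ⟨f₁, h1⟩, conormalMk _ ⟨f₂, h2⟩), ?_⟩
  rw [LinearMap.coprod_apply, conormalMap_mk, conormalMap_mk, ← map_add, eq_comm, ← sub_eq_zero,
    ← map_sub, conormalMk_eq_zero]
  exact h12

/-- Extend an endomorphism to a sum of families by the identity. -/
def extendLeft (τ : Type) (φ : MvPolynomial σ K →ₐ[K] MvPolynomial σ K) :
    MvPolynomial (σ ⊕ τ) K →ₐ[K] MvPolynomial (σ ⊕ τ) K :=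
  aeval (Sum.elim (fun i => rename Sum.inl (φ (X i))) (fun j => X (Sum.inr j)))

theorem extendLeft_rename_inl (φ : MvPolynomial σ K →ₐ[K] MvPolynomial σ K)
    (f : MvPolynomial σ K) :
    extendLeft τ φ (rename Sum.inl f) = rename Sum.inl (φ f) := by
  have : (extendLeft τ φ).comp (rename Sum.inl) = (rename Sum.inl).comp φ := by
    ext1 i
    rw [AlgHom.comp_apply, AlgHom.comp_apply, rename_X, extendLeft, aeval_X, Sum.elim_inl]
  exact DFunLike.congr_fun this f

theorem extendLeft_rename_inr (φ : MvPolynomial σ K →ₐ[K] MvPolynomial σ K)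
    (f : MvPolynomial τ K) :
    extendLeft τ φ (rename Sum.inr f) = rename Sum.inr f := by
  have : (extendLeft τ φ).comp (rename Sum.inr) = rename Sum.inr := by
    ext1 i
    rw [AlgHom.comp_apply, rename_X, extendLeft, aeval_X, Sum.elim_inr]
  exact DFunLike.congr_fun this f

theorem Separates.triviallyActs {Δ : S →ₐ[K] S ⊗[K] S} (h : Separates Δ u₁ u₂)
    (h₂ : RingHom.ker (aeval u₂ : MvPolynomial τ K →ₐ[K] S) ≤ idealOfVars τ K)
    (h₁₂ : RingHom.ker (aeval (Sum.elim u₁ u₂) : MvPolynomial (σ ⊕ τ) K →ₐ[K] S) ≤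
      idealOfVars (σ ⊕ τ) K)
    {θ : S →ₐ[K] S} (hθ : TriviallyActs u₁ θ) (hθ' : ∀ j, θ (u₂ j) = u₂ j) :
    TriviallyActs (Sum.elim u₁ u₂) θ := by
  obtain ⟨φ, hφ, hφθ, htriv⟩ := hθ
  have haug : Augmented (extendLeft τ φ) := by
    rintro (i | j)
    · rw [extendLeft, aeval_X, Sum.elim_inl, (augmented_rename _).constantCoeff_apply, hφ]
    · rw [extendLeft, aeval_X, Sum.elim_inr, constantCoeff_X]
  have hlift : ∀ f, aeval (Sum.elim u₁ u₂) (extendLeft τ φ f) =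
      θ (aeval (Sum.elim u₁ u₂) f) := by
    intro f
    have : (aeval (Sum.elim u₁ u₂)).comp (extendLeft τ φ) =
        θ.comp (aeval (Sum.elim u₁ u₂)) := by
      ext1 i
      rcases i with i | j
      · rw [AlgHom.comp_apply, AlgHom.comp_apply, extendLeft, aeval_X, Sum.elim_inl,
          aeval_rename, Sum.elim_comp_inl, hφθ, aeval_X, aeval_X, Sum.elim_inl]
      · rw [AlgHom.comp_apply, AlgHom.comp_apply, extendLeft, aeval_X, Sum.elim_inr, aeval_X,
          Sum.elim_inr, hθ']
    exact DFunLike.congr_fun this f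
  refine ⟨_, haug, hlift, fun f hf hf2 => ?_⟩
  obtain ⟨f₁, h1, f₂, h2, h12⟩ := h.exists_sub_mem hf
  set I := RingHom.ker (aeval (Sum.elim u₁ u₂) : MvPolynomial (σ ⊕ τ) K →ₐ[K] S) with hI
  set z := f - (rename Sum.inl f₁ + rename Sum.inr f₂) with hz
  have hz2 : z ∈ idealOfVars (σ ⊕ τ) K ^ 2 := mul_le_sq h₁₂ h12
  let π : MvPolynomial (σ ⊕ τ) K →ₐ[K] MvPolynomial σ K := aeval (Sum.elim X fun _ => 0)
  have hπ : Augmented π := by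
    rintro (i | j)
    · rw [aeval_X, Sum.elim_inl, constantCoeff_X]
    · rw [aeval_X, Sum.elim_inr, map_zero]
  have hπf : π (f - z) = f₁ := by
    rw [hz, sub_sub_cancel, map_add, aeval_rename, aeval_rename, Sum.elim_comp_inl,
      Sum.elim_comp_inr, aeval_X_left_apply]
    have : (aeval (fun _ => 0) f₂ : MvPolynomial σ K) = 0 := by
      rw [MvPolynomial.aeval_zero', (mem_idealOfVars_iff _).1 (h₂ h2), map_zero]
    rw [this, add_zero]
  have hf₁ : f₁ ∈ idealOfVars σ K ^ 2 := by
    rw [← hπf]; exact hπ.mem_sq (sub_mem hf2 hz2)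
  have h5 : extendLeft τ φ f - f = rename Sum.inl (φ f₁ - f₁) + (extendLeft τ φ z - z) := by
    have h6 : extendLeft τ φ z =
        extendLeft τ φ f - (rename Sum.inl (φ f₁) + rename Sum.inr f₂) := by
      rw [hz, map_sub, map_add, extendLeft_rename_inl, extendLeft_rename_inr]
    rw [h6, hz, map_sub (rename Sum.inl : MvPolynomial σ K →ₐ[K] MvPolynomial (σ ⊕ τ) K)]; ring
  rw [h5]
  refine add_mem ((augmented_rename _).mem_mul (fun _ => rename_inl_mem_ker) (htriv f₁ h1 hf₁))
    (sub_mem (haug.mem_mul (J := I) (fun g hg => ?_) h12) h12)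
  rw [hI, RingHom.mem_ker] at hg ⊢
  rw [hlift, hg, map_zero]

end SumPresentation

section Product

open TensorProduct

variable {k : Type} [Field k] {n : ℕ} {Wt : Subgroup (Matrix.GeneralLinearGroup (Fin n) k)}
  {E₁ E₂ : Matrix (Fin n) (Fin n) k}

/-- The diagonal map attached to a decomposition of the affine space as a product. -/
def diagonal (E₁ E₂ : Matrix (Fin n) (Fin n) k) :
    MvPolynomial (Fin n) k →ₐ[k] MvPolynomial (Fin n) k ⊗[k] MvPolynomial (Fin n) k :=
  aeval fun i => linSub E₁ (X i) ⊗ₜ 1 + 1 ⊗ₜ linSub E₂ (X i)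

theorem diagonal_linSub (E₁ E₂ M : Matrix (Fin n) (Fin n) k) (i : Fin n) :
    diagonal E₁ E₂ (linSub M (X i)) =
      linSub (M * E₁) (X i) ⊗ₜ 1 + 1 ⊗ₜ linSub (M * E₂) (X i) := by
  rw [← linSub_linSub, ← linSub_linSub, linSub_X, map_sum, map_sum, map_sum,
    TensorProduct.sum_tmul, TensorProduct.tmul_sum, ← Finset.sum_add_distrib]
  refine Finset.sum_congr rfl fun j _ => ?_
  rw [map_smul, map_smul, map_smul, diagonal, aeval_X, smul_add, TensorProduct.smul_tmul',
    TensorProduct.tmul_smul]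

theorem Splitting.diagonal_left (h : Splitting Wt E₁ E₂) {f : MvPolynomial (Fin n) k}
    (hf : linSub E₁ f = f) : diagonal E₁ E₂ f = f ⊗ₜ 1 := by
  have : (diagonal E₁ E₂).comp (linSub E₁) =
      (Algebra.TensorProduct.includeLeft : _ →ₐ[k] _ ⊗[k] MvPolynomial (Fin n) k).comp
        (linSub E₁) := by
    ext1 i
    rw [AlgHom.comp_apply, AlgHom.comp_apply, diagonal_linSub, h.mul_self, h.mul]
    rw [show linSub (0 : Matrix (Fin n) (Fin n) k) (X i) = 0 by rw [linSub_X]; simp,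
      TensorProduct.tmul_zero, add_zero]
    rfl
  rw [← hf]
  exact DFunLike.congr_fun this f

theorem Splitting.diagonal_right (h : Splitting Wt E₁ E₂) {f : MvPolynomial (Fin n) k}
    (hf : linSub E₂ f = f) : diagonal E₁ E₂ f = 1 ⊗ₜ f := by
  have : (diagonal E₁ E₂).comp (linSub E₂) =
      (Algebra.TensorProduct.includeRight : _ →ₐ[k] MvPolynomial (Fin n) k ⊗[k] _).comp
        (linSub E₂) := by
    ext1 i
    rw [AlgHom.comp_apply, AlgHom.comp_apply, diagonal_linSub, h.symm.mul_self, h.mul']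
    rw [show linSub (0 : Matrix (Fin n) (Fin n) k) (X i) = 0 by rw [linSub_X]; simp,
      TensorProduct.zero_tmul, zero_add]
    rfl
  rw [← hf]
  exact DFunLike.congr_fun this f

theorem Splitting.separates (h : Splitting Wt E₁ E₂) {σ τ : Type}
    {u₁ : σ → MvPolynomial (Fin n) k} {u₂ : τ → MvPolynomial (Fin n) k}
    (h₁ : ∀ i, linSub E₁ (u₁ i) = u₁ i) (h₂ : ∀ i, linSub E₂ (u₂ i) = u₂ i) :
    Separates (diagonal E₁ E₂) u₁ u₂ :=
  ⟨fun i => h.diagonal_left (h₁ i), fun i => h.diagonal_right (h₂ i)⟩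

theorem Splitting.goodFamily_sumElim (h : Splitting Wt E₁ E₂) {σ τ : Type} [Fintype σ] [Fintype τ]
    {u₁ : σ → MvPolynomial (Fin n) k} {u₂ : τ → MvPolynomial (Fin n) k}
    (h₁ : ∀ i, linSub E₁ (u₁ i) = u₁ i) (h₂ : ∀ i, linSub E₂ (u₂ i) = u₂ i)
    {N₁ N₂ : ℕ} {Γ₁ Γ₂ : Subgroup (Matrix.GeneralLinearGroup (Fin n) k)}
    (hΓ₁ : Γ₁ ≤ Wt ⊓ fixSub E₂) (hΓ₂ : Γ₂ ≤ Wt ⊓ fixSub E₁)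
    (hu₁ : GoodFamily N₁ (Γ₁ : Set _) u₁) (hu₂ : GoodFamily N₂ (Γ₂ : Set _) u₂) :
    GoodFamily (N₁ + N₂) (Γ₁ ∪ Γ₂ : Set _) (Sum.elim u₁ u₂) := by
  have hz : ∀ i, constantCoeff (Sum.elim u₁ u₂ i) = 0 := by
    rintro (i | i)
    · exact hu₁.zero i
    · exact hu₂.zero i
  have hz' : ∀ i, constantCoeff (Sum.elim u₂ u₁ i) = 0 := by
    rintro (i | i)
    · exact hu₂.zero i
    · exact hu₁.zero i
  have hadj : Algebra.adjoin k (Set.range (Sum.elim u₂ u₁)) =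
      Algebra.adjoin k (Set.range (Sum.elim u₁ u₂)) := by
    rw [Set.Sum.elim_range, Set.Sum.elim_range, Set.union_comm]
  have hs := h.separates h₁ h₂
  have hs' := h.symm.separates h₂ h₁
  refine ⟨hz, ?_, ?_⟩
  · have := hs.finrank_conormal_le
    have h3 := hu₁.finrank_le
    have h4 := hu₂.finrank_le
    rw [Fintype.card_sum]
    omega
  · rintro w (hw | hw)
    · exact hs.triviallyActs
        (ker_aeval_le_of_constantCoeff hu₂.zero) (ker_aeval_le_of_constantCoeff hz)
        (hu₁.acts w hw) fun j => h.symm.matAct_eq_self (hΓ₁ hw).1 (hΓ₁ hw).2 (h₂ j)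
    · obtain ⟨L⟩ := nonempty_lifts_of_constantCoeff hz' hz hadj
      exact L.triviallyActs (hs'.triviallyActs
        (ker_aeval_le_of_constantCoeff hu₁.zero) (ker_aeval_le_of_constantCoeff hz')
        (hu₂.acts w hw) fun j => h.matAct_eq_self (hΓ₂ hw).1 (hΓ₂ hw).2 (h₁ j))

theorem Splitting.range_mul_range (h : Splitting Wt E₁ E₂) :
    Subalgebra.toSubmodule (linSub E₁).range * Subalgebra.toSubmodule (linSub E₂).range = ⊤ := by
  rw [Subalgebra.mul_toSubmodule, Algebra.toSubmodule_eq_top]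
  rw [eq_top_iff, ← adjoin_range_X, Algebra.adjoin_le_iff]
  rintro _ ⟨i, rfl⟩
  have : (X i : MvPolynomial (Fin n) k) = linSub E₁ (X i) + linSub E₂ (X i) := by
    have h1 : linSub (E₁ + E₂) (X i) = linSub E₁ (X i) + linSub E₂ (X i) := by
      rw [linSub_X, linSub_X, linSub_X, ← Finset.sum_add_distrib]
      simp only [Matrix.add_apply, add_smul]
    rw [← h1, h.add, linSub_one, AlgHom.id_apply]
  rw [this]
  exact add_mem ((le_sup_left : (linSub E₁).range ≤ (linSub E₁).range ⊔ (linSub E₂).range) ⟨_, rfl⟩)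
    ((le_sup_right : (linSub E₂).range ≤ (linSub E₁).range ⊔ (linSub E₂).range) ⟨_, rfl⟩)

theorem Splitting.imageInvariants_sup [CharZero k] (h : Splitting Wt E₁ E₂)
    {H₁ H₂ : Subgroup (Matrix.GeneralLinearGroup (Fin n) k)} [Finite ↥H₁] [Finite ↥H₂]
    (hH₁ : H₁ ≤ Wt ⊓ fixSub E₂) (hH₂ : H₂ ≤ Wt ⊓ fixSub E₁) :
    imageInvariants H₁ E₁ ⊔ imageInvariants H₂ E₂ = invariants (H₁ ⊔ H₂) := by
  have key : ∀ f ∈ invariants (H₁ ⊔ H₂), (∀ g ∈ H₁, matAct g f = f) ∧ ∀ g ∈ H₂, matAct g f = f :=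
    fun f hf => ⟨fun g hg => hf g ((le_sup_left : H₁ ≤ H₁ ⊔ H₂) hg),
      fun g hg => hf g ((le_sup_right : H₂ ≤ H₁ ⊔ H₂) hg)⟩
  have key' : ∀ f, (∀ g ∈ H₁, matAct g f = f) → (∀ g ∈ H₂, matAct g f = f) →
      f ∈ invariants (H₁ ⊔ H₂) := fun f hf hf' g hg => by
    rw [Subgroup.sup_eq_closure_mul] at hg
    refine Subgroup.closure_induction (p := fun g _ => matAct g f = f) ?_ ?_ ?_ ?_ hg
    · rintro _ ⟨a, ha, b, hb, rfl⟩
      change matAct (a * b) f = f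
      rw [matAct_mul, AlgHom.comp_apply, hf' b hb, hf a ha]
    · rw [matAct_one, AlgHom.id_apply]
    · intro x y _ _ hx hy
      rw [matAct_mul, AlgHom.comp_apply, hy, hx]
    · intro x _ hx
      apply matAct_injective x
      rw [matAct_inv_apply, hx]
  apply le_antisymm
  · refine sup_le (fun f hf => ?_) (fun f hf => ?_)
    · rw [h.mem_imageInvariants] at hf
      exact key' f hf.1 fun g hg => h.matAct_eq_self (hH₂ hg).1 (hH₂ hg).2 hf.2
    · rw [h.symm.mem_imageInvariants] at hf
      exact key' f (fun g hg => h.symm.matAct_eq_self (hH₁ hg).1 (hH₁ hg).2 hf.2) hf.1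
  · intro f hf
    obtain ⟨hf1, hf2⟩ := key f hf
    have := Fintype.ofFinite ↥H₁
    have := Fintype.ofFinite ↥H₂
    let ρ₁ := (matActHom n k).comp H₁.subtype
    let ρ₂ := (matActHom n k).comp H₂.subtype
    have e : avg ρ₁ (avg ρ₂ f) = f := by
      rw [avg_eq_self ρ₂ fun g => hf2 g g.2, avg_eq_self ρ₁ fun g => hf1 g g.2]
    rw [← e]
    have hft : f ∈ Subalgebra.toSubmodule (linSub E₁).range *
        Subalgebra.toSubmodule (linSub E₂).range := by
      rw [h.range_mul_range]; trivial
    refine Submodule.mul_induction_on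
      (C := fun f => avg ρ₁ (avg ρ₂ f) ∈ imageInvariants H₁ E₁ ⊔ imageInvariants H₂ E₂) hft ?_ ?_
    · rintro _ ⟨a, rfl⟩ _ ⟨b, rfl⟩
      change avg ρ₁ (avg ρ₂ (linSub E₁ a * linSub E₂ b)) ∈ _
      have h2 : avg ρ₂ (linSub E₁ a * linSub E₂ b) = linSub E₁ a * avg ρ₂ (linSub E₂ b) := by
        rw [avg_apply, avg_apply, mul_smul_comm, Finset.mul_sum]
        congr 1
        refine Finset.sum_congr rfl fun g _ => ?_
        rw [map_mul]
        congr 1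
        exact h.matAct_eq_self (hH₂ g.2).1 (hH₂ g.2).2 (h.linSub_linSub_self a)
      have h3 : linSub E₂ (avg ρ₂ (linSub E₂ b)) = avg ρ₂ (linSub E₂ b) := by
        rw [map_avg_of_comm ρ₂ ρ₂ (linSub E₂)
          (fun g f => (h.symm.matAct_linSub (hH₂ g.2).1 f).symm), h.symm.linSub_linSub_self]
      have h4 : linSub E₁ (avg ρ₁ (linSub E₁ a)) = avg ρ₁ (linSub E₁ a) := by
        rw [map_avg_of_comm ρ₁ ρ₁ (linSub E₁)
          (fun g f => (h.matAct_linSub (hH₁ g.2).1 f).symm), h.linSub_linSub_self]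
      have h5 : avg ρ₁ (linSub E₁ a * avg ρ₂ (linSub E₂ b)) =
          avg ρ₁ (linSub E₁ a) * avg ρ₂ (linSub E₂ b) := by
        rw [avg_apply ρ₁, avg_apply ρ₁ (linSub E₁ a), smul_mul_assoc, Finset.sum_mul]
        congr 1
        refine Finset.sum_congr rfl fun g _ => ?_
        rw [map_mul]
        congr 1
        exact h.symm.matAct_eq_self (hH₁ g.2).1 (hH₁ g.2).2 h3
      rw [h2, h5]
      refine mul_mem ((le_sup_left : imageInvariants H₁ E₁ ≤ _) ?_)
        ((le_sup_right : imageInvariants H₂ E₂ ≤ _) ?_)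
      · exact h.mem_imageInvariants.2 ⟨fun g hg => map_avg ρ₁ ⟨g, hg⟩ _, h4⟩
      · exact h.symm.mem_imageInvariants.2 ⟨fun g hg => map_avg ρ₂ ⟨g, hg⟩ _, h3⟩
    · intro x y hx hy
      rw [map_add, map_add]
      exact add_mem hx hy

end Product

section Decomposition

variable {k : Type} [Field k] {n m : ℕ} {Wt G : Subgroup (Matrix.GeneralLinearGroup (Fin n) k)}
  {E₁ E₂ : Matrix (Fin n) (Fin n) k} {p : Fin m → MvPolynomial (Fin n) k} {d : Fin m → ℕ}
  {c : ↥Wt → Fin m → Fin m → k}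

theorem QuotSetup.isGoodQuot_of_goodFamily [CharZero k] (h : QuotSetup Wt G p d c) {σ : Type}
    [Fintype σ] {u : σ → MvPolynomial (Fin n) k} {Γ : Set (Matrix.GeneralLinearGroup (Fin n) k)}
    (hu : GoodFamily n Γ u) (hadj : Algebra.adjoin k (Set.range u) = invariants G)
    (hΓ : (Wt : Set _) ⊆ Γ) : IsGoodQuot Wt p c := by
  have hp := hu.of_adjoin_eq h.constantCoeff_eq (hadj.trans h.gen.symm)
  refine ⟨isCompleteIntersection_of_finrank_le h.dpos h.homog ?_, fun w f hf => ?_⟩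
  · have := hp.finrank_le
    rwa [Fintype.card_fin] at this
  · exact (hp.acts w (hΓ w.2)).trivialOnConormal (augmented_polyAct (c w))
      (aeval_polyAct fun i => h.equivar w i) f hf (h.relIdeal_le_sq hf)

theorem GoodSetup.constantCoeff_eq (h : GoodSetup Wt G p d c) (i : Fin m) :
    constantCoeff (p i) = 0 :=
  constantCoeff_eq_zero_of_isHomogeneous (h.homog i) (h.dpos i)

theorem GoodSetup.goodFamily (h : GoodSetup Wt G p d c) : GoodFamily n (Wt : Set _) p where
  zero := h.constantCoeff_eq
  finrank_le := by rw [Fintype.card_fin]; exact h.finrank_le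
  acts w hw := ⟨polyAct (c ⟨w, hw⟩), augmented_polyAct _,
    aeval_polyAct fun i => h.equivar ⟨w, hw⟩ i, fun f hf _ => h.trivial ⟨w, hw⟩ f hf⟩

theorem Splitting.linSub_slice (h : Splitting Wt E₁ E₂) (v : Fin n → k) (i : Fin m) :
    linSub E₁ (slice E₁ v p i) = slice E₁ v p i := by
  rw [slice, map_sub, h.linSub_affSub_left, algHom_C, algebraMap_eq]

theorem adjoin_range_sumElim {σ τ : Type} (u₁ : σ → MvPolynomial (Fin n) k)
    (u₂ : τ → MvPolynomial (Fin n) k) :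
    Algebra.adjoin k (Set.range (Sum.elim u₁ u₂)) =
      Algebra.adjoin k (Set.range u₁) ⊔ Algebra.adjoin k (Set.range u₂) := by
  rw [Set.Sum.elim_range, Algebra.adjoin_union]

/-- The invariants of the parabolic subgroup attached to a factor have a good presentation. -/
theorem GoodSetup.exists_goodFamily_left [CharZero k] (h : GoodSetup Wt G p d c)
    (hE : Splitting Wt E₁ E₂) :
    ∃ u : Fin m ⊕ Fin n → MvPolynomial (Fin n) k,
      GoodFamily n (Wt ⊓ fixSub E₂ : Subgroup _) u ∧
      Algebra.adjoin k (Set.range u) = invariants (G ⊓ fixSub E₂) := by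
  have : Finite ↥Wt := h.finite
  have : Finite ↥G := h.finite.subset h.le
  obtain ⟨v, hv⟩ := exists_genericPoint (hE.mono h.le)
  have hE' := (hE.mono (bot_le : ⊥ ≤ Wt)).symm
  obtain ⟨v', hv'⟩ := exists_genericPoint hE'
  have : Finite ↥(G ⊓ fixSub E₂) := (Set.toFinite (G : Set _)).subset inf_le_left
  have : Finite ↥((⊥ : Subgroup (Matrix.GeneralLinearGroup (Fin n) k)) ⊓ fixSub E₁) :=
    (goodSetup_bot (n := n) (k := k)).finite.subset inf_le_left
  refine ⟨Sum.elim (slice E₁ v p) (slice E₂ v' X), ?_, ?_⟩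
  · have := hE.goodFamily_sumElim (hE.linSub_slice v) (hE'.linSub_slice v') le_rfl
      (inf_le_inf_right _ bot_le) (h.goodFamily_slice hE hv)
      (goodSetup_bot.goodFamily_slice hE' hv')
    rw [hE.rank] at this
    exact this.mono Set.subset_union_left
  · rw [adjoin_range_sumElim, (hE.mono h.le).adjoin_slice h.gen hv,
      hE'.adjoin_slice goodSetup_bot.gen hv',
      hE.imageInvariants_sup (inf_le_inf_right _ h.le) (inf_le_inf_right _ bot_le)]
    congr 1
    rw [bot_inf_eq, sup_bot_eq]

/-- The invariants of the product of the parabolic subgroups attached to the factors have a good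
presentation. -/
theorem GoodSetup.exists_goodFamily_sup [CharZero k] (h : GoodSetup Wt G p d c)
    (hE : Splitting Wt E₁ E₂) :
    ∃ u : Fin m ⊕ Fin m → MvPolynomial (Fin n) k,
      GoodFamily n ((Wt ⊓ fixSub E₂ : Subgroup _) ∪ (Wt ⊓ fixSub E₁ : Subgroup _) : Set _) u ∧
      Algebra.adjoin k (Set.range u) = invariants ((G ⊓ fixSub E₂) ⊔ (G ⊓ fixSub E₁)) := by
  have : Finite ↥Wt := h.finite
  have : Finite ↥G := h.finite.subset h.le
  have hG := hE.mono h.le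
  obtain ⟨v, hv⟩ := exists_genericPoint hG
  obtain ⟨v', hv'⟩ := exists_genericPoint hG.symm
  have : Finite ↥(G ⊓ fixSub E₂) := (Set.toFinite (G : Set _)).subset inf_le_left
  have : Finite ↥(G ⊓ fixSub E₁) := (Set.toFinite (G : Set _)).subset inf_le_left
  refine ⟨Sum.elim (slice E₁ v p) (slice E₂ v' p), ?_, ?_⟩
  · have := hE.goodFamily_sumElim (hE.linSub_slice v) (hE.symm.linSub_slice v') le_rfl
      le_rfl (h.goodFamily_slice hE hv) (h.goodFamily_slice hE.symm hv')
    rwa [hE.rank] at this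
  · rw [adjoin_range_sumElim, hG.adjoin_slice h.gen hv, hG.symm.adjoin_slice h.gen hv',
      hE.imageInvariants_sup (inf_le_inf_right _ h.le) (inf_le_inf_right _ h.le)]

/-- A reflection preserving a decomposition fixes one of the factors pointwise. -/
theorem Splitting.mem_fixSub_or (h : Splitting Wt E₁ E₂)
    {g : Matrix.GeneralLinearGroup (Fin n) k} (hg : g ∈ Wt)
    (hr : IsReflection (g : Matrix (Fin n) (Fin n) k)) : g ∈ fixSub E₂ ∨ g ∈ fixSub E₁ := by
  by_contra! hcon
  simp only [mem_fixSub] at hcon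
  set N : Matrix (Fin n) (Fin n) k := g - 1 with hN
  have hN1 : N * E₂ ≠ 0 := by rw [hN, sub_mul, one_mul, sub_ne_zero]; exact hcon.1
  have hN2 : N * E₁ ≠ 0 := by rw [hN, sub_mul, one_mul, sub_ne_zero]; exact hcon.2
  have ex : ∀ M : Matrix (Fin n) (Fin n) k, M ≠ 0 → ∃ x, M.mulVec x ≠ 0 := by
    intro M hM
    by_contra! hx
    exact hM (Matrix.ext_of_mulVec_single fun i => by rw [hx, Matrix.zero_mulVec])
  obtain ⟨x, hx⟩ := ex _ hN1
  obtain ⟨y, hy⟩ := ex _ hN2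
  have hrank : Module.finrank k (LinearMap.range (Matrix.toLin' N)) = 1 := by
    have h1 := LinearMap.finrank_range_add_finrank_ker (Matrix.toLin' N)
    have h2 : Matrix.toLin' N = Matrix.toLin' (g : Matrix (Fin n) (Fin n) k) - LinearMap.id := by
      rw [hN, map_sub, Matrix.toLin'_one]
    have h3 := hr.2
    rw [Module.finrank_fin_fun] at h1
    rw [← h2] at h3
    omega
  have hx' : (N * E₂).mulVec x ∈ LinearMap.range (Matrix.toLin' N) :=
    ⟨E₂.mulVec x, by rw [Matrix.toLin'_apply, Matrix.mulVec_mulVec]⟩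
  have hy' : (N * E₁).mulVec y ∈ LinearMap.range (Matrix.toLin' N) :=
    ⟨E₁.mulVec y, by rw [Matrix.toLin'_apply, Matrix.mulVec_mulVec]⟩
  obtain ⟨a, ha⟩ := (finrank_eq_one_iff_of_nonzero'
    (⟨_, hx'⟩ : LinearMap.range (Matrix.toLin' N)) (fun h0 => hx (congrArg Subtype.val h0))).1
    hrank ⟨_, hy'⟩
  have ha' : a • (N * E₂).mulVec x = (N * E₁).mulVec y := congrArg Subtype.val ha
  have hc1 : E₁ * (N * E₁) = N * E₁ := by
    rw [hN, sub_mul, one_mul, h.comm g hg, mul_sub, ← mul_assoc, h.mul_self]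
  have hc2 : E₁ * (N * E₂) = 0 := by
    rw [hN, sub_mul, one_mul, h.comm' g hg, mul_sub, ← mul_assoc, h.mul, zero_mul, sub_zero]
  apply hy
  have := congrArg E₁.mulVec ha'
  rw [Matrix.mulVec_smul, Matrix.mulVec_mulVec, Matrix.mulVec_mulVec, hc1, hc2,
    Matrix.zero_mulVec, smul_zero] at this
  exact this.symm

theorem Splitting.le_closure (h : Splitting Wt E₁ E₂) (hr : IsReflectionGroup Wt) :
    Subgroup.closure ((Wt ⊓ fixSub E₂ : Subgroup _) ∪ (Wt ⊓ fixSub E₁ : Subgroup _) : Set _) =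
      Wt := by
  apply le_antisymm
  · rw [Subgroup.closure_le, Set.union_subset_iff]
    exact ⟨fun g hg => hg.1, fun g hg => hg.1⟩
  · conv_lhs => rw [← hr]
    refine Subgroup.closure_mono fun g hg => ?_
    rcases h.mem_fixSub_or hg.1 hg.2 with h1 | h1
    · exact Or.inl ⟨hg.1, h1⟩
    · exact Or.inr ⟨hg.1, h1⟩

theorem exists_splitting {V₁ V₂ : Submodule k (Fin n → k)} (hV : IsCompl V₁ V₂)
    (h₁ : ∀ w ∈ Wt, ∀ x ∈ V₁, Matrix.mulVec ((w : Matrix.GeneralLinearGroup (Fin n) k) :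
        Matrix (Fin n) (Fin n) k) x ∈ V₁)
    (h₂ : ∀ w ∈ Wt, ∀ x ∈ V₂, Matrix.mulVec ((w : Matrix.GeneralLinearGroup (Fin n) k) :
        Matrix (Fin n) (Fin n) k) x ∈ V₂) :
    ∃ E₁ E₂, Splitting Wt E₁ E₂ ∧ LinearMap.range (Matrix.toLin' E₁) = V₁ ∧
      LinearMap.range (Matrix.toLin' E₂) = V₂ := by
  have key : ∀ {U U' : Submodule k (Fin n → k)} (hU : IsCompl U U'), LinearMap.range
      (Matrix.toLin' (LinearMap.toMatrix' (U.projection U' hU))) = U := fun hU => by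
    rw [Matrix.toLin'_toMatrix', Submodule.range_projection]
  have hmul : ∀ {U U' : Submodule k (Fin n → k)} (hU : IsCompl U U'),
      LinearMap.toMatrix' (U.projection U' hU) *
        LinearMap.toMatrix' (U'.projection U hU.symm) = 0 := fun hU => by
    rw [← LinearMap.toMatrix'_mul, LinearEquiv.map_eq_zero_iff]
    refine LinearMap.ext fun x => ?_
    exact (Submodule.projection_apply_eq_zero_iff hU).2 (Submodule.projection_apply_mem _ _)
  have hcomm : ∀ {U U' : Submodule k (Fin n → k)} (hU : IsCompl U U')
      (M : Matrix (Fin n) (Fin n) k) (_ : ∀ x ∈ U, M.mulVec x ∈ U)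
      (_ : ∀ x ∈ U', M.mulVec x ∈ U'), M * LinearMap.toMatrix' (U.projection U' hU) =
      LinearMap.toMatrix' (U.projection U' hU) * M := by
    intro U U' hU M hM hM'
    apply Matrix.toLin'.injective
    rw [Matrix.toLin'_mul, Matrix.toLin'_mul, Matrix.toLin'_toMatrix']
    refine LinearMap.ext fun x => ?_
    rw [LinearMap.comp_apply, LinearMap.comp_apply, Matrix.toLin'_apply, Matrix.toLin'_apply]
    conv_rhs => rw [← Submodule.projection_add_projection_eq_self hU x, Matrix.mulVec_add, map_add]
    rw [Submodule.projection_apply_of_mem_left _ (hM _ (Submodule.projection_apply_mem hU x)),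
      (Submodule.projection_apply_eq_zero_iff hU).2
        (hM' _ (Submodule.projection_apply_mem hU.symm x)), add_zero]
  refine ⟨LinearMap.toMatrix' (V₁.projection V₂ hV), LinearMap.toMatrix' (V₂.projection V₁ hV.symm),
    ⟨?_, hmul hV, hmul hV.symm, fun w hw => hcomm hV _ (h₁ w hw) (h₂ w hw),
      fun w hw => hcomm hV.symm _ (h₂ w hw) (h₁ w hw), ?_⟩, key hV, key hV.symm⟩
  · rw [← map_add, Submodule.projection_add_projection_eq_id, LinearMap.toMatrix'_id]
  · have hr : ∀ M : Matrix (Fin n) (Fin n) k,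
        M.rank = Module.finrank k (LinearMap.range (Matrix.toLin' M)) := fun M => rfl
    rw [hr, hr, key hV, key hV.symm, Submodule.finrank_add_eq_of_isCompl hV,
      Module.finrank_fin_fun]

end Decomposition

section QuasiRegular

variable {K : Type} [Field K] {τ ι : Type} [Fintype ι]

theorem pderiv_mem_pow {I : Ideal (MvPolynomial τ K)} (j : τ) (N : ℕ) {f : MvPolynomial τ K}
    (hf : f ∈ I ^ (N + 1)) : pderiv j f ∈ I ^ N := by
  induction N generalizing f with
  | zero => rw [pow_zero, Ideal.one_eq_top]; trivial
  | succ N ih =>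
    rw [pow_succ] at hf
    refine Submodule.mul_induction_on hf (fun a ha b hb => ?_) (fun a b ha hb => ?_)
    · rw [Derivation.leibniz, smul_eq_mul, smul_eq_mul]
      refine Ideal.add_mem _ (Ideal.mul_mem_right _ _ ha) ?_
      rw [pow_succ']
      exact Ideal.mul_mem_mul hb (ih ha)
    · rw [map_add]
      exact Ideal.add_mem _ ha hb

/-- The chain rule for evaluating a form whose coefficients are themselves polynomials, up to
the contribution of the coefficients. -/
theorem pderiv_eval_sub_mem_pow {I : Ideal (MvPolynomial τ K)} {h : ι → MvPolynomial τ K}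
    (hI : ∀ i, h i ∈ I) (j : τ) {N : ℕ} {Φ : MvPolynomial ι (MvPolynomial τ K)}
    (hΦ : Φ.IsHomogeneous N) :
    pderiv j (eval h Φ) - ∑ i, eval h (pderiv i Φ) * pderiv j (h i) ∈ I ^ N := by
  classical
  have key : ∀ (s : ι →₀ ℕ) (a : MvPolynomial τ K),
      pderiv j (eval h (monomial s a)) - ∑ i, eval h (pderiv i (monomial s a)) * pderiv j (h i) ∈
        I ^ (monomial s a).totalDegree := by
    refine fun s a => induction_on_monomial (motive := fun Ψ =>
      pderiv j (eval h Ψ) - ∑ i, eval h (pderiv i Ψ) * pderiv j (h i) ∈ I ^ Ψ.totalDegree)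
      (fun a => ?_) (fun Ψ i hΨ => ?_) s a
    · rw [totalDegree_C, pow_zero, Ideal.one_eq_top]; trivial
    · have h1 : pderiv j (eval h (Ψ * X i)) - ∑ l, eval h (pderiv l (Ψ * X i)) * pderiv j (h l) =
          (pderiv j (eval h Ψ) - ∑ l, eval h (pderiv l Ψ) * pderiv j (h l)) * h i := by
        have h2 : ∀ l, eval h (pderiv l (Ψ * X i)) * pderiv j (h l) =
            eval h (pderiv l Ψ) * pderiv j (h l) * h i +
              if i = l then eval h Ψ * pderiv j (h i) else 0 := by
          intro l
          rw [Derivation.leibniz, pderiv_X]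
          by_cases hl : i = l
          · subst hl
            simp [smul_eq_mul]; ring
          · rw [Pi.single_eq_of_ne hl, if_neg hl]
            simp [smul_eq_mul]; ring
        simp only [h2]
        rw [Finset.sum_add_distrib, ← Finset.sum_mul, Finset.sum_ite_eq,
          if_pos (Finset.mem_univ i), map_mul, eval_X, Derivation.leibniz, smul_eq_mul,
          smul_eq_mul]
        ring
      rw [h1]
      refine Ideal.pow_le_pow_right (?_ : _ ≤ Ψ.totalDegree + 1) ?_
      · refine (totalDegree_mul _ _).trans ?_
        rw [totalDegree_X]
      · rw [pow_succ]
        exact Ideal.mul_mem_mul hΨ (hI i)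
  have hsum : pderiv j (eval h Φ) - ∑ i, eval h (pderiv i Φ) * pderiv j (h i) =
      ∑ s ∈ Φ.support, (pderiv j (eval h (monomial s (coeff s Φ))) -
        ∑ i, eval h (pderiv i (monomial s (coeff s Φ))) * pderiv j (h i)) := by
    rw [Finset.sum_sub_distrib, Finset.sum_comm]
    conv_lhs => rw [Φ.as_sum]
    simp only [map_sum, Finset.sum_mul]
  rw [hsum]
  refine Ideal.sum_mem _ fun s hs => ?_
  have := key s (coeff s Φ)
  rw [totalDegree_monomial _ (mem_support_iff.1 hs)] at this
  convert this using 2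
  have h3 := hΦ (mem_support_iff.1 hs)
  rw [← h3, Finsupp.weight_apply]
  simp

/-- Elements of `I` whose gradients are independent modulo `I` form a quasi-regular sequence. -/
theorem coeff_mem_of_eval_mem_pow [CharZero K] {I : Ideal (MvPolynomial τ K)}
    {h : ι → MvPolynomial τ K} (hI : ∀ i, h i ∈ I)
    (hJ : ∀ a : ι → MvPolynomial τ K, (∀ j, ∑ i, a i * pderiv j (h i) ∈ I) → ∀ i, a i ∈ I)
    {N : ℕ} {Φ : MvPolynomial ι (MvPolynomial τ K)} (hΦ : Φ.IsHomogeneous N)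
    (hev : eval h Φ ∈ I ^ (N + 1)) (α : ι →₀ ℕ) : coeff α Φ ∈ I := by
  classical
  induction N generalizing Φ α with
  | zero =>
    rw [← totalDegree_zero_iff_isHomogeneous, totalDegree_eq_zero_iff_eq_C] at hΦ
    rw [hΦ, eval_C, zero_add, pow_one] at hev
    rw [hΦ, coeff_C]
    split_ifs
    · exact hev
    · exact I.zero_mem
  | succ N ih =>
    have h1 : ∀ j β, ∑ i, coeff β (pderiv i Φ) * pderiv j (h i) ∈ I := by
      intro j β
      have hh : (∑ i, C (pderiv j (h i)) * pderiv i Φ).IsHomogeneous N := by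
        refine IsHomogeneous.sum _ _ _ fun i _ => ?_
        have := (isHomogeneous_C ι (pderiv j (h i))).mul (hΦ.pderiv (i := i))
        rwa [zero_add, Nat.add_sub_cancel] at this
      have h2 : eval h (∑ i, C (pderiv j (h i)) * pderiv i Φ) ∈ I ^ (N + 1) := by
        have h3 := Ideal.sub_mem _ (pderiv_mem_pow j (N + 1) hev)
          (pderiv_eval_sub_mem_pow hI j hΦ)
        rw [sub_sub_cancel] at h3
        simpa only [map_sum, map_mul, eval_C, mul_comm] using h3
      have h4 := ih hh h2 β
      rw [coeff_sum] at h4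
      simpa only [coeff_C_mul, mul_comm] using h4
    have h2 : ∀ i β, coeff β (pderiv i Φ) ∈ I := fun i β => hJ _ (fun j => h1 j β) i
    by_cases hα : coeff α Φ = 0
    · rw [hα]; exact I.zero_mem
    have hne : α ≠ 0 := by
      rintro rfl
      have := hΦ hα
      simp at this
    obtain ⟨i, hi⟩ := Finsupp.ne_iff.1 hne
    obtain ⟨β, rfl⟩ : ∃ β, α = β + Finsupp.single i 1 :=
      ⟨α - Finsupp.single i 1, (tsub_add_cancel_of_le (by
        rw [Finsupp.single_le_iff]; exact Nat.one_le_iff_ne_zero.2 hi)).symm⟩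
    have h3 := h2 i β
    rw [coeff_pderiv] at h3
    have h4 : coeff (β + Finsupp.single i 1) Φ =
        (C (((β i : K) + 1)⁻¹) : MvPolynomial τ K) *
          (coeff (β + Finsupp.single i 1) Φ * ((β i : MvPolynomial τ K) + 1)) := by
      have h5 : ((β i : MvPolynomial τ K) + 1) = C ((β i : K) + 1) := by
        rw [map_add, map_one, map_natCast]
      rw [h5, mul_left_comm, ← C_mul, inv_mul_cancel₀ (Nat.cast_add_one_ne_zero _), C_1, mul_one]
    rw [h4]
    exact Ideal.mul_mem_left _ _ h3

end QuasiRegular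

section Jacobian

variable {K : Type} [Field K] {σ τ ι : Type} [Fintype σ] [Fintype τ] [Fintype ι]

theorem card_le_finrank_span_gradient [CharZero K] {F : Type} [Field F] [Algebra K F]
    {φ : MvPolynomial σ K →ₐ[K] F} (hφ : Function.Injective φ) {p : τ → MvPolynomial σ K}
    {h : ι → MvPolynomial τ K}
    (hspan : Ideal.span (Set.range h) =
      RingHom.ker (aeval p : MvPolynomial τ K →ₐ[K] MvPolynomial σ K)) :
    Fintype.card τ ≤ Module.finrank F (Submodule.span F
      (Set.range fun i j => φ (aeval p (pderiv j (h i))))) + Fintype.card σ := by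
  have hP : ∀ g, aeval (fun j => φ (p j)) g = φ (aeval p g) := fun g =>
    (comp_aeval_apply p φ g).symm
  have hh : ∀ i, aeval p (h i) = 0 := fun i => by
    rw [← RingHom.mem_ker, ← hspan]
    exact Ideal.subset_span ⟨i, rfl⟩
  have h1 := card_le_finrank_gradientSpan (K := K) (fun j => φ (p j)) (Fintype.card σ)
    fun S hS => by
      have := card_le_of_algebraicIndependent_comp φ hS fun i => ⟨p i, rfl⟩
      rwa [Fintype.card_coe] at this
  refine h1.trans (Nat.add_le_add_right (Submodule.finrank_mono (Submodule.span_le.2 ?_)) _)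
  rintro _ ⟨g, hg, rfl⟩
  rw [hP, map_eq_zero_iff φ hφ, ← RingHom.mem_ker, ← hspan] at hg
  obtain ⟨b, rfl⟩ := (Submodule.mem_span_range_iff_exists_fun _).1 hg
  have : (fun j => aeval (fun j => φ (p j)) (pderiv j (∑ i, b i • h i))) =
      ∑ i, φ (aeval p (b i)) • fun j => φ (aeval p (pderiv j (h i))) := by
    funext j
    simp only [hP, map_sum, smul_eq_mul, Derivation.leibniz, map_add, map_mul, hh, zero_mul,
      add_zero, Finset.sum_apply, Pi.smul_apply]
  rw [this]
  exact Submodule.sum_mem _ fun i _ =>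
    Submodule.smul_mem _ _ (Submodule.subset_span ⟨i, rfl⟩)

theorem card_le_card_add_of_span_eq_ker [CharZero K] {p : τ → MvPolynomial σ K}
    {h : ι → MvPolynomial τ K}
    (hspan : Ideal.span (Set.range h) =
      RingHom.ker (aeval p : MvPolynomial τ K →ₐ[K] MvPolynomial σ K)) :
    Fintype.card τ ≤ Fintype.card ι + Fintype.card σ :=
  (card_le_finrank_span_gradient
    (φ := IsScalarTower.toAlgHom K (MvPolynomial σ K) (FractionRing (MvPolynomial σ K)))
    (IsFractionRing.injective (MvPolynomial σ K) (FractionRing (MvPolynomial σ K))) hspan).trans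
    (Nat.add_le_add_right (finrank_range_le_card _) _)

/-- The Jacobian criterion: generators of the relation ideal of a complete intersection have
independent gradients modulo the ideal. -/
theorem mem_ker_of_sum_mul_pderiv_mem [CharZero K] {p : τ → MvPolynomial σ K}
    {h : ι → MvPolynomial τ K}
    (hspan : Ideal.span (Set.range h) =
      RingHom.ker (aeval p : MvPolynomial τ K →ₐ[K] MvPolynomial σ K))
    (hcard : Fintype.card ι + Fintype.card σ ≤ Fintype.card τ) (a : ι → MvPolynomial τ K)
    (ha : ∀ j, ∑ i, a i * pderiv j (h i) ∈
      RingHom.ker (aeval p : MvPolynomial τ K →ₐ[K] MvPolynomial σ K)) (i : ι) :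
    a i ∈ RingHom.ker (aeval p : MvPolynomial τ K →ₐ[K] MvPolynomial σ K) := by
  let F := FractionRing (MvPolynomial σ K)
  let φ : MvPolynomial σ K →ₐ[K] F := IsScalarTower.toAlgHom K (MvPolynomial σ K) F
  have hφ : Function.Injective φ := IsFractionRing.injective (MvPolynomial σ K) F
  have h1 := card_le_finrank_span_gradient hφ hspan
  have hli : LinearIndependent F fun i j => φ (aeval p (pderiv j (h i))) := by
    rw [linearIndependent_iff_card_le_finrank_span, Set.finrank]
    omega
  rw [RingHom.mem_ker, ← map_eq_zero_iff φ hφ]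
  refine Fintype.linearIndependent_iff.1 hli (fun i => φ (aeval p (a i))) (funext fun j => ?_) i
  have h3 := congrArg φ (RingHom.mem_ker.1 (ha j))
  simpa [Finset.sum_apply] using h3

end Jacobian

section KeyLemma

variable {K : Type} [Field K] {τ τ' ι : Type}

theorem eval_map_algHom (φ : MvPolynomial τ' K →ₐ[K] MvPolynomial τ K)
    (g : ι → MvPolynomial τ' K) (Φ : MvPolynomial ι (MvPolynomial τ' K)) :
    eval (fun i => φ (g i)) (map (φ : MvPolynomial τ' K →+* MvPolynomial τ K) Φ) =
      φ (eval g Φ) := by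
  rw [eval_map]
  exact (eval₂_comp_left (φ : MvPolynomial τ' K →+* MvPolynomial τ K) (RingHom.id _) g Φ).symm

/-- If `I` is generated by a quasi-regular sequence which lifts along `φ` to a sequence `g`, then
an element of `ker φ` which lies in `A₊ • φ⁻¹ I` lies in `A₊ • ker φ`, up to arbitrarily high
powers of `A₊`. -/
theorem mem_sup_pow_of_mem_ker {φ : MvPolynomial τ' K →ₐ[K] MvPolynomial τ K}
    {I : Ideal (MvPolynomial τ K)} {g : ι → MvPolynomial τ' K}
    (hg : ∀ i, constantCoeff (g i) = 0)
    (hqr : ∀ (N : ℕ) (Φ : MvPolynomial ι (MvPolynomial τ K)), Φ.IsHomogeneous N →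
      eval (fun i => φ (g i)) Φ ∈ I ^ (N + 1) → ∀ α, coeff α Φ ∈ I)
    (hcomap : I.comap φ ≤ RingHom.ker φ ⊔ Ideal.span (Set.range g))
    {x : MvPolynomial τ' K} (hx : x ∈ RingHom.ker φ)
    (hx' : x ∈ idealOfVars τ' K * I.comap φ) (N : ℕ) :
    x ∈ idealOfVars τ' K * RingHom.ker φ ⊔ Ideal.span (Set.range g) ^ (N + 1) := by
  set J := Ideal.span (Set.range g) with hJ
  have hJle : J ≤ idealOfVars τ' K := by
    refine Ideal.span_le.2 ?_
    rintro _ ⟨i, rfl⟩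
    exact (mem_idealOfVars_iff _).2 (hg i)
  induction N with
  | zero =>
    have h1 : idealOfVars τ' K * I.comap φ ≤
        idealOfVars τ' K * RingHom.ker φ ⊔ J ^ (0 + 1) := by
      refine (Ideal.mul_mono_right hcomap).trans ?_
      rw [Ideal.mul_sup, zero_add, pow_one]
      exact sup_le_sup_left (Ideal.mul_le_right : idealOfVars τ' K * J ≤ J) _
    exact h1 hx'
  | succ N ih =>
    obtain ⟨y, hy, z, hz, hyz⟩ := Submodule.mem_sup.1 ih
    have hyK : y ∈ RingHom.ker φ := (Ideal.mul_le_right :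
      idealOfVars τ' K * RingHom.ker φ ≤ RingHom.ker φ) hy
    have hzK : φ z = 0 := by
      have : z = x - y := by rw [← hyz]; ring
      rw [this, map_sub, RingHom.mem_ker.1 hx, RingHom.mem_ker.1 hyK, sub_zero]
    obtain ⟨Ψ, hΨ, hΨz⟩ := (Ideal.mem_span_pow_iff_exists_isHomogeneous _ _).1 hz
    have hcoeff : ∀ α, coeff α Ψ ∈ I.comap φ := by
      intro α
      have h2 := hqr (N + 1) (map (φ : MvPolynomial τ' K →+* MvPolynomial τ K) Ψ) (hΨ.map _) (by
        rw [eval_map_algHom, hΨz, hzK]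
        exact Ideal.zero_mem _) α
      rw [coeff_map] at h2
      exact h2
    rw [← hyz]
    refine Ideal.add_mem _ (Ideal.mem_sup_left hy) ?_
    rw [← hΨz, eval_eq]
    refine Ideal.sum_mem _ fun α hα => ?_
    have hpow : ∏ i ∈ α.support, g i ^ α i ∈ J ^ (N + 1) := by
      rw [Ideal.mem_span_pow_iff_exists_isHomogeneous]
      refine ⟨monomial α 1, isHomogeneous_monomial _ ?_, ?_⟩
      · rw [← hΨ (mem_support_iff.1 hα), Finsupp.weight_apply, Finsupp.degree_apply]
        simp [Finsupp.sum]
      · rw [eval_monomial, one_mul]; rfl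
    obtain ⟨κ, hκ, j, hj, hκj⟩ := Submodule.mem_sup.1 (hcomap (hcoeff α))
    rw [← hκj, add_mul]
    refine Ideal.add_mem _ (Ideal.mem_sup_left ?_) (Ideal.mem_sup_right ?_)
    · rw [mul_comm κ]
      refine Ideal.mul_mem_mul (hJle ?_) hκ
      exact (Ideal.pow_le_self (Nat.succ_ne_zero N) : J ^ (N + 1) ≤ J) hpow
    · rw [pow_succ' J (N + 1)]
      exact Ideal.mul_mem_mul hj hpow

end KeyLemma

section ConormalExtension

variable {K : Type} [Field K] {τ τ' ι : Type} [Finite τ'] [Fintype ι]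

theorem finrank_conormal_add_card_le {I : Ideal (MvPolynomial τ K)}
    {K₁ K₂ : Ideal (MvPolynomial τ' K)} (hle : K₁ ≤ K₂)
    (hK : ∀ x ∈ K₁, x ∈ idealOfVars τ' K * K₂ → x ∈ idealOfVars τ' K * K₁)
    {φ : MvPolynomial τ' K →ₐ[K] MvPolynomial τ K} (hφ : Augmented φ)
    (hφ₁ : ∀ x ∈ K₁, φ x = 0) (hφ₂ : ∀ x ∈ K₂, φ x ∈ I)
    {g : ι → MvPolynomial τ' K} (hg : ∀ i, g i ∈ K₂)
    (hli : LinearIndependent K fun i => conormalMk I ⟨φ (g i), hφ₂ _ (hg i)⟩) :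
    Module.finrank K (Conormal K₁) + Fintype.card ι ≤ Module.finrank K (Conormal K₂) := by
  let α : Conormal K₁ →ₗ[K] Conormal K₂ :=
    conormalMap (AlgHom.id K (MvPolynomial τ' K)) augmented_id hle
  let β : (ι → K) →ₗ[K] Conormal K₂ :=
    Fintype.linearCombination K fun i => conormalMk K₂ ⟨g i, hg i⟩
  let γ : Conormal K₂ →ₗ[K] Conormal I := conormalMap φ hφ hφ₂
  have hγα : ∀ x, γ (α x) = 0 := by
    intro x
    obtain ⟨x, rfl⟩ := conormalMk_surjective K₁ x
    refine (conormalMk_eq_zero _).2 ?_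
    have : φ x = 0 := hφ₁ _ x.2
    change φ x ∈ _
    rw [this]
    exact Ideal.zero_mem _
  have hγβ : ∀ a, γ (β a) = ∑ i, a i • conormalMk I ⟨φ (g i), hφ₂ _ (hg i)⟩ := by
    intro a
    rw [Fintype.linearCombination_apply, map_sum]
    simp only [map_smul]
    rfl
  have hα : ∀ x, α x = 0 → x = 0 := by
    intro x hx
    obtain ⟨x, rfl⟩ := conormalMk_surjective K₁ x
    exact (conormalMk_eq_zero x).2 (hK _ x.2 ((conormalMk_eq_zero _).1 hx))
  have hinj : Function.Injective (α.coprod β) := by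
    rw [← LinearMap.ker_eq_bot, LinearMap.ker_eq_bot']
    rintro ⟨x, a⟩ hxa
    rw [LinearMap.coprod_apply] at hxa
    have h1 := congrArg γ hxa
    rw [map_add, hγα, zero_add, hγβ, map_zero] at h1
    have h2 : a = 0 := funext (Fintype.linearIndependent_iff.1 hli a h1)
    subst h2
    rw [map_zero, add_zero] at hxa
    rw [hα x hxa]; rfl
  have := LinearMap.finrank_le_finrank_of_injective hinj
  rwa [Module.finrank_prod, Module.finrank_fintype_fun_eq_card] at this

end ConormalExtension

section SecondQuotient

variable {k : Type} [Field k] {n m m₃ : ℕ}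
  {Wt G H : Subgroup (Matrix.GeneralLinearGroup (Fin n) k)}
  {q : Fin m → MvPolynomial (Fin n) k} {d : Fin m → ℕ} {c : ↥Wt → Fin m → Fin m → k}
  {r : Fin m₃ → MvPolynomial (Fin m) k} {e : Fin m₃ → ℕ} {c₃ : ↥Wt → Fin m₃ → Fin m₃ → k}

/-- The action of the elements of `G` on the ambient polynomial ring of a presentation. -/
def GoodSetup.midAction (h : GoodSetup Wt H q d c)
    (G : Subgroup (Matrix.GeneralLinearGroup (Fin n) k)) :
    ↥(G.subgroupOf Wt) →* (MvPolynomial (Fin m) k →ₐ[k] MvPolynomial (Fin m) k) :=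
  (actionHom (groupAct Wt) q h.linearIndependent c h.equivar).comp (G.subgroupOf Wt).subtype

theorem GoodSetup.midAction_apply (h : GoodSetup Wt H q d c)
    (G : Subgroup (Matrix.GeneralLinearGroup (Fin n) k)) (g : ↥(G.subgroupOf Wt)) :
    h.midAction G g = polyAct (c g) := rfl

theorem GoodSetup.avg_mem_invariantsMid (h : GoodSetup Wt H q d c)
    (G : Subgroup (Matrix.GeneralLinearGroup (Fin n) k)) [Fintype ↥(G.subgroupOf Wt)]
    (f : MvPolynomial (Fin m) k) : avg (h.midAction G) f ∈ invariantsMid c G :=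
  fun w hw => map_avg (h.midAction G) ⟨w, Subgroup.mem_subgroupOf.2 hw⟩ f

theorem GoodSetup.avg_eq_self_of_mem [CharZero k] (h : GoodSetup Wt H q d c)
    {G : Subgroup (Matrix.GeneralLinearGroup (Fin n) k)} [Fintype ↥(G.subgroupOf Wt)]
    {f : MvPolynomial (Fin m) k} (hf : f ∈ invariantsMid c G) : avg (h.midAction G) f = f :=
  avg_eq_self _ fun g => hf g (Subgroup.mem_subgroupOf.1 g.2)

theorem GoodSetup.aeval_polyAct (h : GoodSetup Wt H q d c) (w : ↥Wt)
    (f : MvPolynomial (Fin m) k) : aeval q (polyAct (c w) f) = matAct w (aeval q f) :=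
  ReflQuot.aeval_polyAct (fun i => h.equivar w i) f

/-- Generators of the invariants of `G / H` give generators of the invariants of `G`. -/
theorem GoodSetup.adjoin_aeval_eq [CharZero k] (h : GoodSetup Wt H q d c) (hHG : H ≤ G)
    (hGW : G ≤ Wt) (hr : Algebra.adjoin k (Set.range r) = invariantsMid c G) :
    Algebra.adjoin k (Set.range fun i => aeval q (r i)) = invariants G := by
  have : Finite ↥Wt := h.finite
  have := Fintype.ofFinite ↥(G.subgroupOf Wt)
  apply le_antisymm
  · refine Algebra.adjoin_le ?_
    rintro _ ⟨i, rfl⟩ g hg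
    have hri : r i ∈ invariantsMid c G := hr ▸ Algebra.subset_adjoin ⟨i, rfl⟩
    change matAct g (aeval q (r i)) = aeval q (r i)
    conv_rhs => rw [← hri ⟨g, hGW hg⟩ hg]
    exact (h.aeval_polyAct ⟨g, hGW hg⟩ (r i)).symm
  · intro f hf
    have hfH : f ∈ invariants H := fun g hg => hf g (hHG hg)
    rw [← h.gen, Algebra.adjoin_range_eq_range_aeval] at hfH
    obtain ⟨F, hF⟩ := hfH
    have h1 := map_avg_of_comm (h.midAction G)
      ((groupAct Wt).comp (G.subgroupOf Wt).subtype) (aeval q)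
      (fun g f => h.aeval_polyAct g f) F
    have hF' : aeval q F = f := hF
    have h0 : avg ((groupAct Wt).comp (G.subgroupOf Wt).subtype) f = f :=
      avg_eq_self _ fun g => hf g (Subgroup.mem_subgroupOf.1 g.2)
    rw [hF', h0] at h1
    have h2 := h.avg_mem_invariantsMid G F
    rw [← hr, Algebra.adjoin_range_eq_range_aeval] at h2
    obtain ⟨Φ, hΦ⟩ := h2
    have hΦ' : aeval r Φ = avg (h.midAction G) F := hΦ
    rw [← hΦ'] at h1
    rw [Algebra.adjoin_range_eq_range_aeval]
    refine ⟨Φ, ?_⟩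
    rw [← h1]
    exact (comp_aeval_apply r (aeval q) Φ).symm

theorem QuotSetup2.constantCoeff_eq (hr : QuotSetup2 c G d r e c₃) (i : Fin m₃) :
    constantCoeff (r i) = 0 :=
  constantCoeff_eq_zero_of_isHomogeneous (hr.homog i) (hr.epos i)

theorem QuotSetup2.augmented (hr : QuotSetup2 c G d r e c₃) :
    Augmented (aeval r : MvPolynomial (Fin m₃) k →ₐ[k] _) := fun i => by
  rw [aeval_X, hr.constantCoeff_eq]

theorem QuotSetup2.relIdeal_le_sq (hr : QuotSetup2 c G d r e c₃) :
    relIdeal r ≤ idealOfVars (Fin m₃) k ^ 2 :=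
  ReflQuot.relIdeal_le_sq (C := invariantsMid c G)
    (fun i => by rw [← hr.gen]; exact Algebra.subset_adjoin ⟨i, rfl⟩) hr.constantCoeff_eq
    hr.minimal

theorem ker_aeval_comp (q : Fin m → MvPolynomial (Fin n) k) (r : Fin m₃ → MvPolynomial (Fin m) k) :
    (relIdeal q).comap (aeval r : MvPolynomial (Fin m₃) k →ₐ[k] _) =
      RingHom.ker (aeval (fun i => aeval q (r i)) : MvPolynomial (Fin m₃) k →ₐ[k] _) := by
  ext f
  rw [Ideal.mem_comap, relIdeal, RingHom.mem_ker, RingHom.mem_ker, comp_aeval_apply]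

/-- If `H ≤ G` are good normal subgroups, then `G / H` is good in `Wt / H`. -/
theorem QuotSetup2.isGoodQuot2 [CharZero k] (hr : QuotSetup2 c G d r e c₃)
    (h : GoodSetup Wt H q d c)
    (hs : GoodFamily n (Wt : Set _) fun i => aeval q (r i)) : IsGoodQuot2 c₃ r := by
  have : Finite ↥Wt := h.finite
  have := Fintype.ofFinite ↥(G.subgroupOf Wt)
  obtain ⟨s, f, hf, hsn, -, hfix, hli, hspan⟩ := h.exists_invariant_generators
  have hex : ∀ i, ∃ g, aeval r g = f i := fun i => by
    have : f i ∈ invariantsMid c G := fun w _ => hfix w i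
    rw [← hr.gen, Algebra.adjoin_range_eq_range_aeval] at this
    exact this
  choose g hg using hex
  have hq : relIdeal q ≤ idealOfVars (Fin m) k :=
    h.minimal.trans (Ideal.pow_le_self two_ne_zero)
  have hg0 : ∀ i, constantCoeff (g i) = 0 := fun i => by
    rw [← hr.augmented.constantCoeff_apply, hg, ← mem_idealOfVars_iff]
    exact hq (hf i)
  have hcomap : (relIdeal q).comap (aeval r : MvPolynomial (Fin m₃) k →ₐ[k] _) ≤
      RingHom.ker (aeval r : MvPolynomial (Fin m₃) k →ₐ[k] _) ⊔ Ideal.span (Set.range g) := by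
    intro Φ hΦ
    rw [Ideal.mem_comap, ← hspan] at hΦ
    obtain ⟨a, ha⟩ := (Submodule.mem_span_range_iff_exists_fun _).1 hΦ
    have hinv : aeval r Φ ∈ invariantsMid c G := by
      rw [← hr.gen, Algebra.adjoin_range_eq_range_aeval]
      exact ⟨Φ, rfl⟩
    have hav : ∀ i, ∃ b, aeval r b = avg (h.midAction G) (a i) := fun i => by
      have := h.avg_mem_invariantsMid G (a i)
      rw [← hr.gen, Algebra.adjoin_range_eq_range_aeval] at this
      exact this
    choose b hb using hav
    have h1 : aeval r Φ = ∑ i, avg (h.midAction G) (a i) * f i := by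
      rw [← h.avg_eq_self_of_mem hinv, ← ha, map_sum]
      refine Finset.sum_congr rfl fun i _ => ?_
      rw [avg_apply, avg_apply, smul_mul_assoc, Finset.sum_mul]
      congr 1
      refine Finset.sum_congr rfl fun w _ => ?_
      rw [smul_eq_mul, map_mul, h.midAction_apply, hfix]
    have h2 : Φ - ∑ i, b i * g i ∈
        RingHom.ker (aeval r : MvPolynomial (Fin m₃) k →ₐ[k] MvPolynomial (Fin m) k) := by
      rw [RingHom.mem_ker, map_sub, h1, map_sum, sub_eq_zero]
      simp only [map_mul, hb, hg]
    rw [← sub_add_cancel Φ (∑ i, b i * g i)]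
    exact Ideal.add_mem _ (Ideal.mem_sup_left h2) (Ideal.mem_sup_right
      (Ideal.sum_mem _ fun i _ => Ideal.mul_mem_left _ _ (Ideal.subset_span ⟨i, rfl⟩)))
  have hgJ : Ideal.span (Set.range g) ≤ idealOfVars (Fin m₃) k := by
    refine Ideal.span_le.2 ?_
    rintro _ ⟨i, rfl⟩
    exact (mem_idealOfVars_iff _).2 (hg0 i)
  have hgf : (fun i => aeval r (g i)) = f := funext hg
  have hJac := mem_ker_of_sum_mul_pderiv_mem hspan
    (by simpa only [Fintype.card_fin] using hsn)
  have hwh : WHomog e (idealOfVars (Fin m₃) k * relIdeal r) :=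
    (whomog_ker_aeval hr.homog).idealOfVars_mul
  have key : ∀ x ∈ relIdeal r, x ∈ idealOfVars (Fin m₃) k *
      (relIdeal q).comap (aeval r : MvPolynomial (Fin m₃) k →ₐ[k] _) →
      x ∈ idealOfVars (Fin m₃) k * relIdeal r := by
    intro x hx hx'
    refine hwh.mem_of_forall_mem_sup_pow hr.epos fun N => ?_
    have h1 := mem_sup_pow_of_mem_ker hg0 (fun N Φ hΦ hev α =>
      coeff_mem_of_eval_mem_pow hf hJac hΦ (by rwa [hgf] at hev) α) hcomap hx hx' N
    refine (sup_le_sup_left ?_ _ :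
      idealOfVars (Fin m₃) k * relIdeal r ⊔ Ideal.span (Set.range g) ^ (N + 1) ≤
        idealOfVars (Fin m₃) k * relIdeal r ⊔ idealOfVars (Fin m₃) k ^ N) h1
    exact (Ideal.pow_right_mono hgJ _).trans (Ideal.pow_le_pow_right N.le_succ)
  have hle : relIdeal r ≤ (relIdeal q).comap (aeval r : MvPolynomial (Fin m₃) k →ₐ[k] _) := by
    intro x hx
    rw [Ideal.mem_comap, RingHom.mem_ker.1 hx]
    exact Ideal.zero_mem _
  refine ⟨isCompleteIntersection_of_finrank_le hr.epos hr.homog ?_, fun w x hx => ?_⟩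
  · have h1 := finrank_conormal_add_card_le (I := relIdeal q) hle key hr.augmented
      (fun x hx => RingHom.mem_ker.1 hx) (fun x hx => hx)
      (g := g) (fun i => by rw [Ideal.mem_comap, hg]; exact hf i) (by simpa only [hg] using hli)
    have h2 := hs.finrank_le
    rw [← ker_aeval_comp, Fintype.card_fin] at h2
    rw [Fintype.card_fin] at h1
    have h3 := card_le_card_add_of_span_eq_ker hspan
    simp only [Fintype.card_fin] at h3
    omega
  · have h1 := ReflQuot.aeval_polyAct (fun i => hr.equivar w i)
    refine key _ ?_ ?_
    · refine Ideal.sub_mem _ ?_ hx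
      rw [relIdeal, RingHom.mem_ker, h1, RingHom.mem_ker.1 hx, map_zero]
    · rw [ker_aeval_comp]
      refine (hs.acts w w.2).trivialOnConormal (augmented_polyAct (c₃ w)) (fun f => ?_) x ?_
        (hr.relIdeal_le_sq hx)
      · rw [← comp_aeval_apply, ← comp_aeval_apply, h1, h.aeval_polyAct]
      · rw [← ker_aeval_comp]
        exact hle hx

end SecondQuotient

/-- let `G` be good in `Wt` and `Vt = V1 ⊕ V2` a decomposition into
`Wt`-stable subspaces, `Wt_1, Wt_2` the pointwise stabilizers of `V2, V1`, and
`G_i = G ∩ Wt_i`. Then `G_1` is good in `Wt_1`, `G_2` is good in `Wt_2`,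
`G_1 × G_2` is good in `Wt`, and `G/(G_1 × G_2)` is good in `Wt/(G_1 × G_2)`. -/
theorem statement11 [CharZero k] {n m : ℕ}
    (Wt G : Subgroup (Matrix.GeneralLinearGroup (Fin n) k))
    (p : Fin m → MvPolynomial (Fin n) k) (d : Fin m → ℕ)
    (c : ↥Wt → Fin m → Fin m → k)
    (hsetup : QuotSetup Wt G p d c)
    (hgood : IsGoodQuot Wt p c)
    (V1 V2 : Submodule k (Fin n → k)) (hcompl : IsCompl V1 V2)
    (hstab1 : ∀ w ∈ Wt, ∀ x ∈ V1,
      Matrix.mulVec ((w : Matrix.GeneralLinearGroup (Fin n) k) :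
        Matrix (Fin n) (Fin n) k) x ∈ V1)
    (hstab2 : ∀ w ∈ Wt, ∀ x ∈ V2,
      Matrix.mulVec ((w : Matrix.GeneralLinearGroup (Fin n) k) :
        Matrix (Fin n) (Fin n) k) x ∈ V2) :
    -- `G_1` is a good normal subgroup of `Wt_1`
    (∀ (m' : ℕ) (p' : Fin m' → MvPolynomial (Fin n) k) (d' : Fin m' → ℕ)
        (c' : ↥(Wt ⊓ pointStab V2) → Fin m' → Fin m' → k),
        QuotSetup (Wt ⊓ pointStab V2) (G ⊓ pointStab V2) p' d' c' →
        IsGoodQuot (Wt ⊓ pointStab V2) p' c')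
    -- `G_2` is a good normal subgroup of `Wt_2`
    ∧ (∀ (m' : ℕ) (p' : Fin m' → MvPolynomial (Fin n) k) (d' : Fin m' → ℕ)
        (c' : ↥(Wt ⊓ pointStab V1) → Fin m' → Fin m' → k),
        QuotSetup (Wt ⊓ pointStab V1) (G ⊓ pointStab V1) p' d' c' →
        IsGoodQuot (Wt ⊓ pointStab V1) p' c')
    -- `G_1 × G_2` is a good normal subgroup of `Wt`
    ∧ (∀ (m2 : ℕ) (q : Fin m2 → MvPolynomial (Fin n) k) (dq : Fin m2 → ℕ)
        (cq : ↥Wt → Fin m2 → Fin m2 → k),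
        QuotSetup Wt ((G ⊓ pointStab V2) ⊔ (G ⊓ pointStab V1)) q dq cq →
        IsGoodQuot Wt q cq)
    -- `G/(G_1 × G_2)` is a good normal subgroup of `Wt/(G_1 × G_2)`, acting on the
    -- tangent space at `0` of `Vt/(G_1 × G_2)`
    ∧ (∀ (m2 : ℕ) (q : Fin m2 → MvPolynomial (Fin n) k) (dq : Fin m2 → ℕ)
        (cq : ↥Wt → Fin m2 → Fin m2 → k),
        QuotSetup Wt ((G ⊓ pointStab V2) ⊔ (G ⊓ pointStab V1)) q dq cq →
        ∀ (m3 : ℕ) (r : Fin m3 → MvPolynomial (Fin m2) k) (e : Fin m3 → ℕ)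
          (c3 : ↥Wt → Fin m3 → Fin m3 → k),
          QuotSetup2 cq G dq r e c3 → IsGoodQuot2 c3 r) := by
  have h := hsetup.goodSetup hgood
  obtain ⟨E₁, E₂, hE, rfl, rfl⟩ := exists_splitting hcompl hstab1 hstab2
  have h12 : ∀ (m2 : ℕ) (q : Fin m2 → MvPolynomial (Fin n) k) (dq : Fin m2 → ℕ)
      (cq : ↥Wt → Fin m2 → Fin m2 → k),
      QuotSetup Wt ((G ⊓ fixSub E₂) ⊔ (G ⊓ fixSub E₁)) q dq cq → IsGoodQuot Wt q cq := by
    intro m2 q dq cq hq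
    obtain ⟨u, hu, hadj⟩ := h.exists_goodFamily_sup hE
    have hcl := hE.le_closure hsetup.reflGroup
    have hu' := hu.closure (by rw [hcl]; exact hsetup.finite)
    exact hq.isGoodQuot_of_goodFamily hu' hadj (by rw [hcl])
  refine ⟨fun m' p' d' c' h' => ?_, fun m' p' d' c' h' => ?_, h12,
    fun m2 q dq cq hq m3 r e c3 hr => ?_⟩
  · obtain ⟨u, hu, hadj⟩ := h.exists_goodFamily_left hE
    exact h'.isGoodQuot_of_goodFamily hu hadj subset_rfl
  · obtain ⟨u, hu, hadj⟩ := h.exists_goodFamily_left hE.symm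
    exact h'.isGoodQuot_of_goodFamily hu hadj subset_rfl
  · have hq' := hq.goodSetup (h12 m2 q dq cq hq)
    refine hr.isGoodQuot2 hq' (h.goodFamily.of_adjoin_eq (fun i => ?_) ?_)
    · have haug : Augmented (aeval q : MvPolynomial (Fin m2) k →ₐ[k] _) := fun j => by
        rw [aeval_X, hq.constantCoeff_eq]
      rw [haug.constantCoeff_apply, hr.constantCoeff_eq]
    · rw [h.gen, hq'.adjoin_aeval_eq (sup_le inf_le_left inf_le_left) h.le hr.gen]

end ReflQuot
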